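/- Let d ≥ 3 and p ∈ (p_c^site(ℤ^d), 1 − p_c^site(ℤ^d)). There exist δ > 0, an integer k ≥ 1 and an even integer h₀ ≥ 2 such that for every m ≥ 1, the ℙ_p^{h₀}-probability that there exists a word ξ ∈ Ξ which is not seen from any vertex of ∂Λ_{m+1} within the slab 𝕊_{h₀} is at most e^{−m}. -/

import Mathlib

open MeasureTheory Set

namespace PercWords

/-- Vertices of the hypercubic lattice `ℤ^d`. -/
abbrev Vtx (d : ℕ) := Fin d → ℤ

/-- Site percolation configurations on `ℤ^d` (`true` = state 1, `false` = state 0). -/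
abbrev Config (d : ℕ) := Vtx d → Bool

/-- `u ∼ v` : the Euclidean distance between `u` and `v` is `1`. -/
def adj {d : ℕ} (u v : Vtx d) : Prop := (∑ i, (u i - v i) ^ 2) = 1

/-- `μ` is Bernoulli site percolation with parameter `p` on the index set `ι`:
a probability measure under which, independently, each site has state `true`
with probability `p` and state `false` with probability `1 - p`. -/
def IsBernoulliFam {ι : Type} (p : ℝ) (μ : Measure (ι → Bool)) : Prop :=
  IsProbabilityMeasure μ ∧
    ∀ (s : Finset ι) (f : ι → Bool),
      μ {ω | ∀ v ∈ s, ω v = f v} =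
        ∏ v ∈ s, ENNReal.ofReal (if f v then p else 1 - p)

/-- The word `ξ` is seen from `v` along an infinite self-avoiding path all of whose
vertices lie in `A`. -/
def seesWordIn {d : ℕ} (ω : Config d) (ξ : ℕ → Bool) (A : Set (Vtx d)) (v : Vtx d) : Prop :=
  ∃ γ : ℕ → Vtx d, γ 0 = v ∧ Function.Injective γ ∧
    (∀ i, adj (γ i) (γ (i + 1))) ∧ (∀ i, γ i ∈ A) ∧ (∀ i, ω (γ i) = ξ i)

/-- The word `ξ` is seen from `v` in the configuration `ω`. -/
def seesWord {d : ℕ} (ω : Config d) (ξ : ℕ → Bool) (v : Vtx d) : Prop :=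
  seesWordIn ω ξ Set.univ v

/-- `v` lies in an infinite connected set of `1`-vertices of `ω`. -/
def PercolatesAt {d : ℕ} (ω : Config d) (v : Vtx d) : Prop :=
  ∃ C : Set (Vtx d), v ∈ C ∧ C.Infinite ∧ (∀ u ∈ C, ω u = true) ∧
    ∀ u₁ ∈ C, ∀ u₂ ∈ C, ∃ n : ℕ, ∃ γ : ℕ → Vtx d,
      γ 0 = u₁ ∧ γ n = u₂ ∧ (∀ i < n, adj (γ i) (γ (i + 1))) ∧ (∀ i ≤ n, γ i ∈ C)

/-- The critical point of Bernoulli site percolation on `ℤ^d`, relative to a family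
`ℙ p` of Bernoulli site percolation measures: the infimum of the set of parameters
for which the origin lies in an infinite connected set of `1`-vertices with positive
probability. -/
noncomputable def pcSite (d : ℕ) (ℙ : ℝ → Measure (Config d)) : ℝ :=
  sInf {p : ℝ | p ∈ Set.Icc (0 : ℝ) 1 ∧ 0 < ℙ p {ω | PercolatesAt ω (fun _ => 0)}}

/-- The slab `𝕊_h = ℤ² × (0, hk] × (−k, k]^{d−3}` inside `ℤ^d`. -/
def slabS (d k h : ℕ) : Set (Vtx d) :=
  {x | ∀ i : Fin d,
    ((i : ℕ) = 2 → 0 < x i ∧ x i ≤ (h : ℤ) * (k : ℤ)) ∧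
    (3 ≤ (i : ℕ) → -(k : ℤ) < x i ∧ x i ≤ (k : ℤ))}

/-- The box `Λ_n = [−kn, kn]² × (0, hk] × (−k, k]^{d−3}`. -/
def lamBox (d k h n : ℕ) : Set (Vtx d) :=
  {x | x ∈ slabS d k h ∧ ∀ i : Fin d, (i : ℕ) ≤ 1 → |x i| ≤ (k : ℤ) * (n : ℤ)}

/-- The inner vertex boundary `∂Λ_n` of `Λ_n` with respect to the slab `𝕊_h`. -/
def lamBdry (d k h n : ℕ) : Set (Vtx d) :=
  {x | x ∈ lamBox d k h n ∧ ∃ y, adj x y ∧ y ∈ slabS d k h ∧ y ∉ lamBox d k h n}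


section reach
variable {V : Type*} (g : V → V → Prop)

inductive Reach (A O : Set V) : V → Prop
  | base (v : V) : v ∈ A → Reach A O v
  | step (v w : V) : Reach A O v → g v w → w ∈ O → Reach A O w

variable {g}
theorem Reach.mono {A A' O O' : Set V} (hA : A ⊆ A') (hO : O ⊆ O') {v : V}
    (h : Reach g A O v) : Reach g A' O' v := by
  induction h with
  | base v h => exact .base v (hA h)
  | step v w _ hg hw ih => exact .step v w ih hg (hO hw)

theorem Reach.bind {A B O : Set V} (h : ∀ v ∈ A, Reach g B O v) {v : V}
    (hv : Reach g A O v) : Reach g B O v := by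
  induction hv with
  | base v hv => exact h v hv
  | step v w _ hg hw ih => exact .step v w ih hg hw

theorem Reach.mem {A O : Set V} {v : V} (h : Reach g A O v) : v ∈ A ∨ v ∈ O := by
  cases h with
  | base _ h => exact .inl h
  | step _ _ _ _ h => exact .inr h

theorem reach_insert {A O : Set V} {v a : V} (ha : a ∈ A) (hav : g a v) (w : V) :
    Reach g A (insert v O) w ↔ Reach g (insert v A) O w := by
  constructor
  · intro h
    induction h with
    | base w hw => exact .base w (mem_insert_of_mem _ hw)
    | step x w _ hg hw ih =>
      rcases hw with rfl | hw
      · exact .base _ (mem_insert _ _)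
      · exact .step x w ih hg hw
  · intro h
    induction h with
    | base w hw =>
      rcases hw with rfl | hw
      · exact .step a _ (.base a ha) hav (mem_insert _ _)
      · exact .base w hw
    | step x w _ hg hw ih => exact .step x w ih hg (mem_insert_of_mem _ hw)

theorem reach_stuck {A O : Set V} (h : ∀ a ∈ A, ∀ v ∈ O, g a v → v ∈ A) {w : V}
    (hw : Reach g A O w) : w ∈ A := by
  induction hw with
  | base w hw => exact hw
  | step x w _ hg hw ih => exact h x ih w hw hg

theorem Reach.map {V' : Type*} {g' : V' → V' → Prop} (e : V → V')
    (hg : ∀ a b, g a b → g' (e a) (e b)) {A O : Set V} {v : V} (h : Reach g A O v) :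
    Reach g' (e '' A) (e '' O) (e v) := by
  induction h with
  | base v h => exact .base _ (mem_image_of_mem _ h)
  | step v w _ h hw ih => exact .step _ _ ih (hg _ _ h) (mem_image_of_mem _ hw)

end reach

section ex
variable {V : Type*} [DecidableEq V]

noncomputable def ex (r : V → ℝ) (R : Finset V) (F : Finset V → ℝ) : ℝ :=
  ∑ O ∈ R.powerset, (∏ v ∈ O, r v) * (∏ v ∈ R \ O, (1 - r v)) * F O

theorem ex_empty (r : V → ℝ) (F : Finset V → ℝ) : ex r ∅ F = F ∅ := by simp [ex]

theorem ex_insert (r : V → ℝ) {R : Finset V} {v : V} (hv : v ∉ R) (F : Finset V → ℝ) :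
    ex r (insert v R) F
      = r v * ex r R (fun O => F (insert v O)) + (1 - r v) * ex r R F := by
  unfold ex
  rw [Finset.sum_powerset_insert hv, Finset.mul_sum, Finset.mul_sum, add_comm]
  congr 1
  · refine Finset.sum_congr rfl fun O hO => ?_
    have hO' := Finset.mem_powerset.1 hO
    have hvO : v ∉ O := fun h => hv (hO' h)
    rw [Finset.prod_insert hvO, Finset.insert_sdiff_insert, Finset.sdiff_insert_of_notMem hv]
    ring
  · refine Finset.sum_congr rfl fun O hO => ?_
    have hO' := Finset.mem_powerset.1 hO
    have hvO : v ∉ O := fun h => hv (hO' h)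
    rw [Finset.insert_sdiff_of_notMem _ hvO, Finset.prod_insert (by simp [hv])]
    ring

theorem ex_congr {r r' : V → ℝ} {R : Finset V} {F G : Finset V → ℝ}
    (hr : ∀ v ∈ R, r v = r' v) (h : ∀ O ⊆ R, F O = G O) : ex r R F = ex r' R G := by
  refine Finset.sum_congr rfl fun O hO => ?_
  have hO := Finset.mem_powerset.1 hO
  rw [h O hO, Finset.prod_congr rfl fun v hv => hr v (hO hv),
    Finset.prod_congr rfl fun v (hv : v ∈ R \ O) => by rw [hr v (Finset.mem_sdiff.1 hv).1]]

theorem ex_mono {r : V → ℝ} {R : Finset V} {F G : Finset V → ℝ}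
    (h0 : ∀ v ∈ R, 0 ≤ r v) (h1 : ∀ v ∈ R, r v ≤ 1) (h : ∀ O ⊆ R, F O ≤ G O) :
    ex r R F ≤ ex r R G := by
  refine Finset.sum_le_sum fun O hO => ?_
  have hO := Finset.mem_powerset.1 hO
  refine mul_le_mul_of_nonneg_left (h O hO) (mul_nonneg ?_ ?_)
  · exact Finset.prod_nonneg fun v hv => h0 v (hO hv)
  · exact Finset.prod_nonneg fun v hv => by linarith [h1 v (Finset.mem_sdiff.1 hv).1]

theorem ex_const (r : V → ℝ) (R : Finset V) (c : ℝ) : ex r R (fun _ => c) = c := by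
  induction R using Finset.induction with
  | empty => rw [ex_empty]
  | insert v R hv ih => rw [ex_insert r hv, ih]; ring

theorem ex_add (r : V → ℝ) (R : Finset V) (F G : Finset V → ℝ) :
    ex r R (fun O => F O + G O) = ex r R F + ex r R G := by
  simp only [ex, mul_add, Finset.sum_add_distrib]

theorem ex_mul (r : V → ℝ) (R : Finset V) (F : Finset V → ℝ) (c : ℝ) :
    ex r R (fun O => c * F O) = c * ex r R F := by
  simp only [ex, Finset.mul_sum]; exact Finset.sum_congr rfl fun _ _ => by ring

theorem ex_sub (r : V → ℝ) (R : Finset V) (F G : Finset V → ℝ) :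
    ex r R (fun O => F O - G O) = ex r R F - ex r R G := by
  simp only [ex, mul_sub, Finset.sum_sub_distrib]

theorem ex_sum {ι : Type*} (r : V → ℝ) (R : Finset V) (s : Finset ι) (F : ι → Finset V → ℝ) :
    ex r R (fun O => ∑ i ∈ s, F i O) = ∑ i ∈ s, ex r R (F i) := by
  simp only [ex, Finset.mul_sum]; exact Finset.sum_comm

theorem ex_le {r : V → ℝ} {R : Finset V} {F : Finset V → ℝ} {c : ℝ}
    (h0 : ∀ v ∈ R, 0 ≤ r v) (h1 : ∀ v ∈ R, r v ≤ 1) (h : ∀ O ⊆ R, F O ≤ c) :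
    ex r R F ≤ c := (ex_mono h0 h1 h).trans_eq (ex_const r R c)

theorem le_ex {r : V → ℝ} {R : Finset V} {F : Finset V → ℝ} {c : ℝ}
    (h0 : ∀ v ∈ R, 0 ≤ r v) (h1 : ∀ v ∈ R, r v ≤ 1) (h : ∀ O ⊆ R, c ≤ F O) :
    c ≤ ex r R F := (ex_const r R c).symm.trans_le (ex_mono h0 h1 h)

theorem ex_mono_r {r r' : V → ℝ} {R : Finset V} {F : Finset V → ℝ} (hF : Monotone F)
    (h0 : ∀ v ∈ R, 0 ≤ r v) (h : ∀ v ∈ R, r v ≤ r' v) (h1 : ∀ v ∈ R, r' v ≤ 1) :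
    ex r R F ≤ ex r' R F := by
  induction R using Finset.induction generalizing F with
  | empty => simp [ex_empty]
  | insert v R hv ih =>
    simp only [Finset.mem_insert, forall_eq_or_imp] at h0 h h1
    rw [ex_insert r hv, ex_insert r' hv]
    have a := ih hF h0.2 h.2 h1.2
    have b := ih (F := fun O => F (insert v O))
      (fun O O' hO => hF (Finset.insert_subset_insert _ hO)) h0.2 h.2 h1.2
    have c : ex r' R F ≤ ex r' R (fun O => F (insert v O)) :=
      ex_mono (fun x hx => (h0.2 x hx).trans (h.2 x hx)) h1.2
        fun O _ => hF (Finset.subset_insert _ _)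
    nlinarith [h0.1, h.1, h1.1]

theorem ex_harris {r : V → ℝ} {R : Finset V} {F G : Finset V → ℝ}
    (h0 : ∀ v ∈ R, 0 ≤ r v) (h1 : ∀ v ∈ R, r v ≤ 1) (hF : Antitone F) (hG : Antitone G) :
    ex r R F * ex r R G ≤ ex r R (fun O => F O * G O) := by
  induction R using Finset.induction generalizing F G with
  | empty => simp [ex_empty]
  | insert v R hv ih =>
    simp only [Finset.mem_insert, forall_eq_or_imp] at h0 h1
    rw [ex_insert r hv, ex_insert r hv, ex_insert r hv]
    have a := ih h0.2 h1.2 hF hG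
    have hF' : Antitone fun O => F (insert v O) :=
      fun O O' hO => hF (Finset.insert_subset_insert _ hO)
    have hG' : Antitone fun O => G (insert v O) :=
      fun O O' hO => hG (Finset.insert_subset_insert _ hO)
    have b := ih h0.2 h1.2 hF' hG'
    have c : ex r R (fun O => F (insert v O)) ≤ ex r R F :=
      ex_mono h0.2 h1.2 fun O _ => hF (Finset.subset_insert _ _)
    have c' : ex r R (fun O => G (insert v O)) ≤ ex r R G :=
      ex_mono h0.2 h1.2 fun O _ => hG (Finset.subset_insert _ _)
    have d := mul_nonneg (mul_nonneg h0.1 (sub_nonneg.2 h1.1))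
      (mul_nonneg (sub_nonneg.2 c) (sub_nonneg.2 c'))
    have a' := mul_le_mul_of_nonneg_left a (sub_nonneg.2 h1.1)
    have b' := mul_le_mul_of_nonneg_left b h0.1
    nlinarith

theorem ex_union (r : V → ℝ) {R₁ R₂ : Finset V} (h : Disjoint R₁ R₂) (F : Finset V → ℝ) :
    ex r (R₁ ∪ R₂) F = ex r R₁ (fun O₁ => ex r R₂ (fun O₂ => F (O₁ ∪ O₂))) := by
  induction R₁ using Finset.induction generalizing F with
  | empty => simp [ex_empty]
  | insert v R hv ih =>
    rw [Finset.disjoint_insert_left] at h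
    rw [Finset.insert_union, ex_insert r (by simp [hv, h.1]), ih h.2, ih h.2, ex_insert r hv]
    simp only [Finset.insert_union]

theorem ex_map {V' : Type*} [DecidableEq V'] (e : V ≃ V') (r : V' → ℝ) (R : Finset V)
    (F : Finset V' → ℝ) :
    ex r (R.map e.toEmbedding) F = ex (r ∘ e) R (fun O => F (O.map e.toEmbedding)) := by
  induction R using Finset.induction generalizing F with
  | empty => simp [ex_empty]
  | insert v R hv ih =>
    rw [Finset.map_insert, ex_insert r (by simpa using hv), ih, ih, ex_insert _ hv]
    simp only [Finset.map_insert]; rfl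

theorem ex_dep (r : V → ℝ) {R₁ R : Finset V} (h : R₁ ⊆ R) {F : Finset V → ℝ}
    (hF : ∀ O ⊆ R, F O = F (O ∩ R₁)) : ex r R F = ex r R₁ F := by
  conv_lhs => rw [← Finset.union_sdiff_of_subset h, ex_union r Finset.disjoint_sdiff]
  refine ex_congr (fun _ _ => rfl) fun O hO => ?_
  rw [ex_congr (G := fun _ => F O) (fun _ _ => rfl), ex_const]
  intro O₂ h₂
  rw [hF _ (Finset.union_subset (hO.trans h) (h₂.trans Finset.sdiff_subset))]
  congr 1
  ext x
  simp only [Finset.mem_inter, Finset.mem_union]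
  constructor
  · rintro ⟨h | h, hx⟩
    · exact h
    · exact absurd hx (Finset.mem_sdiff.1 (h₂ h)).2
  · intro h; exact ⟨.inl h, hO h⟩

/-- probability that none of the vertices of `G` is open -/
theorem ex_none (r : V → ℝ) {R G : Finset V} (h : G ⊆ R) :
    ex r R (fun O => if Disjoint O G then 1 else 0) = ∏ v ∈ G, (1 - r v) := by
  rw [ex_dep r h]
  · clear h
    induction G using Finset.induction with
    | empty => simp [ex_empty]
    | insert v G hv ih =>
      rw [ex_insert r hv, Finset.prod_insert hv, ← ih]
      simp only [Finset.disjoint_insert_left, Finset.mem_insert_self, not_true, false_and,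
        if_false, ex_const, mul_zero, zero_add]
      congr 1
      refine ex_congr (fun _ _ => rfl) fun O hO => ?_
      simp [Finset.disjoint_insert_right, show v ∉ O from fun h => hv (hO h)]
  · intro O _
    congr 1
    simp only [Finset.disjoint_left, Finset.mem_inter, eq_iff_iff]
    exact ⟨fun H x hx => H hx.1, fun H x hx hG => H ⟨hx, hG⟩ hG⟩

open Classical in
noncomputable def pr (r : V → ℝ) (R : Finset V) (φ : Finset V → Prop) : ℝ :=
  ex r R (fun O => if φ O then 1 else 0)

open Classical in
theorem pr_mono {r : V → ℝ} {R : Finset V} {φ ψ : Finset V → Prop}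
    (h0 : ∀ v ∈ R, 0 ≤ r v) (h1 : ∀ v ∈ R, r v ≤ 1) (h : ∀ O ⊆ R, φ O → ψ O) :
    pr r R φ ≤ pr r R ψ := by
  refine ex_mono h0 h1 fun O hO => ?_
  have := h O hO
  split_ifs <;> simp_all

theorem pr_congr {r : V → ℝ} {R : Finset V} {φ ψ : Finset V → Prop}
    (h : ∀ O ⊆ R, φ O ↔ ψ O) : pr r R φ = pr r R ψ :=
  ex_congr (fun _ _ => rfl) fun O hO => by
    have := h O hO
    by_cases a : φ O <;> simp_all

theorem pr_nonneg {r : V → ℝ} {R : Finset V} {φ : Finset V → Prop}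
    (h0 : ∀ v ∈ R, 0 ≤ r v) (h1 : ∀ v ∈ R, r v ≤ 1) : 0 ≤ pr r R φ :=
  le_ex h0 h1 fun O _ => by split_ifs <;> norm_num

theorem pr_le_one {r : V → ℝ} {R : Finset V} {φ : Finset V → Prop}
    (h0 : ∀ v ∈ R, 0 ≤ r v) (h1 : ∀ v ∈ R, r v ≤ 1) : pr r R φ ≤ 1 :=
  ex_le h0 h1 fun O _ => by split_ifs <;> norm_num

theorem pr_not (r : V → ℝ) (R : Finset V) (φ : Finset V → Prop) :
    pr r R (fun O => ¬ φ O) = 1 - pr r R φ := by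
  rw [← ex_const r R 1, pr, pr, ← ex_sub]
  exact ex_congr (fun _ _ => rfl) fun O _ => by by_cases h : φ O <;> simp [h]

theorem pr_or_le {r : V → ℝ} {R : Finset V} {φ ψ : Finset V → Prop}
    (h0 : ∀ v ∈ R, 0 ≤ r v) (h1 : ∀ v ∈ R, r v ≤ 1) :
    pr r R (fun O => φ O ∨ ψ O) ≤ pr r R φ + pr r R ψ := by
  rw [pr, pr, pr, ← ex_add]
  refine ex_mono h0 h1 fun O _ => ?_
  by_cases h : φ O <;> by_cases h' : ψ O <;> simp [h, h']

theorem pr_true (r : V → ℝ) (R : Finset V) : pr r R (fun _ => True) = 1 := by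
  simp [pr, ex_const]

theorem pr_map {V' : Type*} [DecidableEq V'] (e : V ≃ V') (r : V' → ℝ) (R : Finset V)
    (φ : Finset V' → Prop) :
    pr r (R.map e.toEmbedding) φ = pr (r ∘ e) R (fun O => φ (O.map e.toEmbedding)) :=
  ex_map e r R _

theorem pr_mono_r {r r' : V → ℝ} {R : Finset V} {φ : Finset V → Prop}
    (hφ : ∀ O O', O ⊆ O' → φ O → φ O')
    (h0 : ∀ v ∈ R, 0 ≤ r v) (h : ∀ v ∈ R, r v ≤ r' v) (h1 : ∀ v ∈ R, r' v ≤ 1) :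
    pr r R φ ≤ pr r' R φ := by
  refine ex_mono_r (fun O O' hO => ?_) h0 h h1
  have := hφ O O' hO
  by_cases a : φ O <;> by_cases b : φ O' <;> simp_all

/-- enlarging the region: an increasing event gets more likely -/
theorem pr_mono_R {r : V → ℝ} {R₁ R : Finset V} (hR : R₁ ⊆ R) {φ : Finset V → Prop}
    (hφ : ∀ O O', O ⊆ O' → φ O → φ O')
    (h0 : ∀ v ∈ R, 0 ≤ r v) (h1 : ∀ v ∈ R, r v ≤ 1) :
    pr r R₁ φ ≤ pr r R φ := by
  have e : pr r R₁ φ = pr r R (fun O => φ (O ∩ R₁)) := by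
    have h2 : pr r R (fun O => φ (O ∩ R₁)) = pr r R₁ (fun O => φ (O ∩ R₁)) :=
      ex_dep r hR fun O _ => by
        have : O ∩ R₁ ∩ R₁ = O ∩ R₁ := by rw [Finset.inter_assoc, Finset.inter_self]
        beta_reduce; rw [this]
    rw [h2]
    exact pr_congr fun O hO => by rw [Finset.inter_eq_left.2 hO]
  rw [e]
  exact pr_mono h0 h1 fun O _ => hφ _ _ Finset.inter_subset_left

theorem pr_eq (r : V → ℝ) (R : Finset V) (φ : Finset V → Prop) [DecidablePred φ] :
    pr r R φ = ex r R (fun O => if φ O then 1 else 0) :=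
  ex_congr (fun _ _ => rfl) fun O _ => by congr

theorem pr_union (r : V → ℝ) {R₁ R₂ : Finset V} (h : Disjoint R₁ R₂) (φ : Finset V → Prop) :
    pr r (R₁ ∪ R₂) φ = ex r R₁ (fun O₁ => pr r R₂ (fun O₂ => φ (O₁ ∪ O₂))) :=
  ex_union r h _

end ex

section geom
variable {d : ℕ}

theorem adj_symm {u v : Vtx d} (h : adj u v) : adj v u := by
  unfold adj at *; rw [← h]; exact Finset.sum_congr rfl fun i _ => by ring

theorem adj_le {u v : Vtx d} (h : adj u v) (i : Fin d) : |u i - v i| ≤ 1 := by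
  have : (u i - v i) ^ 2 ≤ 1 := by
    rw [← (show _ = _ from h)]
    exact Finset.single_le_sum (f := fun i => (u i - v i) ^ 2)
      (fun i _ => sq_nonneg _) (Finset.mem_univ i)
  simpa using this

theorem adj_update (u : Vtx d) (i : Fin d) {a : ℤ} (ha : a = u i + 1 ∨ a = u i - 1) :
    adj u (Function.update u i a) := by
  unfold adj
  rw [Finset.sum_eq_single i]
  · rcases ha with rfl | rfl <;> simp
  · intro j _ hj; simp [Function.update_of_ne hj]
  · simp

noncomputable def ball (u : Vtx d) (n : ℕ) : Finset (Vtx d) := Finset.Icc (fun i => u i - n) (fun i => u i + n)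

theorem mem_ball {u v : Vtx d} {n : ℕ} : v ∈ ball u n ↔ ∀ i, |v i - u i| ≤ n := by
  simp only [ball, Finset.mem_Icc, Pi.le_def, abs_le, ← forall_and]
  exact forall_congr' fun i => ⟨fun h => ⟨by linarith [h.1], by linarith [h.2]⟩,
    fun h => ⟨by linarith [h.1], by linarith [h.2]⟩⟩

noncomputable def bd (n : ℕ) : Finset (Vtx d) := (ball 0 n).filter (fun v => ∃ i, |v i| = n)

theorem mem_bd {v : Vtx d} {n : ℕ} : v ∈ bd n ↔ (∀ i, |v i| ≤ n) ∧ ∃ i, |v i| = n := by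
  simp [bd, mem_ball]

theorem reach_exit {A O : Set (Vtx d)} {n : ℕ} (hA : A ⊆ ↑(ball (0 : Vtx d) n)) {w : Vtx d}
    (h : Reach adj A O w) :
    (w ∈ ball 0 n ∧ Reach adj A (O ∩ ↑(ball (0 : Vtx d) n)) w) ∨
      ∃ u ∈ bd n, Reach adj A (O ∩ ↑(ball (0 : Vtx d) n)) u ∧
        ∃ g ∈ O, g ∉ ball 0 n ∧ adj u g := by
  induction h with
  | base w hw => exact .inl ⟨hA hw, .base w hw⟩
  | step x w _ hg hw ih =>
    rcases ih with ⟨hx, hr⟩ | h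
    · by_cases hwn : w ∈ ball 0 n
      · exact .inl ⟨hwn, .step x w hr hg ⟨hw, hwn⟩⟩
      · refine .inr ⟨x, ?_, hr, w, hw, hwn, hg⟩
        rw [mem_bd]
        simp only [mem_ball, Pi.zero_apply, sub_zero, not_forall, not_le] at hx hwn
        obtain ⟨i, hi⟩ := hwn
        refine ⟨hx, i, le_antisymm (hx i) ?_⟩
        have h1 := adj_le hg i
        have h2 : |w i| - |x i| ≤ |w i - x i| := abs_sub_abs_le_abs_sub _ _
        rw [abs_sub_comm] at h2
        omega
    · exact .inr h

end geom

section bern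
open Measure

noncomputable def bernMeas (p : ℝ) : Measure Bool :=
  ENNReal.ofReal p • dirac true + ENNReal.ofReal (1 - p) • dirac false

theorem bernMeas_single (p : ℝ) (b : Bool) :
    bernMeas p {b} = ENNReal.ofReal (if b then p else 1 - p) := by
  cases b <;> simp [bernMeas]

theorem bernMeas_prob {p : ℝ} (h0 : 0 ≤ p) (h1 : p ≤ 1) : IsProbabilityMeasure (bernMeas p) := by
  constructor
  simp [bernMeas]
  rw [← ENNReal.ofReal_add h0 (by linarith)]; simp

theorem bern_eq {ι : Type} {p : ℝ} (h0 : 0 ≤ p) (h1 : p ≤ 1) {μ : Measure (ι → Bool)}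
    (h : IsBernoulliFam p μ) : 
    haveI := bernMeas_prob h0 h1
    μ = infinitePi (fun _ => bernMeas p) := by
  haveI := bernMeas_prob h0 h1
  haveI := h.1
  refine IsProjectiveLimit.unique ?_ (isProjectiveLimit_infinitePi (fun _ => bernMeas p))
  intro I
  refine ext_of_singleton fun f => ?_
  classical
  rw [Measure.pi_singleton, Measure.map_apply (Finset.measurable_restrict _) (measurableSet_singleton _)]
  have := h.2 I (fun v => if hv : v ∈ I then f ⟨v, hv⟩ else true)
  rw [← Finset.prod_attach] at this
  simp only [bernMeas_single]
  convert this using 1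
  · congr 1
    ext ω
    simp only [mem_preimage, mem_singleton_iff, mem_setOf_eq, funext_iff]
    constructor
    · intro H v hv; simp [hv, ← H ⟨v, hv⟩]
    · rintro H ⟨v, hv⟩; simpa [hv] using H v hv
  · simp

theorem bern_pr {ι : Type} [DecidableEq ι] {p : ℝ} (h0 : 0 ≤ p) (h1 : p ≤ 1)
    {μ : Measure (ι → Bool)} (h : IsBernoulliFam p μ) (R : Finset ι) (φ : Finset ι → Prop) :
    μ {ω | φ (R.filter (fun v => ω v = true))} = ENNReal.ofReal (pr (fun _ => p) R φ) := by
  classical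
  have e : {ω : ι → Bool | φ (R.filter (fun v => ω v = true))} =
      ⋃ O ∈ R.powerset.filter φ, {ω | ∀ v ∈ R, ω v = decide (v ∈ O)} := by
    ext ω
    simp only [mem_setOf_eq, mem_iUnion, Finset.mem_filter, Finset.mem_powerset, exists_prop]
    constructor
    · intro H
      exact ⟨_, ⟨Finset.filter_subset _ _, H⟩, fun v hv => by simp [hv]⟩
    · rintro ⟨O, ⟨hO, hφ⟩, H⟩
      convert hφ
      ext v
      simp only [Finset.mem_filter]
      exact ⟨fun hv => by simpa [hv.2] using H v hv.1, fun hv => ⟨hO hv, by simp [H v (hO hv), hv]⟩⟩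
  rw [e, measure_biUnion_finset]
  · rw [pr, ex, ENNReal.ofReal_sum_of_nonneg, Finset.sum_filter]
    · refine Finset.sum_congr rfl fun O hO => ?_
      have hO := Finset.mem_powerset.1 hO
      split_ifs with hφ
      · rw [h.2, mul_one, ← Finset.prod_sdiff hO, mul_comm, ENNReal.ofReal_mul (by positivity),
          ENNReal.ofReal_prod_of_nonneg (fun _ _ => h0),
          ENNReal.ofReal_prod_of_nonneg (fun _ _ => by linarith)]
        congr 1
        · exact Finset.prod_congr rfl fun v hv => by simp [hv]
        · exact Finset.prod_congr rfl fun v hv => by simp [(Finset.mem_sdiff.1 hv).2]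
      · simp
    · intro O _
      have : 0 ≤ 1 - p := by linarith
      split_ifs <;> simp <;> positivity
  · intro O hO O' hO' hne
    simp only [Function.onFun, Set.disjoint_left, mem_setOf_eq]
    intro ω h1 h2
    simp only [Finset.coe_filter, Finset.mem_powerset, mem_setOf_eq] at hO hO'
    apply hne
    ext v
    by_cases hv : v ∈ R
    · have := (h1 v hv).symm.trans (h2 v hv)
      simpa using this
    · exact ⟨fun H => absurd (hO.1 H) hv, fun H => absurd (hO'.1 H) hv⟩
  · intro O _
    have : {ω : ι → Bool | ∀ v ∈ R, ω v = decide (v ∈ O)} =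
        Set.pi R (fun v => {decide (v ∈ O)}) := by ext; simp
    rw [this]
    exact MeasurableSet.pi R.countable_toSet fun _ _ => measurableSet_singleton _

end bern

section zeroone
variable {d : ℕ}
open Measure

def opn (ω : Config d) : Set (Vtx d) := {v | ω v = true}

def InfC : Set (Config d) := {ω | ∃ v, {w | Reach adj {v} (opn ω) w}.Infinite}

theorem reach_finite {V : Type*} {g : V → V → Prop} {A O : Set V} {w : V} (h : Reach g A O w) :
    ∃ T : Finset V, ↑T ⊆ O ∧ Reach g A ↑T w := by
  classical
  induction h with
  | base v h => exact ⟨∅, by simp, .base v h⟩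
  | step v w _ hg hw ih =>
    obtain ⟨T, hT, hr⟩ := ih
    refine ⟨insert w T, ?_, .step v w (hr.mono subset_rfl ?_) hg (by simp)⟩
    · simp [Set.insert_subset_iff, hw, hT]
    · simp

theorem meas_reach (v w : Vtx d) : MeasurableSet {ω : Config d | Reach adj {v} (opn ω) w} := by
  have : {ω : Config d | Reach adj {v} (opn ω) w} =
      ⋃ T ∈ {T : Finset (Vtx d) | Reach adj {v} (T : Set (Vtx d)) w},
        ⋂ x ∈ T, {ω : Config d | ω x = true} := by
    ext ω
    simp only [mem_setOf_eq, mem_iUnion, mem_iInter, exists_prop]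
    constructor
    · intro h
      obtain ⟨T, hT, hr⟩ := reach_finite h
      exact ⟨T, hr, fun x hx => hT hx⟩
    · rintro ⟨T, hr, h⟩
      exact hr.mono subset_rfl fun x hx => h x hx
  rw [this]
  refine MeasurableSet.biUnion (to_countable _) fun T _ =>
    MeasurableSet.biInter (to_countable _) fun x _ => ?_
  exact measurableSet_eq_fun (measurable_pi_apply x) measurable_const

theorem meas_InfC : MeasurableSet (InfC : Set (Config d)) := by
  have : (InfC : Set (Config d)) = ⋃ v, ⋂ S : Finset (Vtx d), ⋃ w ∈ {w | w ∉ S},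
      {ω : Config d | Reach adj {v} (opn ω) w} := by
    ext ω
    simp only [InfC, mem_setOf_eq, mem_iUnion, mem_iInter, exists_prop]
    refine exists_congr fun v => ⟨fun h S => ?_, fun h hf => ?_⟩
    · obtain ⟨w, hw, hS⟩ := h.exists_notMem_finset S
      exact ⟨w, hS, hw⟩
    · obtain ⟨w, hw, hr⟩ := h hf.toFinset
      exact hw (by simpa using hr)
  rw [this]
  exact MeasurableSet.iUnion fun v => MeasurableSet.iInter fun S =>
    MeasurableSet.biUnion (to_countable _) fun w _ => meas_reach v w

open Classical in
theorem InfC_tail (F : Finset (Vtx d)) :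
    (InfC : Set (Config d)) = (fun ω v => if v ∈ F then false else ω v) ⁻¹' InfC := by
  ext ω
  simp only [InfC, mem_preimage, mem_setOf_eq]
  have hs : opn (fun v => if v ∈ F then false else ω v) = opn ω \ ↑F := by
    ext v; by_cases h : v ∈ F <;> simp [opn, h]
  rw [hs]
  constructor
  · rintro ⟨v, hv⟩
    by_contra! H
    apply hv
    have : {w | Reach adj {v} (opn ω) w} ⊆
        ⋃ a ∈ (insert v F : Finset (Vtx d)), {w | Reach adj {a} (opn ω \ ↑F) w} := by
      intro w hw
      simp only [mem_setOf_eq] at hw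
      induction hw with
      | base w h => simp only [mem_iUnion]; exact ⟨v, by simp, Reach.base _ h⟩
      | step x w _ hg hw ih =>
        simp only [mem_iUnion] at ih ⊢
        by_cases hF : w ∈ F
        · exact ⟨w, by simp [hF], Reach.base _ rfl⟩
        · obtain ⟨a, ha, hr⟩ := ih
          exact ⟨a, ha, Reach.step x w hr hg ⟨hw, hF⟩⟩
    exact Set.Finite.subset (Set.Finite.biUnion (Finset.finite_toSet _)
      fun a _ => H a) this
  · rintro ⟨v, hv⟩
    exact ⟨v, hv.mono fun w hw => Reach.mono subset_rfl diff_subset hw⟩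

theorem InfC_zero_one {p : ℝ} (h0 : 0 ≤ p) (h1 : p ≤ 1) {μ : Measure (Config d)} (hd : 0 < d)
    (h : IsBernoulliFam p μ) : μ InfC = 0 ∨ μ InfC = 1 := by
  classical
  haveI := bernMeas_prob h0 h1
  haveI : Nonempty (Fin d) := ⟨⟨0, hd⟩⟩
  obtain ⟨e⟩ : Nonempty (ℕ ≃ Vtx d) := by
    haveI : Infinite (Vtx d) := inferInstance
    exact ⟨(nonempty_denumerable (Vtx d)).some.eqv.symm⟩
  set s : ℕ → MeasurableSpace (Config d) :=
    fun n => MeasurableSpace.comap (fun ω : Config d => ω (e n)) inferInstance with hs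
  have hind : ProbabilityTheory.iIndep s μ := by
    rw [bern_eq h0 h1 h]
    have := ProbabilityTheory.iIndepFun_infinitePi (P := fun _ : Vtx d => bernMeas p)
      (X := fun _ (b : Bool) => b) (fun _ => measurable_id)
    exact ProbabilityTheory.iIndepFun.precomp e.injective this
  refine ProbabilityTheory.measure_zero_or_one_of_measurableSet_limsup_atTop (s := s)
    (fun n => (measurable_pi_apply (e n)).comap_le) hind ?_
  rw [Filter.limsup_eq_iInf_iSup_of_nat, MeasurableSpace.measurableSet_iInf]
  intro n
  rw [InfC_tail ((Finset.range n).map e.toEmbedding)]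
  refine @measurableSet_preimage _ _ (_) _ _ _ ?_ meas_InfC
  refine @measurable_pi_lambda _ _ _ (_) _ _ fun v => ?_
  by_cases hv : v ∈ (Finset.range n).map e.toEmbedding
  · simp only [hv, if_true]; exact @measurable_const _ _ _ (_) _
  · simp only [hv, if_false]
    obtain ⟨i, rfl⟩ := e.surjective v
    have hi : n ≤ i := by
      by_contra hlt
      exact hv (Finset.mem_map_of_mem e.toEmbedding (by simpa using hlt))
    have : s i ≤ ⨆ i, ⨆ (_ : i ≥ n), s i := le_iSup₂_of_le i hi le_rfl
    exact (comap_measurable (fun ω : Config d => ω (e i))).mono this le_rfl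

theorem perc_sub : {ω : Config d | PercolatesAt ω (fun _ => 0)} ⊆ InfC := by
  rintro ω ⟨C, h0, hinf, hop, hC⟩
  refine ⟨fun _ => 0, hinf.mono fun w hw => ?_⟩
  obtain ⟨n, γ, g0, gn, ga, gC⟩ := hC _ h0 w hw
  have : ∀ i ≤ n, Reach adj {fun _ => 0} (opn ω) (γ i) := by
    intro i
    induction i with
    | zero => intro _; exact .base _ g0
    | succ i ih => intro hi; exact .step _ _ (ih (by omega)) (ga i (by omega)) (hop _ (gC _ hi))
  exact gn ▸ this n le_rfl

/-- the nominal connection event -/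
def Conn (m n : ℕ) (O : Finset (Vtx d)) : Prop :=
  ∃ v ∈ bd n, Reach adj ((ball (0 : Vtx d) m : Set (Vtx d)) ∩ (O : Set (Vtx d))) (O : Set (Vtx d)) v

theorem C1 {p : ℝ} (h0 : 0 ≤ p) (h1 : p ≤ 1) {μ : Measure (Config d)} (hd : 0 < d)
    (h : IsBernoulliFam p μ) (hθ : 0 < μ {ω | PercolatesAt ω (fun _ => 0)})
    (η : ℝ) (hη : 0 < η) :
    ∃ m : ℕ, ∀ n, m ≤ n → 1 - η ≤ pr (fun _ => p) (ball (0 : Vtx d) n) (Conn m n) := by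
  haveI := h.1
  have hone : μ InfC = 1 := by
    rcases InfC_zero_one h0 h1 hd h with h | h
    · exact absurd (hθ.trans_le (measure_mono perc_sub)) (by simp [h])
    · exact h
  let E : ℕ → Set (Config d) := fun m =>
    {ω | {w | Reach adj (↑(ball (0 : Vtx d) m) ∩ opn ω) (opn ω) w}.Infinite}
  have hmono : Monotone E := by
    intro m m' hm ω hω
    refine hω.mono fun w hw => Reach.mono (inter_subset_inter_left _ ?_) subset_rfl hw
    intro v hv
    simp only [Finset.mem_coe, mem_ball] at hv ⊢
    exact fun i => (hv i).trans (by exact_mod_cast hm)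
  have hU : InfC ⊆ ⋃ m, E m := by
    rintro ω ⟨v, hv⟩
    obtain ⟨m, hm⟩ : ∃ m : ℕ, ∀ i, |v i| + 1 ≤ (m : ℤ) := by
      refine ⟨∑ i, (v i).natAbs + 1, fun i => ?_⟩
      have := Finset.single_le_sum (f := fun i => (v i).natAbs) (fun i _ => Nat.zero_le _)
        (Finset.mem_univ i)
      push_cast
      have h2 : ((v i).natAbs : ℤ) ≤ ∑ i, ((v i).natAbs : ℤ) := by exact_mod_cast this
      simpa using h2
    refine mem_iUnion.2 ⟨m, ?_⟩
    have : {w | Reach adj {v} (opn ω) w} \ {v} ⊆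
        {w | Reach adj (↑(ball (0 : Vtx d) m) ∩ opn ω) (opn ω) w} := by
      rintro w ⟨hw, hne⟩
      have key : ∀ w, Reach adj {v} (opn ω) w →
          w = v ∨ Reach adj (↑(ball (0 : Vtx d) m) ∩ opn ω) (opn ω) w := by
        intro w hw
        induction hw with
        | base w h => exact .inl h
        | step x w _ hg hwo ih =>
          right
          rcases ih with rfl | ih
          · refine .base _ ⟨?_, hwo⟩
            simp only [Finset.mem_coe, mem_ball, Pi.zero_apply, sub_zero]
            intro i
            have h1 := adj_le hg i
            have h2 : |w i| - |x i| ≤ |w i - x i| := abs_sub_abs_le_abs_sub _ _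
            rw [abs_sub_comm] at h2
            linarith [hm i]
          · exact .step _ _ ih hg hwo
      exact (key w hw).resolve_left hne
    exact (hv.diff (finite_singleton v)).mono this
  have ht := tendsto_measure_iUnion_atTop (μ := μ) hmono
  rw [show μ (⋃ m, E m) = 1 from le_antisymm prob_le_one (hone ▸ measure_mono hU)] at ht
  have hev := ht.eventually (lt_mem_nhds (a := ENNReal.ofReal (1 - η))
    (by rw [← ENNReal.ofReal_one]; exact (ENNReal.ofReal_lt_ofReal_iff one_pos).2 (by linarith)))
  obtain ⟨m, hm⟩ := hev.exists
  refine ⟨m, fun n hn => ?_⟩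
  have hsub : E m ⊆ {ω | Conn m n ((ball (0 : Vtx d) n).filter (fun v => ω v = true))} := by
    intro ω hω
    obtain ⟨w, hw, hwn⟩ := hω.exists_notMem_finset (ball 0 n)
    have hb : (ball (0 : Vtx d) m) ⊆ ball 0 n := by
      intro v hv
      simp only [mem_ball] at hv ⊢
      exact fun i => (hv i).trans (by exact_mod_cast hn)
    have hco : (((ball (0 : Vtx d) n).filter (fun v => ω v = true) : Finset (Vtx d)) : Set (Vtx d))
        = opn ω ∩ ↑(ball (0 : Vtx d) n) := by
      ext v; simp [opn, and_comm]
    rcases reach_exit (n := n) (fun v hv => hb hv.1) hw with h | ⟨u, hu, hr, -⟩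
    · exact absurd h.1 hwn
    · refine ⟨u, hu, ?_⟩
      rw [hco]
      refine hr.mono ?_ subset_rfl
      exact fun v hv => ⟨hv.1, hv.2, hb hv.1⟩
  have := hm.le.trans (measure_mono hsub)
  rw [bern_pr h0 h1 h] at this
  exact (ENNReal.ofReal_le_ofReal_iff (pr_nonneg (fun _ _ => h0) fun _ _ => h1)).1 this

end zeroone

section autom
variable {d : ℕ}

def aut (u : Vtx d) (π : Equiv.Perm (Fin d)) (s : Fin d → ℤˣ) : Vtx d ≃ Vtx d where
  toFun v j := u j + s j * v (π j)
  invFun w j := s (π.symm j) * (w (π.symm j) - u (π.symm j))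
  left_inv v := by
    funext j
    simp [← mul_assoc, ← Units.val_mul, Int.units_mul_self]
  right_inv w := by
    funext j
    simp [← mul_assoc, ← Units.val_mul, Int.units_mul_self]

theorem aut_apply (u : Vtx d) (π : Equiv.Perm (Fin d)) (s : Fin d → ℤˣ) (v : Vtx d) (j : Fin d) :
    aut u π s v j = u j + s j * v (π j) := rfl

theorem aut_adj (u : Vtx d) (π : Equiv.Perm (Fin d)) (s : Fin d → ℤˣ) (v w : Vtx d) :
    adj (aut u π s v) (aut u π s w) ↔ adj v w := by
  unfold adj
  rw [← Equiv.sum_comp π (fun i => (v i - w i) ^ 2)]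
  refine Eq.congr (Finset.sum_congr rfl fun j _ => ?_) rfl
  have : ((s j : ℤ)) ^ 2 = 1 := by rw [sq, ← Units.val_mul, Int.units_mul_self]; rfl
  simp only [aut_apply]
  linear_combination (v (π j) - w (π j)) ^ 2 * this

theorem abs_unit_mul (s : ℤˣ) (x : ℤ) : |(s : ℤ) * x| = |x| := by
  rcases Int.units_eq_one_or s with rfl | rfl <;> simp

theorem aut_ball (u : Vtx d) (π : Equiv.Perm (Fin d)) (s : Fin d → ℤˣ) (a v : Vtx d) (n : ℕ) :
    aut u π s v ∈ ball (aut u π s a) n ↔ v ∈ ball a n := by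
  simp only [mem_ball, aut_apply, add_sub_add_left_eq_sub, ← mul_sub, abs_unit_mul]
  exact π.forall_congr_left.trans (by simp)

theorem aut_map_ball (u : Vtx d) (π : Equiv.Perm (Fin d)) (s : Fin d → ℤˣ) (a : Vtx d) (n : ℕ) :
    (ball a n).map (aut u π s).toEmbedding = ball (aut u π s a) n := by
  ext w
  obtain ⟨v, rfl⟩ := (aut u π s).surjective w
  rw [aut_ball]
  simp [Finset.mem_map]

theorem reach_aut (u : Vtx d) (π : Equiv.Perm (Fin d)) (s : Fin d → ℤˣ) (A O : Set (Vtx d))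
    (v : Vtx d) :
    Reach adj (aut u π s '' A) (aut u π s '' O) (aut u π s v) ↔ Reach adj A O v := by
  refine ⟨fun h => ?_, Reach.map _ fun a b => (aut_adj u π s a b).2⟩
  have := Reach.map (g' := adj) (aut u π s).symm
    (fun a b hab => by rw [← aut_adj u π s]; simpa using hab) h
  simpa [image_image] using this

theorem aut_zero (π : Equiv.Perm (Fin d)) (s : Fin d → ℤˣ) : aut 0 π s (0 : Vtx d) = 0 := by
  funext j; simp [aut_apply]

theorem ball_conn (c a : Vtx d) (m : ℕ) (ha : a ∈ ball c m) (v : Vtx d) (hv : v ∈ ball c m) :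
    Reach adj {a} (ball c m : Set (Vtx d)) v := by
  obtain ⟨N, hN⟩ : ∃ N, N = ∑ i, (v i - a i).natAbs := ⟨_, rfl⟩
  induction N using Nat.strong_induction_on generalizing v with
  | _ N ih =>
    by_cases hva : v = a
    · exact .base _ hva
    · obtain ⟨i, hi⟩ : ∃ i, v i ≠ a i := by
        by_contra! H; exact hva (funext H)
      obtain ⟨b, hb1, hb2, hb3⟩ : ∃ b : ℤ, (b = v i + 1 ∨ b = v i - 1) ∧
          (b - a i).natAbs < (v i - a i).natAbs ∧ (a i ≤ b ∧ b ≤ v i ∨ v i ≤ b ∧ b ≤ a i) := by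
        rcases lt_or_gt_of_ne hi with h | h
        · exact ⟨v i + 1, .inl rfl, by omega, by omega⟩
        · exact ⟨v i - 1, .inr rfl, by omega, by omega⟩
      have hmem : Function.update v i b ∈ ball c m := by
        rw [mem_ball] at ha hv ⊢
        intro j
        by_cases hj : j = i
        · subst hj
          rw [Function.update_self]
          have h1 := abs_le.1 (ha j); have h2 := abs_le.1 (hv j)
          rw [abs_le]; omega
        · rw [Function.update_of_ne hj]; exact hv j
      have hlt : ∑ j, (Function.update v i b j - a j).natAbs < ∑ j, (v j - a j).natAbs := by
        refine Finset.sum_lt_sum (fun j _ => ?_) ⟨i, Finset.mem_univ _, by simpa using hb2⟩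
        by_cases hj : j = i
        · subst hj; simpa using hb2.le
        · rw [Function.update_of_ne hj]
      refine .step _ _ (ih _ (hN ▸ hlt) _ hmem rfl) (adj_symm (adj_update v i hb1)) hv

theorem ball_mono (c : Vtx d) {m n : ℕ} (h : m ≤ n) : ball c m ⊆ ball c n := by
  intro v hv
  rw [mem_ball] at hv ⊢
  exact fun i => (hv i).trans (by exact_mod_cast h)

end autom

section nominal
variable {d : ℕ}
open Classical

noncomputable def U (m n : ℕ) (O : Finset (Vtx d)) : Finset (Vtx d) :=
  (bd n).filter (fun v => Reach adj ((ball (0 : Vtx d) m : Set (Vtx d)) ∩ (O : Set (Vtx d)))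
    (O : Set (Vtx d)) v)

theorem conn_iff (m n : ℕ) (O : Finset (Vtx d)) : Conn m n O ↔ (U m n O).Nonempty := by
  simp [Conn, U, Finset.Nonempty]

theorem U_mono (m n : ℕ) {O O' : Finset (Vtx d)} (h : O ⊆ O') : U m n O ⊆ U m n O' := by
  intro v hv
  rw [U, Finset.mem_filter] at hv ⊢
  refine ⟨hv.1, hv.2.mono ?_ (by exact_mod_cast h)⟩
  exact inter_subset_inter_right _ (by exact_mod_cast h)

theorem C2_step {q : ℝ} (h0 : 0 ≤ q) (h1 : q ≤ 1) {m n M : ℕ} (hmn : m ≤ n) :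
    pr (fun _ => q) (ball (0 : Vtx d) (n + 1)) (Conn m (n + 1)) +
      (1 - q) ^ (M * 3 ^ d) * pr (fun _ => q) (ball (0 : Vtx d) n)
        (fun O => 1 ≤ (U m n O).card ∧ (U m n O).card ≤ M)
      ≤ pr (fun _ => q) (ball (0 : Vtx d) n) (Conn m n) := by
  have hb := ball_mono (0 : Vtx d) (Nat.le_succ n)
  have hbm := ball_mono (0 : Vtx d) hmn
  rw [← Finset.union_sdiff_of_subset hb, pr, ex_union _ Finset.disjoint_sdiff, pr, pr,
    ← ex_mul, ← ex_add]
  refine ex_mono (fun _ _ => h0) (fun _ _ => h1) fun O₁ hO₁ => ?_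
  set Sh := ball (0 : Vtx d) (n + 1) \ ball 0 n
  change pr _ Sh (fun O₂ => Conn m (n + 1) (O₁ ∪ O₂)) + _ ≤ _
  have key : ∀ O₂ ⊆ Sh, Conn m (n + 1) (O₁ ∪ O₂) →
      ∃ f ∈ U m n O₁, ∃ g ∈ O₂, adj f g := by
    rintro O₂ hO₂ ⟨v, hv, hr⟩
    have hvn : v ∉ ball (0 : Vtx d) n := by
      rw [mem_bd] at hv
      obtain ⟨-, i, hi⟩ := hv
      intro h
      rw [mem_ball] at h
      have := h i
      simp at this; omega
    have e1 : ((O₁ ∪ O₂ : Finset (Vtx d)) : Set (Vtx d)) ∩ ↑(ball (0 : Vtx d) n) = ↑O₁ := by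
      ext x
      simp only [Finset.coe_union, mem_inter_iff, mem_union, Finset.mem_coe]
      constructor
      · rintro ⟨h | h, hx⟩
        · exact h
        · exact absurd hx (Finset.mem_sdiff.1 (hO₂ h)).2
      · exact fun h => ⟨.inl h, hO₁ h⟩
    have e2 : (ball (0 : Vtx d) m : Set (Vtx d)) ∩ ↑(O₁ ∪ O₂) = ↑(ball (0 : Vtx d) m) ∩ ↑O₁ := by
      rw [← e1]; ext x; simp only [mem_inter_iff]
      exact ⟨fun h => ⟨h.1, h.2, hbm h.1⟩, fun h => ⟨h.1, h.2.1⟩⟩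
    rcases reach_exit (n := n) (fun x hx => hbm hx.1) hr with h | ⟨u, hu, hr, g, hg, hgn, ha⟩
    · exact absurd h.1 hvn
    · rw [e1, e2] at hr
      refine ⟨u, Finset.mem_filter.2 ⟨hu, hr⟩, g, ?_, ha⟩
      rcases Finset.mem_union.1 hg with h | h
      · exact absurd (hO₁ h) hgn
      · exact h
  have hle : pr (fun _ => q) Sh (fun O₂ => Conn m (n + 1) (O₁ ∪ O₂)) ≤ 1 :=
    pr_le_one (fun _ _ => h0) (fun _ _ => h1)
  by_cases hU : (U m n O₁).card ≤ M
  · by_cases hne : (U m n O₁).Nonempty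
    · rw [if_pos ⟨Finset.card_pos.2 hne, hU⟩, if_pos ((conn_iff m n O₁).2 hne)]
      set G := (((U m n O₁).biUnion (fun f => ball f 1)) ∩ Sh)
      have hG : G.card ≤ M * 3 ^ d := by
        refine (Finset.card_le_card Finset.inter_subset_left).trans
          ((Finset.card_biUnion_le_card_mul _ _ (3 ^ d) fun f _ => ?_).trans
            (Nat.mul_le_mul_right _ hU))
        rw [ball, Pi.card_Icc]
        simp [show ∀ x : ℤ, x + 1 + 1 - (x - 1) = 3 by intro x; ring]
      have h2 : pr (fun _ => q) Sh (fun O₂ => Conn m (n + 1) (O₁ ∪ O₂)) ≤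
          pr (fun _ => q) Sh (fun O₂ => ¬ Disjoint O₂ G) := by
        refine pr_mono (fun _ _ => h0) (fun _ _ => h1) fun O₂ hO₂ hc => ?_
        obtain ⟨f, hf, g, hg, ha⟩ := key O₂ hO₂ hc
        rw [Finset.not_disjoint_iff]
        refine ⟨g, hg, Finset.mem_inter.2 ⟨Finset.mem_biUnion.2 ⟨f, hf, ?_⟩, hO₂ hg⟩⟩
        rw [mem_ball]
        exact fun i => by rw [abs_sub_comm]; exact_mod_cast adj_le ha i
      have h3 : pr (fun _ => q) Sh (fun O₂ => Disjoint O₂ G) = (1 - q) ^ G.card := by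
        rw [← Finset.prod_const, ← ex_none (fun _ => q) (Finset.inter_subset_right : G ⊆ Sh), pr]
        exact ex_congr (fun _ _ => rfl) fun O _ => by congr
      rw [pr_not, h3] at h2
      have h4 : (1 - q) ^ (M * 3 ^ d) ≤ (1 - q) ^ G.card :=
        pow_le_pow_of_le_one (by linarith) (by linarith) hG
      linarith
    · have : pr (fun _ => q) Sh (fun O₂ => Conn m (n + 1) (O₁ ∪ O₂)) ≤ 0 := by
        refine ex_le (fun _ _ => h0) (fun _ _ => h1) fun O₂ hO₂ => ?_
        rw [if_neg]
        intro h
        obtain ⟨f, hf, -⟩ := key O₂ hO₂ h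
        exact hne ⟨f, hf⟩
      rw [if_neg (fun h => hne (Finset.card_pos.1 h.1))]
      split_ifs <;> linarith
  · have hne : (U m n O₁).Nonempty := Finset.card_pos.1 (by omega)
    rw [if_neg (fun h => hU h.2), if_pos ((conn_iff m n O₁).2 hne)]
    linarith

theorem C2 {q : ℝ} (h0 : 0 ≤ q) (h1 : q < 1) (m M : ℕ) {η : ℝ} (hη : 0 < η) :
    ∃ n₀, ∀ n ≥ n₀, pr (fun _ => q) (ball (0 : Vtx d) n)
        (fun O => 1 ≤ (U m n O).card ∧ (U m n O).card ≤ M) ≤ η := by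
  set P : ℕ → ℝ := fun k => pr (fun _ => q) (ball (0 : Vtx d) (m + k)) (Conn m (m + k))
  have hc : 0 < (1 - q) ^ (M * 3 ^ d) := pow_pos (by linarith) _
  have hst : ∀ k, P (k + 1) + (1 - q) ^ (M * 3 ^ d) * pr (fun _ => q) (ball (0 : Vtx d) (m + k))
        (fun O => 1 ≤ (U m (m + k) O).card ∧ (U m (m + k) O).card ≤ M) ≤ P k :=
    fun k => C2_step h0 h1.le (Nat.le_add_right m k)
  have hanti : Antitone P := antitone_nat_of_succ_le fun k => by
    have := mul_nonneg hc.le (pr_nonneg (fun _ _ => h0) (fun _ _ => h1.le) :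
      0 ≤ pr (fun _ => q) (ball (0 : Vtx d) (m + k))
        (fun O => 1 ≤ (U m (m + k) O).card ∧ (U m (m + k) O).card ≤ M))
    linarith [hst k]
  have hbdd : BddBelow (range P) :=
    ⟨0, by rintro _ ⟨k, rfl⟩; exact pr_nonneg (fun _ _ => h0) (fun _ _ => h1.le)⟩
  have ht := tendsto_atTop_ciInf hanti hbdd
  have hdiff := ht.sub ((Filter.tendsto_add_atTop_iff_nat 1).2 ht)
  rw [sub_self] at hdiff
  obtain ⟨k₀, hk₀⟩ := (hdiff.eventually (gt_mem_nhds (mul_pos hc hη))).exists_forall_of_atTop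
  refine ⟨m + k₀, fun n hn => ?_⟩
  obtain ⟨k, rfl⟩ := Nat.exists_eq_add_of_le (show m ≤ n by omega)
  have := hk₀ k (by omega)
  have h2 := hst k
  by_contra! hcon
  have := mul_lt_mul_of_pos_left hcon hc
  linarith

end nominal

section facets
variable {d : ℕ}
open Classical

noncomputable def F0 (i0 : Fin d) (n : ℕ) : Finset (Vtx d) :=
  (ball 0 n).filter (fun v => v i0 = n ∧ ∀ j, 0 ≤ v j)

theorem U_map (π : Equiv.Perm (Fin d)) (s : Fin d → ℤˣ) (m n : ℕ) (O : Finset (Vtx d)) :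
    U m n (O.map (aut 0 π s).toEmbedding) = (U m n O).map (aut 0 π s).toEmbedding := by
  ext w
  obtain ⟨v, rfl⟩ := (aut 0 π s).surjective w
  have e1 : aut 0 π s v ∈ bd n ↔ v ∈ bd n := by
    rw [bd, Finset.mem_filter, Finset.mem_filter]
    have := aut_ball 0 π s 0 v n
    rw [aut_zero] at this
    rw [this]
    refine and_congr_right fun _ => ?_
    simp only [aut_apply, Pi.zero_apply, zero_add, abs_unit_mul]
    exact π.exists_congr_left.trans (by simp)
  have e2 : (ball (0 : Vtx d) m : Set (Vtx d)) ∩ ↑(O.map (aut 0 π s).toEmbedding) =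
      aut 0 π s '' (↑(ball (0 : Vtx d) m) ∩ ↑O) := by
    rw [image_inter (aut 0 π s).injective]
    congr 1
    · have := aut_map_ball 0 π s 0 m
      rw [aut_zero] at this
      conv_lhs => rw [← this]
      simp
    · simp
  have e3 : ((O.map (aut 0 π s).toEmbedding : Finset (Vtx d)) : Set (Vtx d)) = aut 0 π s '' ↑O := by
    simp
  simp only [U, Finset.mem_filter, e1, e2]
  rw [e3, reach_aut]
  simp [Finset.mem_map]

theorem ex_harris_prod {V ι : Type*} [DecidableEq V] {r : V → ℝ} {R : Finset V} (K : Finset ι)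
    {F : ι → Finset V → ℝ} (h0 : ∀ v ∈ R, 0 ≤ r v) (h1 : ∀ v ∈ R, r v ≤ 1)
    (hF : ∀ k, Antitone (F k)) (hp : ∀ k O, 0 ≤ F k O) :
    ∏ k ∈ K, ex r R (F k) ≤ ex r R (fun O => ∏ k ∈ K, F k O) := by
  induction K using Finset.induction with
  | empty => simp [ex_const]
  | insert k K hk ih =>
    rw [Finset.prod_insert hk]
    simp only [Finset.prod_insert hk]
    refine le_trans (mul_le_mul_of_nonneg_left ih (le_ex h0 h1 fun O _ => hp k O)) ?_
    refine ex_harris h0 h1 (hF k) fun O O' h => ?_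
    exact Finset.prod_le_prod (fun k _ => hp k _) fun k _ => hF k h

theorem C3 (i0 : Fin d) {q : ℝ} (h0 : 0 ≤ q) (h1 : q < 1)
    (hC1 : ∀ η : ℝ, 0 < η → ∃ m : ℕ, ∀ n, m ≤ n →
      1 - η ≤ pr (fun _ => q) (ball (0 : Vtx d) n) (Conn m n))
    {η : ℝ} (hη : 0 < η) :
    ∃ m : ℕ, ∀ M : ℕ, ∃ n₀, ∀ n ≥ n₀, pr (fun _ => q) (ball (0 : Vtx d) n)
      (fun O => (U m n O ∩ F0 i0 n).card ≤ M) ≤ η := by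
  let K := Fin d × (Fin d → ℤˣ)
  set κ := Fintype.card K
  have hκ : κ ≠ 0 := (Fintype.card_pos_iff.2 ⟨(i0, fun _ => 1)⟩).ne'
  let e : K → (Vtx d ≃ Vtx d) := fun k => aut 0 (Equiv.swap i0 k.1) k.2
  have hη' : 0 < η ^ κ / 2 := by positivity
  obtain ⟨m, hm⟩ := hC1 _ hη'
  refine ⟨m, fun M => ?_⟩
  obtain ⟨n₁, hn₁⟩ := C2 (d := d) h0 h1 m (κ * M) hη'
  refine ⟨max m n₁, fun n hn => ?_⟩
  have hm := hm n (by omega)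
  have hn₁ := hn₁ n (by omega)
  have hcover : ∀ v ∈ (bd n : Finset (Vtx d)), ∃ k : K, v ∈ (F0 i0 n).map (e k).toEmbedding := by
    intro v hv
    obtain ⟨hv, i, hi⟩ := mem_bd.1 hv
    refine ⟨(i, fun j => if 0 ≤ v j then 1 else -1), ?_⟩
    set k : K := (i, fun j => if 0 ≤ v j then 1 else -1) with hk
    have hab : ∀ j, ((k.2 j : ℤˣ) : ℤ) * v j = |v j| := by
      intro j
      by_cases h : 0 ≤ v j
      · simp [hk, h, abs_of_nonneg]
      · simp only [hk, h, if_false]; rw [abs_of_neg (by omega)]; simp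
    refine Finset.mem_map.2 ⟨(e k).symm v, ?_, by simp⟩
    have hw : ∀ j, (e k).symm v j = |v ((Equiv.swap i0 i) j)| := by
      intro j
      rw [← hab]
      simp [e, aut, hk]
    rw [F0, Finset.mem_filter, mem_ball]
    refine ⟨fun j => ?_, ?_, fun j => ?_⟩
    · rw [hw]; simpa using hv _
    · rw [hw]; simpa using hi
    · rw [hw]; exact abs_nonneg _
  have hsym : ∀ k : K, pr (fun _ => q) (ball (0 : Vtx d) n)
      (fun O => (U m n O ∩ (F0 i0 n).map (e k).toEmbedding).card ≤ M) =
      pr (fun _ => q) (ball (0 : Vtx d) n) (fun O => (U m n O ∩ F0 i0 n).card ≤ M) := by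
    intro k
    have hb := aut_map_ball 0 (Equiv.swap i0 k.1) k.2 0 n
    rw [aut_zero] at hb
    conv_lhs => rw [← hb]
    rw [pr_map]
    refine pr_congr fun O _ => ?_
    rw [U_map, ← Finset.map_inter, Finset.card_map]
  set x := pr (fun _ => q) (ball (0 : Vtx d) n) (fun O => (U m n O ∩ F0 i0 n).card ≤ M)
  have hx : x ^ κ ≤ η ^ κ := by
    have hH := ex_harris_prod (r := fun _ => q) (R := ball (0 : Vtx d) n) (Finset.univ : Finset K)
      (F := fun k O => if (U m n O ∩ (F0 i0 n).map (e k).toEmbedding).card ≤ M then 1 else 0)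
      (fun _ _ => h0) (fun _ _ => h1.le)
      (fun k O O' h => by
        have := Finset.card_le_card (Finset.inter_subset_inter_right (u := (F0 i0 n).map (e k).toEmbedding) (U_mono m n h))
        by_cases h2 : (U m n O' ∩ (F0 i0 n).map (e k).toEmbedding).card ≤ M
        · simp [h2, this.trans h2]
        · simp only [h2, if_false]; split_ifs <;> norm_num)
      (fun k O => by split_ifs <;> norm_num)
    have : ∏ k : K, ex (fun _ => q) (ball (0 : Vtx d) n)
        (fun O => if (U m n O ∩ (F0 i0 n).map (e k).toEmbedding).card ≤ M then (1 : ℝ) else 0)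
        = x ^ κ := by
      rw [Finset.prod_congr rfl fun k _ => (pr_eq _ _ _).symm.trans (hsym k), Finset.prod_const]
      rfl
    rw [this] at hH
    refine hH.trans ?_
    have h2 : ex (fun _ => q) (ball (0 : Vtx d) n) (fun O => ∏ k : K,
        if (U m n O ∩ (F0 i0 n).map (e k).toEmbedding).card ≤ M then (1 : ℝ) else 0) ≤
        pr (fun _ => q) (ball (0 : Vtx d) n) (fun O => ¬ Conn m n O ∨
          (1 ≤ (U m n O).card ∧ (U m n O).card ≤ κ * M)) := by
      refine ex_mono (fun _ _ => h0) (fun _ _ => h1.le) fun O _ => ?_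
      by_cases hall : ∀ k : K, (U m n O ∩ (F0 i0 n).map (e k).toEmbedding).card ≤ M
      · rw [if_pos, Finset.prod_congr rfl (fun k _ => if_pos (hall k))]
        · simp
        · beta_reduce
          rw [conn_iff, or_iff_not_imp_left, not_not]
          refine fun hne => ⟨Finset.card_pos.2 hne, ?_⟩
          have hs : U m n O ⊆ (Finset.univ : Finset K).biUnion
              (fun k => U m n O ∩ (F0 i0 n).map (e k).toEmbedding) := by
            intro v hv
            obtain ⟨k, hk⟩ := hcover v (Finset.mem_filter.1 hv).1
            exact Finset.mem_biUnion.2 ⟨k, Finset.mem_univ _, Finset.mem_inter.2 ⟨hv, hk⟩⟩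
          exact (Finset.card_le_card hs).trans
            (Finset.card_biUnion_le_card_mul _ _ _ fun k _ => hall k)
      · push Not at hall
        obtain ⟨k, hk⟩ := hall
        rw [Finset.prod_eq_zero (Finset.mem_univ k) (if_neg (by omega))]
        split_ifs <;> norm_num
    have h3 := pr_or_le (r := fun _ => q) (R := ball (0 : Vtx d) n) (φ := fun O => ¬ Conn m n O)
      (ψ := fun O => (1 ≤ (U m n O).card ∧ (U m n O).card ≤ κ * M))
      (fun _ _ => h0) (fun _ _ => h1.le)
    rw [pr_not] at h3
    linarith
  exact le_of_pow_le_pow_left₀ hκ hη.le hx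

end facets

section slots
variable {d : ℕ}
open Classical

theorem pr_all {V : Type*} [DecidableEq V] (r : V → ℝ) (R : Finset V) :
    pr r R (fun O => R ⊆ O) = ∏ v ∈ R, r v := by
  rw [pr, ex, Finset.sum_eq_single R]
  · simp
  · intro O hO hne
    rw [if_neg, mul_zero]
    exact fun h => hne (Finset.Subset.antisymm (Finset.mem_powerset.1 hO) h)
  · simp

theorem pr_none_of {V : Type*} [DecidableEq V] {δ : ℝ} (h0 : 0 ≤ δ) (h1 : δ ≤ 1) (b : ℕ)
    {ι : Type*} (X : Finset ι) (G : ι → Finset V) (hb : ∀ f, (G f).card ≤ b) :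
    ∀ R : Finset V, (∀ f ∈ X, G f ⊆ R) → (∀ f ∈ X, ∀ f' ∈ X, f ≠ f' → Disjoint (G f) (G f')) →
    pr (fun _ => δ) R (fun O => ∀ f ∈ X, ¬ G f ⊆ O) ≤ (1 - δ ^ b) ^ X.card := by
  induction X using Finset.induction with
  | empty => intro R _ _; simpa using pr_le_one (fun _ _ => h0) (fun _ _ => h1)
  | insert f X hf ih =>
    intro R hR hdis
    have hfR := hR f (Finset.mem_insert_self _ _)
    have hb1 : δ ^ b ≤ 1 := pow_le_one₀ h0 h1
    rw [← Finset.union_sdiff_of_subset hfR, pr, ex_union _ Finset.disjoint_sdiff,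
      Finset.card_insert_of_notMem hf, pow_succ']
    have ih := ih (R \ G f) (fun f' hf' => by
        rw [Finset.subset_sdiff]
        exact ⟨hR f' (Finset.mem_insert_of_mem hf'),
          hdis _ (Finset.mem_insert_of_mem hf') _ (Finset.mem_insert_self _ _)
            (fun h => hf (h ▸ hf'))⟩)
      (fun a ha a' ha' => hdis a (Finset.mem_insert_of_mem ha) a' (Finset.mem_insert_of_mem ha'))
    have hp : 0 ≤ (1 - δ ^ b) ^ X.card := pow_nonneg (by linarith) _
    calc _ ≤ ex (fun _ => δ) (G f) (fun O₁ => (1 - δ ^ b) ^ X.card *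
            (if ¬ G f ⊆ O₁ then (1 : ℝ) else 0)) := by
          refine ex_mono (fun _ _ => h0) (fun _ _ => h1) fun O₁ hO₁ => ?_
          by_cases hc : G f ⊆ O₁
          · refine ex_le (fun _ _ => h0) (fun _ _ => h1) fun O₂ _ => ?_
            rw [if_neg]
            · simp [hc]
            · exact fun h => h f (Finset.mem_insert_self _ _) (hc.trans Finset.subset_union_left)
          · rw [if_pos hc, mul_one]
            refine le_trans ?_ ih
            refine pr_mono (φ := fun O₂ => ∀ f_1 ∈ insert f X, ¬ G f_1 ⊆ O₁ ∪ O₂)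
              (fun _ _ => h0) (fun _ _ => h1) fun O₂ _ h f' hf' hs => ?_
            exact h f' (Finset.mem_insert_of_mem hf') (hs.trans Finset.subset_union_right)
      _ = (1 - δ ^ b) ^ X.card * (1 - δ ^ (G f).card) := by
          rw [ex_mul]
          congr 1
          have := pr_not (fun _ => δ) (G f) (fun O => G f ⊆ O)
          rw [pr_all, Finset.prod_const] at this
          rw [← this, pr]
          exact ex_congr (fun _ _ => rfl) fun O _ => by congr
      _ ≤ _ := by
          rw [mul_comm]
          have : δ ^ b ≤ δ ^ (G f).card := pow_le_pow_of_le_one h0 h1 (hb f)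
          gcongr

/-- centre of the seed attached to the facet point `f` -/
def ctr (i0 : Fin d) (m : ℕ) (f : Vtx d) : Vtx d := Function.update f i0 (f i0 + (m + 1))

noncomputable def slot (i0 : Fin d) (m : ℕ) (f : Vtx d) : Finset (Vtx d) := ball (ctr i0 m f) m

noncomputable def Sl (i0 : Fin d) (m n : ℕ) : Finset (Vtx d) := (F0 i0 n).biUnion (slot i0 m)

theorem Sl_disj (i0 : Fin d) (m n : ℕ) : Disjoint (ball (0 : Vtx d) n) (Sl i0 m n) := by
  rw [Finset.disjoint_left]
  intro v hv hs
  obtain ⟨f, hf, hs⟩ := Finset.mem_biUnion.1 hs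
  have h1 := mem_ball.1 hv i0
  have h2 := mem_ball.1 hs i0
  have h3 := (Finset.mem_filter.1 hf).2.1
  simp only [ctr, Function.update_self, h3, Pi.zero_apply, abs_le] at h1 h2
  omega

theorem card_ball (u : Vtx d) (m : ℕ) : (ball u m).card = (2 * m + 1) ^ d := by
  rw [ball, Pi.card_Icc]
  simp [show ∀ x : ℤ, (x + m + 1 - (x - m)).toNat = 2 * m + 1 by intro x; omega]

theorem slot_pigeon (i0 : Fin d) (m n M' : ℕ) (X : Finset (Vtx d)) (hX : X ⊆ F0 i0 n)
    (hc : M' * (2 * m + 1) ^ d < X.card) :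
    ∃ X' ⊆ X, M' ≤ X'.card ∧ ∀ f ∈ X', ∀ f' ∈ X', f ≠ f' → Disjoint (slot i0 m f) (slot i0 m f') := by
  obtain ⟨y, -, hy⟩ := Finset.exists_lt_card_fiber_of_mul_lt_card_of_maps_to
    (s := X) (t := (Finset.univ : Finset (Fin d → ZMod (2 * m + 1)))) (n := M')
    (f := fun f j => (f j : ZMod (2 * m + 1))) (fun _ _ => Finset.mem_univ _)
    (by simpa [mul_comm] using hc)
  refine ⟨_, Finset.filter_subset _ _, hy.le, ?_⟩
  intro f hf f' hf' hne
  obtain ⟨hfX, hfy⟩ := Finset.mem_filter.1 hf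
  obtain ⟨hfX', hfy'⟩ := Finset.mem_filter.1 hf'
  obtain ⟨j, hj⟩ : ∃ j, f j ≠ f' j := by by_contra! H; exact hne (funext H)
  have hj0 : j ≠ i0 := by
    rintro rfl
    exact hj (((Finset.mem_filter.1 (hX hfX)).2.1).trans ((Finset.mem_filter.1 (hX hfX')).2.1).symm)
  have hz : ((f j : ℤ) : ZMod (2 * m + 1)) = (f' j : ℤ) := by
    rw [congrFun hfy j, congrFun hfy' j]
  rw [ZMod.intCast_eq_intCast_iff_dvd_sub] at hz
  have hz := Int.le_of_dvd (abs_pos.2 (sub_ne_zero.2 hj.symm)) ((dvd_abs _ _).2 hz)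
  rw [Finset.disjoint_left]
  intro v hv hv'
  have h1 := mem_ball.1 hv j
  have h2 := mem_ball.1 hv' j
  simp only [ctr, Function.update_of_ne hj0] at h1 h2
  have := abs_sub_le (f' j) (v j) (f j)
  rw [abs_sub_comm] at h2
  push_cast at hz
  omega

/-- nominal success -/
def Nom (i0 : Fin d) (m n : ℕ) (O : Finset (Vtx d)) : Prop :=
  ∃ f ∈ F0 i0 n, f ∈ U m n (O ∩ ball 0 n) ∧ slot i0 m f ⊆ O

theorem C4 (i0 : Fin d) {q δ η : ℝ} (h0 : 0 ≤ q) (h1 : q < 1) (hδ0 : 0 < δ) (hδ1 : δ ≤ 1)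
    (hC1 : ∀ η : ℝ, 0 < η → ∃ m : ℕ, ∀ n, m ≤ n →
      1 - η ≤ pr (fun _ => q) (ball (0 : Vtx d) n) (Conn m n))
    (hη : 0 < η) :
    ∃ m n : ℕ, m < n ∧ 1 - η ≤ pr (fun v => if v ∈ ball 0 n then q else δ)
      (ball (0 : Vtx d) n ∪ Sl i0 m n) (Nom i0 m n) := by
  obtain ⟨m, hm⟩ := C3 i0 h0 h1 hC1 (half_pos hη)
  set b := (2 * m + 1) ^ d
  have hb : δ ^ b ≤ 1 := pow_le_one₀ hδ0.le hδ1
  have hb0 : 0 < δ ^ b := by positivity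
  obtain ⟨M', hM'⟩ := exists_pow_lt_of_lt_one (half_pos hη) (show 1 - δ ^ b < 1 by linarith)
  obtain ⟨n₀, hn₀⟩ := hm (M' * b)
  refine ⟨m, max n₀ (m + 1), by omega, ?_⟩
  set n := max n₀ (m + 1)
  have hn := hn₀ n (le_max_left _ _)
  set r : Vtx d → ℝ := fun v => if v ∈ ball 0 n then q else δ with hr
  have hr0 : ∀ v, 0 ≤ r v := fun v => by simp only [hr]; split_ifs <;> linarith
  have hr1 : ∀ v, r v ≤ 1 := fun v => by simp only [hr]; split_ifs <;> linarith
  suffices h : pr r (ball (0 : Vtx d) n ∪ Sl i0 m n) (fun O => ¬ Nom i0 m n O) ≤ η by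
    rw [pr_not] at h; linarith
  have hdj := Sl_disj i0 m n
  rw [pr_union _ hdj]
  have hpt : ∀ O₁ ⊆ ball (0 : Vtx d) n, pr r (Sl i0 m n)
      (fun O₂ => ¬ Nom i0 m n (O₁ ∪ O₂)) ≤
      (if (U m n O₁ ∩ F0 i0 n).card ≤ M' * b then 1 else 0) + η / 2 := by
    intro O₁ hO₁
    by_cases hc : (U m n O₁ ∩ F0 i0 n).card ≤ M' * b
    · rw [if_pos hc]
      have : pr r (Sl i0 m n) (fun O₂ => ¬ Nom i0 m n (O₁ ∪ O₂)) ≤ 1 :=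
        pr_le_one (fun v _ => hr0 v) (fun v _ => hr1 v)
      linarith
    · rw [if_neg hc, zero_add]
      obtain ⟨X', hX', hcard, hdis⟩ := slot_pigeon i0 m n M' (U m n O₁ ∩ F0 i0 n)
        Finset.inter_subset_right (not_le.1 hc)
      have h2 := pr_none_of hδ0.le hδ1 b X' (slot i0 m) (fun f => (card_ball _ _).le)
        (Sl i0 m n) (fun f hf => Finset.subset_biUnion_of_mem (slot i0 m)
          (Finset.mem_inter.1 (hX' hf)).2) hdis
      have h3 : (1 - δ ^ b) ^ X'.card ≤ (1 - δ ^ b) ^ M' :=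
        pow_le_pow_of_le_one (by linarith) (by linarith) hcard
      refine le_trans ?_ (h2.trans (h3.trans hM'.le))
      have h4 : pr r (Sl i0 m n) (fun O => ∀ f ∈ X', ¬ slot i0 m f ⊆ O) =
          pr (fun _ => δ) (Sl i0 m n) (fun O => ∀ f ∈ X', ¬ slot i0 m f ⊆ O) := by
        refine ex_congr (fun v hv => ?_) (fun _ _ => rfl)
        simp only [hr]
        rw [if_neg (Finset.disjoint_right.1 hdj hv)]
      rw [← h4]
      refine pr_mono (fun v _ => hr0 v)
        (fun v _ => hr1 v) fun O₂ hO₂ hN f hf hs => hN ?_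
      obtain ⟨hfU, hfF⟩ := Finset.mem_inter.1 (hX' hf)
      refine ⟨f, hfF, U_mono m n ?_ hfU, hs.trans Finset.subset_union_right⟩
      exact fun x hx => Finset.mem_inter.2 ⟨Finset.mem_union_left _ hx, hO₁ hx⟩
  refine (ex_mono (fun v _ => hr0 v) (fun v _ => hr1 v) hpt).trans ?_
  rw [ex_add, ex_const]
  have : ex r (ball (0 : Vtx d) n) (fun O => if (U m n O ∩ F0 i0 n).card ≤ M' * b then 1 else 0)
      = pr (fun _ => q) (ball (0 : Vtx d) n) (fun O => (U m n O ∩ F0 i0 n).card ≤ M' * b) := by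
    rw [pr_eq]
    refine ex_congr (fun v hv => ?_) (fun _ _ => rfl)
    simp only [hr]; rw [if_pos hv]
  rw [this]
  linarith

end slots

section gmstep
variable {d : ℕ}
open Classical

def Succ0 (i0 : Fin d) (m n : ℕ) (A : Set (Vtx d)) (O : Finset (Vtx d)) : Prop :=
  ∃ f ∈ F0 i0 n, ∀ v ∈ slot i0 m f, Reach adj A (O : Set (Vtx d)) v

theorem pow_split {q δ : ℝ} (hq : q < 1) (hq0 : 0 ≤ q) (hδ0 : 0 ≤ δ) (hδ1 : δ ≤ 1) (K N : ℕ) :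
    (1 - δ) ^ N ≤ (1 - δ) ^ K + ((1 - q) ^ K)⁻¹ * (1 - q) ^ N := by
  have h1 : 0 < (1 - q) ^ K := pow_pos (by linarith) _
  have h2 : 0 < (1 - q) ^ N := pow_pos (by linarith) _
  rcases le_total K N with h | h
  · have : (1 - δ) ^ N ≤ (1 - δ) ^ K := pow_le_pow_of_le_one (by linarith) (by linarith) h
    have : 0 ≤ ((1 - q) ^ K)⁻¹ * (1 - q) ^ N := by positivity
    linarith
  · have a : (1 - q) ^ K ≤ (1 - q) ^ N := pow_le_pow_of_le_one (by linarith) (by linarith) h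
    have b : 1 ≤ ((1 - q) ^ K)⁻¹ * (1 - q) ^ N := by
      rw [inv_mul_eq_div, le_div_iff₀ h1]; linarith
    have c : (1 - δ) ^ N ≤ 1 := pow_le_one₀ (by linarith) (by linarith)
    have e : 0 ≤ (1 - δ) ^ K := pow_nonneg (by linarith) _
    linarith

theorem C5 (i0 : Fin d) {q δ ε : ℝ} (h1 : q < 1) (hδ0 : 0 < δ) (hδq : δ ≤ q)
    (hC1 : ∀ η : ℝ, 0 < η → ∃ m : ℕ, ∀ n, m ≤ n →
      1 - η ≤ pr (fun _ => q) (ball (0 : Vtx d) n) (Conn m n))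
    (hε : 0 < ε) :
    ∃ m n : ℕ, m < n ∧ ∀ (A : Set (Vtx d)) (r : Vtx d → ℝ) (R : Finset (Vtx d)),
      (ball (0 : Vtx d) m : Set (Vtx d)) ⊆ A → (∀ v ∈ R, δ ≤ r v) → (∀ v ∈ R, r v ≤ 1) →
      (∀ v ∈ ball (0 : Vtx d) n, v ∉ A → (∀ a ∈ A, ¬ adj a v) → q ≤ r v) →
      (∀ v ∈ ball (0 : Vtx d) n ∪ Sl i0 m n, v ∉ A → v ∈ R) →
      1 - ε ≤ pr r R (Succ0 i0 m n A) := by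
  have h0 : 0 ≤ q := by linarith
  have hδ1 : δ ≤ 1 := by linarith
  obtain ⟨K, hK⟩ := exists_pow_lt_of_lt_one (half_pos hε) (show 1 - δ < 1 by linarith)
  have hqK : 0 < (1 - q) ^ K := pow_pos (by linarith) _
  obtain ⟨m, n, hmn, hnom⟩ := C4 i0 h0 h1 hδ0 hδ1 hC1 (η := ε / 2 * (1 - q) ^ K) (by positivity)
  refine ⟨m, n, hmn, fun A r R hA hrδ hr1 hrq hR => ?_⟩
  set S0 := ball (0 : Vtx d) n ∪ Sl i0 m n with hS0
  set E := (ball (0 : Vtx d) n).filter (fun v => v ∈ A ∨ ∃ a ∈ A, adj a v) with hE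
  set R1 := ball (0 : Vtx d) n \ E with hR1
  have hEb : E ⊆ ball (0 : Vtx d) n := Finset.filter_subset _ _
  have hdj := Sl_disj i0 m n
  set r0 : Vtx d → ℝ := fun v => if v ∈ R1 then q else δ with hr0
  set r1 : Vtx d → ℝ := fun v => if v ∈ ball (0 : Vtx d) n then q else δ with hr1d
  have b0 : ∀ v, 0 ≤ r0 v := fun v => by simp only [hr0]; split_ifs <;> linarith
  have b1 : ∀ v, r0 v ≤ 1 := fun v => by simp only [hr0]; split_ifs <;> linarith
  have c0 : ∀ v, 0 ≤ r1 v := fun v => by simp only [hr1d]; split_ifs <;> linarith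
  have c1 : ∀ v, r1 v ≤ 1 := fun v => by simp only [hr1d]; split_ifs <;> linarith
  have hmono : ∀ O O', O ⊆ O' → Succ0 i0 m n A O → Succ0 i0 m n A O' := by
    rintro O O' h ⟨f, hf, H⟩
    exact ⟨f, hf, fun v hv => (H v hv).mono subset_rfl (by exact_mod_cast h)⟩
  -- reduction to r0 on S0
  have s1 : pr r (S0 \ Finset.filter (· ∈ A) S0) (Succ0 i0 m n A) ≤ pr r R (Succ0 i0 m n A) := by
    refine pr_mono_R ?_ hmono (fun v hv => hδ0.le.trans (hrδ v hv)) hr1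
    intro v hv
    simp only [Finset.mem_sdiff, Finset.mem_filter, not_and] at hv
    exact hR v hv.1 (hv.2 hv.1)
  have s2 : pr r0 (S0 \ Finset.filter (· ∈ A) S0) (Succ0 i0 m n A) ≤
      pr r (S0 \ Finset.filter (· ∈ A) S0) (Succ0 i0 m n A) := by
    have hin : ∀ v ∈ S0 \ Finset.filter (· ∈ A) S0, v ∈ R ∧ v ∉ A := by
      intro v hv
      simp only [Finset.mem_sdiff, Finset.mem_filter, not_and] at hv
      exact ⟨hR v hv.1 (hv.2 hv.1), hv.2 hv.1⟩
    refine pr_mono_r hmono (fun v _ => b0 v) (fun v hv => ?_) fun v hv => hr1 v (hin v hv).1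
    simp only [hr0]
    split_ifs with h
    · simp only [hR1, hE, Finset.mem_sdiff, Finset.mem_filter, not_and, not_or, not_exists] at h
      exact hrq v h.1 (hin v hv).2 fun a ha => (h.2 h.1).2 a ha
    · exact hrδ v (hin v hv).1
  have s3 : pr r0 S0 (Succ0 i0 m n A) ≤
      pr r0 (S0 \ Finset.filter (· ∈ A) S0) (Succ0 i0 m n A) := by
    have : S0 = (S0 \ Finset.filter (· ∈ A) S0) ∪ Finset.filter (· ∈ A) S0 :=
      (Finset.sdiff_union_of_subset (Finset.filter_subset _ _)).symm
    conv_lhs => rw [this]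
    rw [pr_union _ Finset.sdiff_disjoint, pr_eq]
    refine ex_mono (fun v _ => b0 v) (fun v _ => b1 v) fun O₁ _ => ?_
    by_cases hs : Succ0 i0 m n A O₁
    · rw [if_pos hs]; exact pr_le_one (fun v _ => b0 v) (fun v _ => b1 v)
    · rw [if_neg hs]
      refine ex_le (fun v _ => b0 v) (fun v _ => b1 v) fun O₂ hO₂ => ?_
      rw [if_neg]
      rintro ⟨f, hf, H⟩
      refine hs ⟨f, hf, fun v hv => ?_⟩
      have : ∀ w, Reach adj A ((O₁ ∪ O₂ : Finset (Vtx d)) : Set (Vtx d)) w →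
          Reach adj A (O₁ : Set (Vtx d)) w := by
        intro w hw
        induction hw with
        | base w h => exact .base w h
        | step x w _ hg hw ih =>
          rcases Finset.mem_union.1 hw with h | h
          · exact .step x w ih hg h
          · exact .base w (Finset.mem_filter.1 (hO₂ h)).2
      exact this v (H v hv)
  -- decomposition
  have hdec : S0 = (R1 ∪ Sl i0 m n) ∪ E := by
    rw [hS0, hR1, Finset.union_right_comm, Finset.sdiff_union_of_subset hEb]
  have hdecd : Disjoint (R1 ∪ Sl i0 m n) E := by
    rw [Finset.disjoint_union_left]
    exact ⟨Finset.sdiff_disjoint, (hdj.mono_left hEb).symm⟩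
  let N : Finset (Vtx d) → Finset (Vtx d) := fun O => E.filter (fun e => ∃ f ∈ F0 i0 n,
    slot i0 m f ⊆ O ∧ Reach adj {e} ((O ∩ R1 : Finset (Vtx d)) : Set (Vtx d)) f)
  have hNE : ∀ O, N O ⊆ E := fun O => Finset.filter_subset _ _
  -- nominal
  have hn1 : pr r1 S0 (Nom i0 m n) ≤
      ex r1 (R1 ∪ Sl i0 m n) (fun O => 1 - (1 - q) ^ (N O).card) := by
    rw [hdec, pr_union _ hdecd]
    refine ex_mono (fun v _ => c0 v) (fun v _ => c1 v) fun O hO => ?_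
    have h3 : pr r1 E (fun Oe => Disjoint Oe (N O)) = (1 - q) ^ (N O).card := by
      rw [pr_eq, ex_none _ (hNE O), ← Finset.prod_const]
      refine Finset.prod_congr rfl fun v hv => ?_
      simp only [hr1d]; rw [if_pos (hEb (hNE O hv))]
    rw [← h3, ← pr_not]
    refine pr_mono (fun v _ => c0 v) (fun v _ => c1 v) fun Oe hOe => ?_
    rintro ⟨f, hf, hfU, hfs⟩
    have hfs' : slot i0 m f ⊆ O := by
      intro v hv
      rcases Finset.mem_union.1 (hfs hv) with h | h
      · exact h
      · exact absurd (Finset.mem_biUnion.2 ⟨f, hf, hv⟩)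
          (Finset.disjoint_left.1 hdj (hEb (hOe h)))
    have hr := (Finset.mem_filter.1 hfU).2
    have key : ∀ w, Reach adj ((ball (0 : Vtx d) m : Set (Vtx d)) ∩
        (((O ∪ Oe) ∩ ball 0 n : Finset (Vtx d)) : Set (Vtx d)))
        (((O ∪ Oe) ∩ ball 0 n : Finset (Vtx d)) : Set (Vtx d)) w →
        ∃ e ∈ Oe, Reach adj {e} ((O ∩ R1 : Finset (Vtx d)) : Set (Vtx d)) w := by
      have hEO : ∀ w ∈ E, w ∈ O ∪ Oe → w ∈ Oe := by
        intro w hw h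
        rcases Finset.mem_union.1 h with h | h
        · exact absurd hw (Finset.disjoint_left.1 hdecd (hO h))
        · exact h
      intro w hw
      induction hw with
      | base w h =>
        obtain ⟨h1, h2⟩ := h
        have h2 := Finset.mem_inter.1 h2
        exact ⟨w, hEO w (Finset.mem_filter.2 ⟨h2.2, .inl (hA h1)⟩) h2.1, .base _ rfl⟩
      | step x w _ hg hw ih =>
        have hw := Finset.mem_inter.1 hw
        by_cases hwE : w ∈ E
        · exact ⟨w, hEO w hwE hw.1, .base _ rfl⟩
        · obtain ⟨e, he, hre⟩ := ih
          refine ⟨e, he, .step x w hre hg ?_⟩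
          have hwO : w ∈ O := by
            rcases Finset.mem_union.1 hw.1 with h | h
            · exact h
            · exact absurd (hOe h) hwE
          exact Finset.mem_inter.2 ⟨hwO, Finset.mem_sdiff.2 ⟨hw.2, hwE⟩⟩
    obtain ⟨e, he, hre⟩ := key f hr
    rw [Finset.not_disjoint_iff]
    exact ⟨e, he, Finset.mem_filter.2 ⟨hOe he, f, hf, hfs', hre⟩⟩
  have hn2 : ex r1 (R1 ∪ Sl i0 m n) (fun O => 1 - (1 - δ) ^ (N O).card) ≤
      pr r0 S0 (Succ0 i0 m n A) := by
    rw [hdec, pr_union _ hdecd]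
    have hrr : ∀ v ∈ R1 ∪ Sl i0 m n, r1 v = r0 v := by
      intro v hv
      simp only [hr0, hr1d]
      rcases Finset.mem_union.1 hv with h | h
      · rw [if_pos h, if_pos (Finset.sdiff_subset h)]
      · rw [if_neg (Finset.disjoint_right.1 hdj h),
          if_neg (fun h' => Finset.disjoint_right.1 hdj h (Finset.sdiff_subset h'))]
    rw [ex_congr hrr (fun _ _ => rfl)]
    refine ex_mono (fun v _ => b0 v) (fun v _ => b1 v) fun O hO => ?_
    have h3 : pr r0 E (fun Oe => Disjoint Oe (N O)) = (1 - δ) ^ (N O).card := by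
      rw [pr_eq, ex_none _ (hNE O), ← Finset.prod_const]
      refine Finset.prod_congr rfl fun v hv => ?_
      simp only [hr0]; rw [if_neg (fun h => (Finset.mem_sdiff.1 h).2 (hNE O hv))]
    rw [← h3, ← pr_not]
    refine pr_mono (fun v _ => b0 v) (fun v _ => b1 v) fun Oe hOe hnd => ?_
    obtain ⟨e, he, heN⟩ := Finset.not_disjoint_iff.1 hnd
    obtain ⟨heE, f, hf, hfs, hre⟩ := Finset.mem_filter.1 heN
    refine ⟨f, hf, fun v hv => ?_⟩
    set OO : Set (Vtx d) := ((O ∪ Oe : Finset (Vtx d)) : Set (Vtx d)) with hOO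
    have hOsub : (O : Set (Vtx d)) ⊆ OO := by simp [hOO]
    have r_e : Reach adj A OO e := by
      rcases (Finset.mem_filter.1 heE).2 with h | ⟨a, ha, hae⟩
      · exact .base _ h
      · exact .step a e (.base a ha) hae (by simp [hOO, he])
    have r_f : Reach adj A OO f := by
      refine Reach.bind (A := {e}) (by rintro _ rfl; exact r_e) (hre.mono subset_rfl ?_)
      exact fun x hx => hOsub (Finset.mem_inter.1 hx).1
    set f1 := Function.update f i0 (f i0 + 1) with hf1
    have hf1m : f1 ∈ slot i0 m f := by
      rw [slot, mem_ball]
      intro j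
      by_cases hj : j = i0
      · subst hj
        simp only [hf1, ctr, Function.update_self]
        rw [abs_le]; constructor <;> omega
      · simp [hf1, ctr, Function.update_of_ne hj]
    have r_f1 : Reach adj A OO f1 :=
      .step f f1 r_f (adj_update f i0 (.inl rfl)) (hOsub (hfs hf1m))
    refine Reach.bind (A := {f1}) (by rintro _ rfl; exact r_f1)
      ((ball_conn _ _ _ hf1m v hv).mono subset_rfl ?_)
    exact fun x hx => hOsub (hfs hx)
  -- conclusion
  have hf : ex r1 (R1 ∪ Sl i0 m n) (fun O => (1 - δ) ^ (N O).card) ≤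
      (1 - δ) ^ K + ((1 - q) ^ K)⁻¹ * ex r1 (R1 ∪ Sl i0 m n) (fun O => (1 - q) ^ (N O).card) := by
    rw [← ex_mul, ← ex_const r1 (R1 ∪ Sl i0 m n) ((1 - δ) ^ K), ← ex_add]
    exact ex_mono (fun v _ => c0 v) (fun v _ => c1 v) fun O _ =>
      pow_split h1 h0 hδ0.le hδ1 K _
  rw [ex_sub, ex_const] at hn1 hn2
  have hfin : ((1 - q) ^ K)⁻¹ * ex r1 (R1 ∪ Sl i0 m n) (fun O => (1 - q) ^ (N O).card) ≤ ε / 2 := by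
    rw [inv_mul_le_iff₀ hqK]; linarith
  linarith

/-- The Grimmett-Marstrand step, in an arbitrary direction. -/
theorem GMstep (hd : 0 < d) {q δ ε : ℝ} (h1 : q < 1) (hδ0 : 0 < δ) (hδq : δ ≤ q)
    (hC1 : ∀ η : ℝ, 0 < η → ∃ m : ℕ, ∀ n, m ≤ n →
      1 - η ≤ pr (fun _ => q) (ball (0 : Vtx d) n) (Conn m n))
    (hε : 0 < ε) :
    ∃ m n : ℕ, m < n ∧ ∀ (u : Vtx d) (i : Fin d) (s : Fin d → ℤˣ) (A : Set (Vtx d))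
      (r : Vtx d → ℝ) (R : Finset (Vtx d)),
      (ball u m : Set (Vtx d)) ⊆ A → (∀ v ∈ R, δ ≤ r v) → (∀ v ∈ R, r v ≤ 1) →
      (∀ v ∈ ball u n, v ∉ A → (∀ a ∈ A, ¬ adj a v) → q ≤ r v) →
      (∀ v ∈ ball u (n + 2 * m + 1), v ∉ A → v ∈ R) →
      1 - ε ≤ pr r R (fun O => ∃ u' : Vtx d, (∀ v ∈ ball u' m, Reach adj A (O : Set (Vtx d)) v) ∧
        u' i = u i + s i * (n + m + 1) ∧ ∀ j, j ≠ i → 0 ≤ s j * (u' j - u j) ∧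
          s j * (u' j - u j) ≤ n) := by
  set i0 : Fin d := ⟨0, hd⟩
  obtain ⟨m, n, hmn, H⟩ := C5 i0 h1 hδ0 hδq hC1 hε
  refine ⟨m, n, hmn, fun u i s A r R hA hrδ hr1 hrq hR => ?_⟩
  set e := aut u (Equiv.swap i0 i) s with he
  have he0 : e 0 = u := by funext j; simp [he, aut_apply]
  have hball : ∀ v k, e v ∈ ball u k ↔ v ∈ ball 0 k := by
    intro v k; rw [← he0]; exact aut_ball _ _ _ _ _ _
  have hRR : R = (R.map e.symm.toEmbedding).map e.toEmbedding := by
    ext w; simp [Finset.mem_map]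
  have hmR : ∀ v, v ∈ R.map e.symm.toEmbedding ↔ e v ∈ R := by
    intro v
    simp only [Finset.mem_map, Equiv.coe_toEmbedding]
    exact ⟨by rintro ⟨a, ha, rfl⟩; simpa using ha, fun h => ⟨_, h, by simp⟩⟩
  have := H (e ⁻¹' A) (r ∘ e) (R.map e.symm.toEmbedding)
    (fun v hv => hA ((hball v m).2 hv)) (fun v hv => hrδ _ ((hmR v).1 hv))
    (fun v hv => hr1 _ ((hmR v).1 hv))
    (fun v hv hvA hva => hrq (e v) ((hball v n).2 hv) hvA fun a ha hadj => by
      obtain ⟨b, rfl⟩ := e.surjective a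
      exact hva b ha ((aut_adj _ _ _ _ _).1 hadj))
    (fun v hv hvA => (hmR v).2 (hR (e v) ((hball v _).2 (by
      rcases Finset.mem_union.1 hv with h | h
      · exact ball_mono _ (by omega) h
      · obtain ⟨f, hf, hs⟩ := Finset.mem_biUnion.1 h
        have hf' := mem_ball.1 (Finset.mem_filter.1 hf).1
        rw [slot, mem_ball] at hs
        rw [mem_ball]
        intro j
        have a := abs_le.1 (hf' j)
        have b := abs_le.1 (hs j)
        have c : ctr i0 m f j = f j ∨ ctr i0 m f j = f j + (m + 1) := by
          by_cases hj : j = i0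
          · subst hj; right; simp [ctr]
          · left; simp [ctr, Function.update_of_ne hj]
        simp only [Pi.zero_apply, sub_zero] at a ⊢
        rw [abs_le]
        push_cast
        rcases c with c | c <;> rw [c] at b <;> constructor <;> linarith)) hvA))
  refine this.trans ?_
  conv_rhs => rw [hRR, pr_map]
  refine pr_mono (fun v hv => hδ0.le.trans (hrδ _ ((hmR v).1 hv)))
    (fun v hv => hr1 _ ((hmR v).1 hv)) fun O _ => ?_
  rintro ⟨f, hf, hs⟩
  have hff := Finset.mem_filter.1 hf
  have hss : ∀ j, ((s j : ℤ)) * s j = 1 := fun j => by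
    rw [← Units.val_mul, Int.units_mul_self]; rfl
  refine ⟨e (ctr i0 m f), fun w hw => ?_, ?_, fun j hj => ?_⟩
  · obtain ⟨v, rfl⟩ := e.surjective w
    have hv : v ∈ slot i0 m f := (aut_ball _ _ _ _ _ _).1 hw
    have := (reach_aut u (Equiv.swap i0 i) s _ _ _).2 (hs v hv)
    rw [← he] at this
    rw [image_preimage_eq _ e.surjective] at this
    simpa using this
  · simp only [he, aut_apply, Equiv.swap_apply_right, ctr, Function.update_self, hff.2.1]
    ring
  · have hne : Equiv.swap i0 i j ≠ i0 := by
      intro h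
      exact hj ((Equiv.swap i0 i).injective (h.trans (Equiv.swap_apply_right i0 i).symm))
    have e1 : s j * (e (ctr i0 m f) j - u j) = f (Equiv.swap i0 i j) := by
      simp only [he, aut_apply, ctr, Function.update_of_ne hne]
      linear_combination f (Equiv.swap i0 i j) * hss j
    rw [e1]
    refine ⟨hff.2.2 _, ?_⟩
    have := mem_ball.1 hff.1 (Equiv.swap i0 i j)
    simp only [Pi.zero_apply, sub_zero] at this
    exact (le_abs_self _).trans this

end gmstep

section engine
variable {V : Type} [DecidableEq V] [Countable V] {Ω : Type} [Fintype Ω] [MeasurableSpace Ω]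
  [MeasurableSingletonClass Ω]

/-- configurations compatible with the knowledge `C` -/
def cyl (C : V → Set Ω) : Set (V → Ω) := {u | ∀ v, u v ∈ C v}

theorem cyl_meas (C : V → Set Ω) : MeasurableSet (cyl C) := by
  have : cyl C = ⋂ v, (fun u : V → Ω => u v) ⁻¹' C v := by ext; simp [cyl]
  rw [this]
  exact MeasurableSet.iInter fun v => (measurable_pi_apply v) (toFinite _).measurableSet

/-- finitely supported knowledge -/
def FS (C : V → Set Ω) : Prop := ∃ F : Finset V, ∀ v, v ∉ F → C v = univ

/-- product measure -/
noncomputable def PM (V : Type) {Ω : Type} [MeasurableSpace Ω] (ν : Measure Ω) : Measure (V → Ω) :=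
  Measure.infinitePi (fun _ : V => ν)

variable {ν : Measure Ω} [IsProbabilityMeasure ν]

instance : IsProbabilityMeasure (PM V ν) := by unfold PM; infer_instance

theorem cyl_prod (C : V → Set Ω) (F : Finset V) (hF : ∀ v, v ∉ F → C v = univ) :
    (PM V ν).real (cyl C) = ∏ v ∈ F, ν.real (C v) := by
  have : cyl C = Set.pi F C := by
    ext u
    simp only [cyl, mem_setOf_eq, Set.mem_pi, Finset.mem_coe]
    refine ⟨fun h v _ => h v, fun h v => ?_⟩
    by_cases hv : v ∈ F
    · exact h v hv
    · rw [hF v hv]; trivial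
  rw [this, measureReal_def, PM, Measure.infinitePi_pi]
  · rw [ENNReal.toReal_prod]; rfl
  · exact fun v _ => (toFinite _).measurableSet

theorem FS.upd {C : V → Set Ω} (h : FS C) (v : V) (D : Set Ω) : FS (Function.update C v D) := by
  obtain ⟨F, hF⟩ := h
  refine ⟨insert v F, fun w hw => ?_⟩
  simp only [Finset.mem_insert, not_or] at hw
  rw [Function.update_of_ne hw.1, hF w hw.2]

theorem cyl_upd {C : V → Set Ω} (h : FS C) (v : V) (Q : Set Ω) :
    ν.real Q * (PM V ν).real (cyl C) ≤ (PM V ν).real (cyl (Function.update C v Q)) := by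
  obtain ⟨F, hF⟩ := h
  have hF' : ∀ w, w ∉ insert v F → C w = univ := fun w hw =>
    hF w fun h => hw (Finset.mem_insert_of_mem h)
  rw [cyl_prod C (insert v F) hF', cyl_prod (Function.update C v Q) (insert v F) (by
    intro w hw
    rw [Function.update_of_ne (by rintro rfl; simp at hw), hF' w hw])]
  rw [← Finset.mul_prod_erase _ _ (Finset.mem_insert_self v F),
    ← Finset.mul_prod_erase _ (fun w => ν.real (Function.update C v Q w))
      (Finset.mem_insert_self v F)]
  simp only [Function.update_self]
  refine mul_le_mul_of_nonneg_left ?_ measureReal_nonneg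
  rw [Finset.prod_congr rfl (f := fun w => ν.real (Function.update C v Q w))
    (g := fun w => ν.real (C w)) fun w hw => by
      rw [Function.update_of_ne (Finset.ne_of_mem_erase hw)]]
  exact mul_le_of_le_one_left (Finset.prod_nonneg fun _ _ => measureReal_nonneg)
    measureReal_le_one

/-- `f` resolves the knowledge `C` into finitely many finer cylinders -/
structure Rslv {S : Type} (C : V → Set Ω) (f : (V → Ω) → S) (K : S → V → Set Ω) : Prop where
  mem : ∀ u ∈ cyl C, u ∈ cyl (K (f u))
  sub : ∀ u ∈ cyl C, ∀ v, K (f u) v ⊆ C v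
  fib : ∀ u ∈ cyl C, ∀ u' ∈ cyl (K (f u)), f u' = f u
  fin : (f '' cyl C).Finite

open Classical in
theorem Rslv.sum {S : Type} {C : V → Set Ω} {f : (V → Ω) → S} {K : S → V → Set Ω}
    (h : Rslv C f K) (P : S → Prop) :
    (PM V ν).real (cyl C ∩ {u | P (f u)})
      = ∑ s ∈ h.fin.toFinset with P s, (PM V ν).real (cyl (K s)) := by
  rw [← measureReal_biUnion_finset]
  · congr 1
    ext u
    simp only [mem_inter_iff, mem_setOf_eq, Finset.mem_filter, Set.Finite.mem_toFinset, mem_image,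
      mem_iUnion, exists_prop]
    constructor
    · rintro ⟨h1, h2⟩; exact ⟨f u, ⟨⟨u, h1, rfl⟩, h2⟩, h.mem u h1⟩
    · rintro ⟨s, ⟨⟨u', h1, rfl⟩, h2⟩, h3⟩
      exact ⟨fun v => h.sub u' h1 v (h3 v), by rw [h.fib u' h1 u h3]; exact h2⟩
  · intro s hs t ht hst
    simp only [Finset.coe_filter, Set.Finite.mem_toFinset, mem_image, mem_setOf_eq] at hs ht
    obtain ⟨⟨u, hu, rfl⟩, -⟩ := hs
    obtain ⟨⟨u', hu', rfl⟩, -⟩ := ht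
    refine Set.disjoint_left.2 fun w hw hw' => hst ?_
    rw [← h.fib u hu w hw, h.fib u' hu' w hw']
  · exact fun s _ => cyl_meas _

open Classical in
theorem Rslv.le {S : Type} {C : V → Set Ω} {f : (V → Ω) → S} {K : S → V → Set Ω}
    (h : Rslv C f K) (P : S → Prop) (G : S → Set (V → Ω)) (c : ℝ)
    (hP : ∀ u ∈ cyl C, P (f u) → (PM V ν).real (cyl (K (f u)) ∩ G (f u))
      ≤ c * (PM V ν).real (cyl (K (f u)))) :
    (PM V ν).real (cyl C ∩ {u | P (f u) ∧ u ∈ G (f u)})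
      ≤ c * (PM V ν).real (cyl C ∩ {u | P (f u)}) := by
  rw [h.sum P, Finset.mul_sum]
  refine le_trans (measureReal_mono (s₂ := ⋃ s ∈ h.fin.toFinset.filter (fun s => P s),
    (cyl (K s) ∩ G s)) ?_ (measure_ne_top _ _)) ?_
  · rintro u ⟨h1, h2, h3⟩
    simp only [Finset.mem_filter, Set.Finite.mem_toFinset, mem_image, mem_iUnion, exists_prop]
    exact ⟨f u, ⟨⟨u, h1, rfl⟩, h2⟩, h.mem u h1, h3⟩
  · refine (measureReal_biUnion_finset_le _ _).trans (Finset.sum_le_sum fun s hs => ?_)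
    simp only [Finset.mem_filter, Set.Finite.mem_toFinset, mem_image] at hs
    obtain ⟨⟨u, hu, rfl⟩, h2⟩ := hs
    exact hP u hu h2

/-- outcome of an exploration of `R` -/
structure Out (g : V → V → Prop) (ξ : ℕ → Bool) (lt : Ω → Bool) (Q : V → Bool → Set Ω)
    (Near : V → Prop) (R : Finset V) (lab : V → Option ℕ) (C : V → Set Ω)
    (lab' : V → Option ℕ) (C' : V → Set Ω) : Prop where
  ext : ∀ v l, lab v = some l → lab' v = some l
  new : ∀ v l, lab v = none → lab' v = some l → v ∈ R ∧ ∃ k w, l = k + 1 ∧ g w v ∧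
    lab' w = some k ∧ ∀ o ∈ C' v, lt o = ξ k
  bd : ∀ β, (∀ w l, lab w = some l → Near w → l ≤ β) →
    ∀ w l, lab' w = some l → Near w → l ≤ β + R.card
  unk : ∀ v, lab' v = none → C' v = C v ∨ v ∈ R ∧ (∃ w, lab' w ≠ none ∧ g w v) ∧
    ∃ a, C' v = C v \ Q v a
  sub : ∀ v, C' v ⊆ C v
  fs : FS C'

/-- labelled vertices -/
def dom (lab : V → Option ℕ) : Set V := {v | lab v ≠ none}

theorem E1 (g : V → V → Prop) (ξ : ℕ → Bool) (lt : Ω → Bool) (Q : V → Bool → Set Ω)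
    (Near : V → Prop) (r : V → ℝ) (Ev : Set V → Prop) (hEv : ∀ A B, A ⊆ B → Ev A → Ev B)
    (hQl : ∀ v a, ∀ o ∈ Q v a, lt o = a) (n : ℕ) :
    ∀ (R : Finset V) (lab : V → Option ℕ) (C : V → Set Ω), R.card = n → FS C →
    (∀ v ∈ R, lab v = none) → (∀ v ∈ R, ∀ a, Q v a ⊆ C v) →
    (∀ v ∈ R, 0 ≤ r v) → (∀ v ∈ R, ∀ a, r v ≤ ν.real (Q v a)) →
    (∀ v ∈ R, ∀ w, g w v → Near w) →
    ∃ f : (V → Ω) → (V → Option ℕ) × (V → Set Ω), Rslv C f Prod.snd ∧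
      (∀ u ∈ cyl C, Out g ξ lt Q Near R lab C (f u).1 (f u).2) ∧
      (PM V ν).real (cyl C ∩ {u | ¬ Ev (dom (f u).1)}) ≤
        (1 - pr r R (fun O => Ev {v | Reach g (dom lab) O v})) * (PM V ν).real (cyl C) := by
  induction n with
  | zero =>
    intro R lab C hn hC hR hQ hr0 hr hN
    rw [Finset.card_eq_zero] at hn
    subst hn
    refine ⟨fun _ => (lab, C), ⟨fun u h => h, fun _ _ _ => subset_rfl, fun _ _ _ _ => rfl, ?_⟩,
      fun u _ => ⟨fun _ _ h => h, ?_, fun β h => by simpa using h, fun _ _ => .inl rfl,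
        fun _ => subset_rfl, hC⟩, ?_⟩
    · exact (finite_singleton (lab, C)).subset (by rintro _ ⟨u, _, rfl⟩; simp)
    · intro v l h1 h2; simp [h1] at h2
    · by_cases hE : Ev (dom lab)
      · have : cyl C ∩ {u : V → Ω | ¬ Ev (dom lab)} = ∅ := by simp [hE]
        simp only [this, measureReal_empty]
        exact mul_nonneg (sub_nonneg.2 (pr_le_one (by simp) (by simp))) measureReal_nonneg
      · have : pr r ∅ (fun O => Ev {v | Reach g (dom lab) O v}) = 0 := by
          rw [pr, ex_empty, if_neg]
          intro h
          exact hE (hEv _ _ (fun v hv => reach_stuck (by simp) hv) h)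
        rw [this]
        simpa using measureReal_mono inter_subset_left
  | succ n ih =>
    intro R lab C hn hC hR hQ hr0 hr hN
    have hr1 : ∀ v ∈ R, r v ≤ 1 := fun v hv => (hr v hv true).trans measureReal_le_one
    by_cases hex : ∃ v ∈ R, ∃ w l, g w v ∧ lab w = some l
    swap
    · push Not at hex
      refine ⟨fun _ => (lab, C), ⟨fun u h => h, fun _ _ _ => subset_rfl, fun _ _ _ _ => rfl, ?_⟩,
        fun u _ => ⟨fun _ _ h => h, ?_, fun β h w l hw hw' => (h w l hw hw').trans (by omega),
          fun _ _ => .inl rfl, fun _ => subset_rfl, hC⟩, ?_⟩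
      · exact (finite_singleton (lab, C)).subset (by rintro _ ⟨u, _, rfl⟩; simp)
      · intro v l h1 h2; simp [h1] at h2
      · by_cases hE : Ev (dom lab)
        · have : cyl C ∩ {u : V → Ω | ¬ Ev (dom lab)} = ∅ := by simp [hE]
          simp only [this, measureReal_empty]
          exact mul_nonneg (sub_nonneg.2 (pr_le_one hr0 hr1)) measureReal_nonneg
        · have : pr r R (fun O => Ev {v | Reach g (dom lab) O v}) = 0 := by
            rw [pr_congr (ψ := fun _ => ¬ True), pr_not, pr_true, sub_self]
            intro O hO
            simp only [not_true_eq_false, iff_false]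
            intro h
            refine hE (hEv _ _ (fun v hv => reach_stuck ?_ hv) h)
            intro a ha v hv hav
            obtain ⟨l, hl⟩ := Option.ne_none_iff_exists'.1 ha
            exact absurd hl (hex v (hO hv) a l hav)
          rw [this]
          simpa using measureReal_mono inter_subset_left
    · obtain ⟨v, hvR, w, l, hwv, hwl⟩ := hex
      have hv0 := hR v hvR
      set q := Q v (ξ l) with hq
      have hwv' : w ≠ v := by rintro rfl; simp [hv0] at hwl
      have hc : (R.erase v).card = n := by rw [Finset.card_erase_of_mem hvR, hn]; rfl
      have her : ∀ x ∈ R.erase v, x ∈ R ∧ x ≠ v := fun x hx =>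
        ⟨Finset.mem_of_mem_erase hx, Finset.ne_of_mem_erase hx⟩
      set lab1 := Function.update lab v (some (l + 1)) with hlab1
      set C1 := Function.update C v q with hC1
      set C2 := Function.update C v (C v \ q) with hC2
      have hqC : q ⊆ C v := hQ v hvR _
      have hC1s : ∀ x, C1 x ⊆ C x := by
        intro x
        by_cases hx : x = v
        · subst hx; simpa [hC1] using hqC
        · simp [hC1, Function.update_of_ne hx]
      have hC2s : ∀ x, C2 x ⊆ C x := by
        intro x
        by_cases hx : x = v
        · subst hx; simpa [hC2] using diff_subset
        · simp [hC2, Function.update_of_ne hx]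
      obtain ⟨f1, R1, O1, B1⟩ := ih (R.erase v) lab1 C1 hc (hC.upd _ _)
        (fun x hx => by rw [hlab1, Function.update_of_ne (her x hx).2, hR x (her x hx).1])
        (fun x hx => by rw [hC1, Function.update_of_ne (her x hx).2]; exact hQ x (her x hx).1)
        (fun x hx => hr0 x (her x hx).1) (fun x hx => hr x (her x hx).1)
        (fun x hx => hN x (her x hx).1)
      obtain ⟨f2, R2, O2, B2⟩ := ih (R.erase v) lab C2 hc (hC.upd _ _)
        (fun x hx => hR x (her x hx).1)
        (fun x hx => by rw [hC2, Function.update_of_ne (her x hx).2]; exact hQ x (her x hx).1)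
        (fun x hx => hr0 x (her x hx).1) (fun x hx => hr x (her x hx).1)
        (fun x hx => hN x (her x hx).1)
      have m1 : ∀ u, u ∈ cyl C1 ↔ u ∈ cyl C ∧ u v ∈ q := by
        intro u
        refine ⟨fun h => ⟨fun x => hC1s x (h x), by simpa [hC1] using h v⟩, fun h x => ?_⟩
        by_cases hx : x = v
        · subst hx; simpa [hC1] using h.2
        · rw [hC1, Function.update_of_ne hx]; exact h.1 x
      have m2 : ∀ u, u ∈ cyl C2 ↔ u ∈ cyl C ∧ u v ∉ q := by
        intro u
        refine ⟨fun h => ⟨fun x => hC2s x (h x), by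
          have := h v; simp only [hC2, Function.update_self] at this; exact this.2⟩, fun h x => ?_⟩
        by_cases hx : x = v
        · subst hx; simpa [hC2] using ⟨h.1 x, h.2⟩
        · rw [hC2, Function.update_of_ne hx]; exact h.1 x
      classical
      set f : (V → Ω) → (V → Option ℕ) × (V → Set Ω) := fun u => if u v ∈ q then f1 u else f2 u
        with hf
      have hf1 : ∀ u, u v ∈ q → f u = f1 u := fun u h => if_pos h
      have hf2 : ∀ u, u v ∉ q → f u = f2 u := fun u h => if_neg h
      refine ⟨f, ⟨?_, ?_, ?_, ?_⟩, ?_, ?_⟩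
      · intro u hu
        by_cases h : u v ∈ q
        · rw [hf1 u h]; exact R1.mem u ((m1 u).2 ⟨hu, h⟩)
        · rw [hf2 u h]; exact R2.mem u ((m2 u).2 ⟨hu, h⟩)
      · intro u hu x
        by_cases h : u v ∈ q
        · rw [hf1 u h]; exact (R1.sub u ((m1 u).2 ⟨hu, h⟩) x).trans (hC1s x)
        · rw [hf2 u h]; exact (R2.sub u ((m2 u).2 ⟨hu, h⟩) x).trans (hC2s x)
      · intro u hu u' hu'
        by_cases h : u v ∈ q
        · rw [hf1 u h] at hu' ⊢
          have hh := (m1 u).2 ⟨hu, h⟩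
          rw [hf1 u' ((m1 u').1 fun x => R1.sub u hh x (hu' x)).2]
          exact R1.fib u hh u' hu'
        · rw [hf2 u h] at hu' ⊢
          have hh := (m2 u).2 ⟨hu, h⟩
          rw [hf2 u' ((m2 u').1 fun x => R2.sub u hh x (hu' x)).2]
          exact R2.fib u hh u' hu'
      · refine (R1.fin.union R2.fin).subset ?_
        rintro _ ⟨u, hu, rfl⟩
        by_cases h : u v ∈ q
        · rw [hf1 u h]; exact .inl ⟨u, (m1 u).2 ⟨hu, h⟩, rfl⟩
        · rw [hf2 u h]; exact .inr ⟨u, (m2 u).2 ⟨hu, h⟩, rfl⟩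
      · intro u hu
        by_cases h : u v ∈ q
        · rw [hf1 u h]
          obtain ⟨a1, a2, a3, a4, a5, a6⟩ := O1 u ((m1 u).2 ⟨hu, h⟩)
          have hext : ∀ x k, lab x = some k → (f1 u).1 x = some k := fun x k hk =>
            a1 x k (by rw [hlab1, Function.update_of_ne (by rintro rfl; simp [hv0] at hk), hk])
          have hvv : (f1 u).1 v = some (l + 1) := a1 v (l + 1) (by simp [hlab1])
          refine ⟨hext, fun x k h0 hk => ?_, fun β hβ x k hk hx => ?_, fun x hx => ?_,
            fun x => (a5 x).trans (hC1s x), a6⟩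
          · by_cases hx : x = v
            · subst hx
              refine ⟨hvR, l, w, ?_, hwv, hext _ _ hwl, fun o ho => ?_⟩
              · rw [hvv] at hk; simpa using hk.symm
              · have := a5 x ho
                simp only [hC1, Function.update_self] at this
                exact hQl _ _ o this
            · obtain ⟨b1, b2⟩ := a2 x k (by rw [hlab1, Function.update_of_ne hx, h0]) hk
              exact ⟨(her x b1).1, b2⟩
          · have := a3 (β + 1) (fun y j hy hy' => ?_) x k hk hx
            · omega
            · by_cases hyv : y = v
              · subst hyv
                have := hβ w l hwl (hN _ hvR w hwv)
                simp only [hlab1, Function.update_self, Option.some.injEq] at hy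
                omega
              · rw [hlab1, Function.update_of_ne hyv] at hy
                exact (hβ y j hy hy').trans (by omega)
          · have hxv : x ≠ v := by rintro rfl; simp [hvv] at hx
            rcases a4 x hx with b | ⟨b1, b2, b3⟩
            · left; rw [b, hC1, Function.update_of_ne hxv]
            · right
              rw [hC1, Function.update_of_ne hxv] at b3
              exact ⟨(her x b1).1, b2, b3⟩
        · rw [hf2 u h]
          obtain ⟨a1, a2, a3, a4, a5, a6⟩ := O2 u ((m2 u).2 ⟨hu, h⟩)
          refine ⟨a1, fun x k h0 hk => ?_, fun β hβ x k hk hx => ?_, fun x hx => ?_,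
            fun x => (a5 x).trans (hC2s x), a6⟩
          · obtain ⟨b1, b2⟩ := a2 x k h0 hk
            exact ⟨(her x b1).1, b2⟩
          · have := a3 β hβ x k hk hx
            omega
          · by_cases hxv : x = v
            · subst hxv
              right
              refine ⟨hvR, ⟨w, by rw [a1 w l hwl]; simp, hwv⟩, ξ l, ?_⟩
              rcases a4 x hx with b | ⟨b1, -⟩
              · rw [b, hC2, Function.update_self]
              · exact absurd rfl (her x b1).2
            · rcases a4 x hx with b | ⟨b1, b2, b3⟩
              · left; rw [b, hC2, Function.update_of_ne hxv]
              · right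
                rw [hC2, Function.update_of_ne hxv] at b3
                exact ⟨(her x b1).1, b2, b3⟩
      · set P1 := pr r (R.erase v) (fun O => Ev {x | Reach g (dom lab1) O x}) with hP1
        set P2 := pr r (R.erase v) (fun O => Ev {x | Reach g (dom lab) O x}) with hP2
        have hdom : dom lab1 = insert v (dom lab) := by
          ext x
          by_cases hx : x = v
          · subst hx; simp [dom, hlab1]
          · simp [dom, hlab1, Function.update_of_ne hx, hx]
        have e1 : pr r R (fun O => Ev {x | Reach g (dom lab) O x})
            = r v * P1 + (1 - r v) * P2 := by
          conv_lhs => rw [← Finset.insert_erase hvR, pr, ex_insert _ (Finset.notMem_erase v R)]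
          congr 2
          refine pr_congr fun O _ => ?_
          have : {x | Reach g (dom lab) (↑(insert v O)) x} = {x | Reach g (dom lab1) O x} := by
            ext x
            simp only [mem_setOf_eq, hdom, Finset.coe_insert]
            exact reach_insert (by simp [dom, hwl] : w ∈ dom lab) hwv x
          rw [this]
        have h12 : P2 ≤ P1 := pr_mono (fun x hx => hr0 x (her x hx).1)
          (fun x hx => hr1 x (her x hx).1) fun O _ hE => hEv _ _ (fun x hx =>
            Reach.mono (by rw [hdom]; exact subset_insert _ _) subset_rfl hx) hE
        have hsplit : (PM V ν).real (cyl C) = (PM V ν).real (cyl C1) + (PM V ν).real (cyl C2) := by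
          rw [← measureReal_union _ (cyl_meas _)]
          · congr 1
            ext u
            rw [mem_union, m1, m2]
            tauto
          · refine Set.disjoint_left.2 fun u h1 h2 => ?_
            exact ((m2 u).1 h2).2 ((m1 u).1 h1).2
        have hyes : r v * (PM V ν).real (cyl C) ≤ (PM V ν).real (cyl C1) :=
          (mul_le_mul_of_nonneg_right (hr v hvR _) measureReal_nonneg).trans (cyl_upd hC v q)
        have hle : (PM V ν).real (cyl C ∩ {u | ¬ Ev (dom (f u).1)}) ≤
            (1 - P1) * (PM V ν).real (cyl C1) + (1 - P2) * (PM V ν).real (cyl C2) := by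
          refine le_trans (measureReal_mono (s₂ := (cyl C1 ∩ {u | ¬ Ev (dom (f1 u).1)}) ∪
            (cyl C2 ∩ {u | ¬ Ev (dom (f2 u).1)})) ?_ (measure_ne_top _ _))
            ((measureReal_union_le _ _).trans (add_le_add B1 B2))
          rintro u ⟨h1, h2⟩
          by_cases h : u v ∈ q
          · rw [mem_setOf_eq, hf1 u h] at h2
            exact .inl ⟨(m1 u).2 ⟨h1, h⟩, h2⟩
          · rw [mem_setOf_eq, hf2 u h] at h2
            exact .inr ⟨(m2 u).2 ⟨h1, h⟩, h2⟩
        rw [e1]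
        refine hle.trans ?_
        have := mul_le_mul_of_nonneg_left hyes (sub_nonneg.2 h12)
        rw [hsplit] at this ⊢
        nlinarith

end engine

section runs

open Classical in
/-- abstract data for the exploration engine -/
structure Eng (V X Ω : Type) [DecidableEq V] [MeasurableSpace Ω] where
  g : V → V → Prop
  lt : Ω → Bool
  ν : Measure Ω
  prob : IsProbabilityMeasure ν
  Q0 : Bool → Set Ω
  Qc : Bool → ℕ → Set Ω
  Reg : X → Finset V
  col : X → ℕ
  nb : X → X → Prop
  Seed : X → Set V → Prop
  q : ℝ
  δ : ℝ
  ε : ℝ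
  N : ℕ
  Q0l : ∀ a, ∀ o ∈ Q0 a, lt o = a
  Qcl : ∀ a c, ∀ o ∈ Qc a c, lt o = a
  Q0m : ∀ a, q ≤ ν.real (Q0 a)
  Qcm : ∀ a c, c < 512 → δ ≤ ν.real (Qc a c)
  dj0 : ∀ a b c, Disjoint (Q0 a) (Qc b c)
  djc : ∀ a b c c', c ≠ c' → Disjoint (Qc a c) (Qc b c')
  colt : ∀ x, col x < 512
  coldj : ∀ x y, x ≠ y → col x = col y → ∀ v ∈ Reg x, ∀ w ∈ Reg y, w ≠ v ∧ ¬ g w v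
  regc : ∀ x, (Reg x).card ≤ N
  seedm : ∀ x A B, A ⊆ B → Seed x A → Seed x B
  hδ : 0 ≤ δ
  hδq : δ ≤ q
  hε : 0 ≤ ε
  gm : ∀ x y A, nb y x → Seed y A →
    1 - ε ≤ pr (fun v => if ∃ a ∈ A, g a v then δ else q) ((Reg x).filter (fun v => v ∉ A))
      (fun O => Seed x {v | Reach g A (O : Set V) v})

/-- exploration state -/
structure St (V X Ω : Type) where
  lab : V → Option ℕ
  C : V → Set Ω
  alive : Set X
  bad : Set X

variable {V X Ω : Type} [DecidableEq V] [Countable V] [Fintype Ω] [MeasurableSpace Ω]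
  [MeasurableSingletonClass Ω] (E : Eng V X Ω)

instance : IsProbabilityMeasure E.ν := E.prob

structure Eng.Inv (s : St V X Ω) : Prop where
  fs : FS s.C
  i1 : ∀ v, s.lab v = none → (∀ w, s.lab w ≠ none → ¬ E.g w v) → s.C v = univ
  i2 : ∀ v x, s.lab v = none → x ∉ s.alive → x ∉ s.bad → v ∈ E.Reg x →
    ∀ a, E.Qc a (E.col x) ⊆ s.C v
  i3 : ∀ x ∈ s.alive, E.Seed x (dom s.lab)
  i4 : ∀ x ∈ s.alive, x ∉ s.bad

def Eng.Elig (s : St V X Ω) (x : X) : Prop := x ∉ s.alive ∧ x ∉ s.bad ∧ ∃ y ∈ s.alive, E.nb y x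

def Eng.Near (x : X) (w : V) : Prop := w ∈ E.Reg x ∨ ∃ v ∈ E.Reg x, E.g w v

structure Eng.Tst (s : St V X Ω) (ξ : ℕ → Bool) (x : X) (s' : St V X Ω) : Prop where
  ext : ∀ v l, s.lab v = some l → s'.lab v = some l
  new : ∀ v l, s.lab v = none → s'.lab v = some l → v ∈ E.Reg x ∧ ∃ k w, l = k + 1 ∧ E.g w v ∧
    s'.lab w = some k ∧ ∀ o ∈ s'.C v, E.lt o = ξ k
  bd : ∀ β, (∀ w l, s.lab w = some l → E.Near x w → l ≤ β) →
    ∀ w l, s'.lab w = some l → E.Near x w → l ≤ β + E.N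
  sub : ∀ v, s'.C v ⊆ s.C v
  ab : (s'.alive = insert x s.alive ∧ s'.bad = s.bad) ∨
    (s'.alive = s.alive ∧ s'.bad = insert x s.bad)
  inv : E.Inv s'

theorem E2 (s : St V X Ω) (ξ : ℕ → Bool) (x : X) (hs : E.Inv s) (hx : E.Elig s x) :
    ∃ f : (V → Ω) → St V X Ω, Rslv s.C f St.C ∧ (∀ u ∈ cyl s.C, E.Tst s ξ x (f u)) ∧
      (PM V E.ν).real (cyl s.C ∩ {u | x ∈ (f u).bad}) ≤ E.ε * (PM V E.ν).real (cyl s.C) := by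
  classical
  obtain ⟨hxa, hxb, y, hy, hyx⟩ := hx
  set Q : V → Bool → Set Ω := fun v a =>
    if ∃ a ∈ dom s.lab, E.g a v then E.Qc a (E.col x) else E.Q0 a with hQ
  set r : V → ℝ := fun v => if ∃ a ∈ dom s.lab, E.g a v then E.δ else E.q with hr
  set R := (E.Reg x).filter (fun v => v ∉ dom s.lab) with hR
  have hRm : ∀ v ∈ R, v ∈ E.Reg x ∧ s.lab v = none := by
    intro v hv
    rw [hR, Finset.mem_filter] at hv
    exact ⟨hv.1, by simpa [dom] using hv.2⟩
  obtain ⟨F, hF1, hF2, hF3⟩ := E1 (ν := E.ν) E.g ξ E.lt Q (E.Near x) r (E.Seed x) (E.seedm x)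
    (by
      intro v a o ho
      simp only [hQ] at ho
      split_ifs at ho
      · exact E.Qcl _ _ o ho
      · exact E.Q0l _ o ho) R.card R s.lab s.C rfl hs.fs (fun v hv => (hRm v hv).2)
    (by
      intro v hv a
      simp only [hQ]
      split_ifs with h
      · exact hs.i2 v x (hRm v hv).2 hxa hxb (hRm v hv).1 a
      · rw [hs.i1 v (hRm v hv).2 fun w hw hg => h ⟨w, hw, hg⟩]
        exact subset_univ _)
    (by
      intro v _
      simp only [hr]
      split_ifs
      · exact E.hδ
      · exact E.hδ.trans E.hδq)
    (by
      intro v _ a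
      simp only [hr, hQ]
      split_ifs
      · exact E.Qcm _ _ (E.colt x)
      · exact E.Q0m _)
    (fun v hv w hw => .inr ⟨v, (hRm v hv).1, hw⟩)
  set h : (V → Option ℕ) × (V → Set Ω) → St V X Ω := fun o =>
    ⟨o.1, o.2, if E.Seed x (dom o.1) then insert x s.alive else s.alive,
      if E.Seed x (dom o.1) then s.bad else insert x s.bad⟩ with hh
  refine ⟨fun u => h (F u), ⟨fun u hu => hF1.mem u hu, fun u hu => hF1.sub u hu,
    fun u hu u' hu' => by simp only [hF1.fib u hu u' hu'], ?_⟩, fun u hu => ?_, ?_⟩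
  · refine (hF1.fin.image h).subset ?_
    rintro _ ⟨u, hu, rfl⟩
    exact ⟨F u, ⟨u, hu, rfl⟩, rfl⟩
  · obtain ⟨a1, a2, a3, a4, a5, a6⟩ := hF2 u hu
    have hdom : dom s.lab ⊆ dom (F u).1 := by
      intro v hv
      obtain ⟨l, hl⟩ := Option.ne_none_iff_exists'.1 hv
      simp [dom, a1 v l hl]
    refine ⟨a1, fun v l h0 h1 => ?_, fun β hβ w l hw hw' => ?_, a5, ?_, ?_⟩
    · obtain ⟨b1, b2⟩ := a2 v l h0 h1
      exact ⟨(hRm v b1).1, b2⟩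
    · refine (a3 β hβ w l hw hw').trans ?_
      have : R.card ≤ E.N := (Finset.card_filter_le _ _).trans (E.regc x)
      omega
    · by_cases hS : E.Seed x (dom (F u).1)
      · left; simp [hh, hS]
      · right; simp [hh, hS]
    · have hnone : ∀ v, (F u).1 v = none → s.lab v = none := by
        intro v hv
        by_contra hc
        exact hdom hc hv
      refine ⟨a6, fun v hv hw => ?_, fun v z hv hza hzb hz a => ?_, fun z hz => ?_, fun z hz => ?_⟩
      · rcases a4 v hv with b | ⟨-, ⟨w, b1, b2⟩, -⟩
        · change (F u).2 v = univ
          rw [b]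
          exact hs.i1 v (hnone v hv) fun w hw' => hw w (hdom hw')
        · exact absurd b2 (hw w b1)
      · have hzx : z ≠ x := by
          rintro rfl
          by_cases hS : E.Seed z (dom (F u).1) <;> simp [hh, hS] at hza hzb
        have hza' : z ∉ s.alive := by
          intro h1; apply hza; simp only [hh]; split_ifs <;> simp [h1]
        have hzb' : z ∉ s.bad := by
          intro h1; apply hzb; simp only [hh]; split_ifs <;> simp [h1]
        have hold := hs.i2 v z (hnone v hv) hza' hzb' hz a
        change _ ⊆ (F u).2 v
        rcases a4 v hv with b | ⟨b1, -, a', b3⟩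
        · rw [b]; exact hold
        · rw [b3]
          refine subset_diff.2 ⟨hold, ?_⟩
          simp only [hQ]
          split_ifs
          · refine E.djc _ _ _ _ fun hcol => ?_
            exact (E.coldj z x hzx hcol v hz v (hRm v b1).1).1 rfl
          · exact (E.dj0 _ _ _).symm
      · by_cases hS : E.Seed x (dom (F u).1)
        · simp only [hh, hS, if_true] at hz ⊢
          rcases hz with rfl | hz
          · exact hS
          · exact E.seedm _ _ _ hdom (hs.i3 z hz)
        · simp only [hh, hS, if_false] at hz ⊢
          exact E.seedm _ _ _ hdom (hs.i3 z hz)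
      · by_cases hS : E.Seed x (dom (F u).1)
        · simp only [hh, hS, if_true] at hz ⊢
          rcases hz with rfl | hz
          · exact hxb
          · exact hs.i4 z hz
        · simp only [hh, hS, if_false] at hz ⊢
          rintro (rfl | h1)
          · exact hxa hz
          · exact hs.i4 z hz h1
  · have e : cyl s.C ∩ {u | x ∈ (h (F u)).bad} = cyl s.C ∩ {u | ¬ E.Seed x (dom (F u).1)} := by
      ext u
      simp only [mem_inter_iff, mem_setOf_eq, hh, and_congr_right_iff]
      intro _
      split_ifs with hS <;> simp [hS, hxb]
    rw [e]
    refine hF3.trans (mul_le_mul_of_nonneg_right ?_ measureReal_nonneg)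
    have := E.gm x y (dom s.lab) hyx (hs.i3 y hy)
    linarith

open Classical in
noncomputable def Eng.stp (ξ : ℕ → Bool) (x : X) (s : St V X Ω) : (V → Ω) → St V X Ω :=
  if h : E.Inv s ∧ E.Elig s x then Classical.choose (E2 E s ξ x h.1 h.2) else fun _ => s

theorem Eng.stp_yes {ξ : ℕ → Bool} {x : X} {s : St V X Ω} (hs : E.Inv s) (hx : E.Elig s x) :
    Rslv s.C (E.stp ξ x s) St.C ∧ (∀ u ∈ cyl s.C, E.Tst s ξ x (E.stp ξ x s u)) ∧
      (PM V E.ν).real (cyl s.C ∩ {u | x ∈ (E.stp ξ x s u).bad})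
        ≤ E.ε * (PM V E.ν).real (cyl s.C) := by
  rw [Eng.stp, dif_pos ⟨hs, hx⟩]
  exact Classical.choose_spec (E2 E s ξ x hs hx)

theorem Eng.stp_no {ξ : ℕ → Bool} {x : X} {s : St V X Ω} (hx : ¬ E.Elig s x) (u : V → Ω) :
    E.stp ξ x s u = s := by
  rw [Eng.stp, dif_neg fun h => hx h.2]

noncomputable def Eng.run : List ((ℕ → Bool) × X) → St V X Ω → (V → Ω) → St V X Ω
  | [], s, _ => s
  | a :: L, s, u => Eng.run L (E.stp a.1 a.2 s u) u

theorem Eng.run_append (L L' : List ((ℕ → Bool) × X)) (s : St V X Ω) (u : V → Ω) :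
    E.run (L ++ L') s u = E.run L' (E.run L s u) u := by
  induction L generalizing s with
  | nil => rfl
  | cons a L ih => exact ih _

theorem Eng.stp_ok {ξ : ℕ → Bool} {x : X} {s : St V X Ω} (hs : E.Inv s) {u : V → Ω}
    (hu : u ∈ cyl s.C) : E.Inv (E.stp ξ x s u) ∧ u ∈ cyl (E.stp ξ x s u).C ∧
      s.alive ⊆ (E.stp ξ x s u).alive ∧ s.bad ⊆ (E.stp ξ x s u).bad := by
  by_cases hx : E.Elig s x
  · obtain ⟨h1, h2, -⟩ := E.stp_yes (ξ := ξ) hs hx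
    have h3 := h2 u hu
    refine ⟨h3.inv, h1.mem u hu, ?_⟩
    rcases h3.ab with ⟨a, b⟩ | ⟨a, b⟩ <;> rw [a, b] <;> simp
  · rw [E.stp_no hx]; exact ⟨hs, hu, subset_rfl, subset_rfl⟩

theorem Eng.run_ok (L : List ((ℕ → Bool) × X)) {s : St V X Ω} (hs : E.Inv s) {u : V → Ω}
    (hu : u ∈ cyl s.C) : E.Inv (E.run L s u) ∧ u ∈ cyl (E.run L s u).C ∧
      s.alive ⊆ (E.run L s u).alive ∧ s.bad ⊆ (E.run L s u).bad := by
  induction L generalizing s with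
  | nil => exact ⟨hs, hu, subset_rfl, subset_rfl⟩
  | cons a L ih =>
    obtain ⟨h1, h2, h3, h4⟩ := E.stp_ok (ξ := a.1) (x := a.2) hs hu
    obtain ⟨k1, k2, k3, k4⟩ := ih h1 h2
    exact ⟨k1, k2, h3.trans k3, h4.trans k4⟩

theorem Eng.run_hit (L : List ((ℕ → Bool) × X)) {s : St V X Ω} (hs : E.Inv s) {u : V → Ω}
    (hu : u ∈ cyl s.C) {x y : X} (hx : x ∈ s.alive) (hxy : E.nb x y) {ξ : ℕ → Bool}
    (hL : (ξ, y) ∈ L) : y ∈ (E.run L s u).alive ∨ y ∈ (E.run L s u).bad := by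
  induction L generalizing s with
  | nil => simp at hL
  | cons a L ih =>
    obtain ⟨h1, h2, h3, h4⟩ := E.stp_ok (ξ := a.1) (x := a.2) hs hu
    rcases List.mem_cons.1 hL with rfl | hL
    · have : y ∈ (E.stp ξ y s u).alive ∨ y ∈ (E.stp ξ y s u).bad := by
        by_cases he : E.Elig s y
        · obtain ⟨-, k2, -⟩ := E.stp_yes (ξ := ξ) hs he
          rcases (k2 u hu).ab with ⟨a, b⟩ | ⟨a, b⟩ <;> rw [a, b] <;> simp
        · rw [E.stp_no he]
          by_contra hc
          push Not at hc
          exact he ⟨hc.1, hc.2, x, hx, hxy⟩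
      obtain ⟨-, -, k3, k4⟩ := E.run_ok L h1 h2
      exact this.imp (fun h => k3 h) (fun h => k4 h)
    · exact ih h1 h2 (h3 hx) hL

open Classical in
theorem Eng.run_bad (L : List ((ℕ → Bool) × X)) {s : St V X Ω} (hs : E.Inv s) (B : Finset X)
    (hB : ∀ x ∈ B, x ∉ s.alive) :
    (PM V E.ν).real (cyl s.C ∩ {u | ∀ x ∈ B, x ∈ (E.run L s u).bad})
      ≤ E.ε ^ (B.filter (fun x => x ∉ s.bad)).card * (PM V E.ν).real (cyl s.C) := by
  induction L generalizing s with
  | nil =>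
    by_cases h : ∀ x ∈ B, x ∈ s.bad
    · rw [Finset.filter_false_of_mem (by simpa using h)]
      simpa using measureReal_mono inter_subset_left
    · have : cyl s.C ∩ {u | ∀ x ∈ B, x ∈ (E.run [] s u).bad} = ∅ := by
        ext u; simp only [Eng.run, mem_inter_iff, mem_setOf_eq, h, and_false]; simp
      rw [this, measureReal_empty]
      exact mul_nonneg (pow_nonneg E.hε _) measureReal_nonneg
  | cons a L ih =>
    obtain ⟨ξ, x⟩ := a
    by_cases hx : E.Elig s x
    swap
    · have := ih hs hB
      simpa only [Eng.run, E.stp_no hx] using this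
    obtain ⟨h1, h2, h3⟩ := E.stp_yes (ξ := ξ) hs hx
    by_cases hxB : x ∈ B
    · refine le_trans (measureReal_mono (s₂ := cyl s.C ∩ {u | x ∈ (E.stp ξ x s u).bad ∧
        u ∈ {u' | ∀ y ∈ B, y ∈ (E.run L (E.stp ξ x s u) u').bad}}) ?_ (measure_ne_top _ _)) ?_
      · rintro u ⟨hu, hu'⟩
        refine ⟨hu, ?_, hu'⟩
        by_contra hc
        have hT := h2 u hu
        have hal : x ∈ (E.stp ξ x s u).alive := by
          rcases hT.ab with ⟨a, b⟩ | ⟨a, b⟩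
          · rw [a]; simp
          · rw [b] at hc; simp at hc
        obtain ⟨k1, k2, k3, k4⟩ := E.run_ok L hT.inv (h1.mem u hu)
        exact k1.i4 x (k3 hal) (hu' x hxB)
      · have hcard : (B.filter (fun x => x ∉ s.bad)).card
            = (B.filter (fun y => y ∉ insert x s.bad)).card + 1 := by
          have : B.filter (fun y => y ∉ insert x s.bad)
              = (B.filter (fun x => x ∉ s.bad)).erase x := by
            ext y; simp [Finset.mem_erase]; tauto
          rw [this, Finset.card_erase_add_one]
          exact Finset.mem_filter.2 ⟨hxB, hx.2.1⟩
        refine (h1.le (fun s' => x ∈ s'.bad) (fun s' => {u' | ∀ y ∈ B, y ∈ (E.run L s' u').bad})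
          (E.ε ^ (B.filter (fun y => y ∉ insert x s.bad)).card) ?_).trans ?_
        · intro u hu hP
          have hT := h2 u hu
          have hab : (E.stp ξ x s u).alive = s.alive ∧ (E.stp ξ x s u).bad = insert x s.bad := by
            rcases hT.ab with ⟨a, b⟩ | h
            · rw [b] at hP; exact absurd hP hx.2.1
            · exact h
          have := ih hT.inv (by rw [hab.1]; exact hB)
          rw [hab.2] at this
          convert this
        · rw [hcard, pow_succ, mul_assoc]
          exact mul_le_mul_of_nonneg_left h3 (pow_nonneg E.hε _)
    · have := h1.le (ν := E.ν) (fun _ => True)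
        (fun s' => {u' | ∀ y ∈ B, y ∈ (E.run L s' u').bad})
        (E.ε ^ (B.filter (fun y => y ∉ s.bad)).card) (fun u hu _ => ?_)
      · simpa [Eng.run] using this
      · have hT := h2 u hu
        have := ih hT.inv (by
          intro z hz
          rcases hT.ab with ⟨a, b⟩ | ⟨a, b⟩ <;> rw [a]
          · rintro (rfl | h)
            · exact hxB hz
            · exact hB z hz h
          · exact hB z hz)
        have e : B.filter (fun y => y ∉ (E.stp ξ x s u).bad) = B.filter (fun y => y ∉ s.bad) := by
          refine Finset.filter_congr fun z hz => ?_
          rcases hT.ab with ⟨a, b⟩ | ⟨a, b⟩ <;> rw [b]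
          have : z ≠ x := by rintro rfl; exact hxB hz
          simp [this]
        rwa [e] at this

end runs

section rounds

variable {V X Ω : Type} [DecidableEq V] [Countable V] [Fintype Ω] [MeasurableSpace Ω]
  [MeasurableSingletonClass Ω] (E : Eng V X Ω)

def trunc (n : ℕ) (ξ : ℕ → Bool) : ℕ → Bool := fun i => if i < n then ξ i else false

noncomputable def Eng.rnd (Win : Finset X) (ξ : ℕ → Bool) (ρ : ℕ) : List ((ℕ → Bool) × X) :=
  (Win.filter (fun x => E.col x = ρ % 512)).toList.map (fun x => (trunc (E.N * (ρ + 1)) ξ, x))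

noncomputable def Eng.all (Win : Finset X) (ξ : ℕ → Bool) : ℕ → List ((ℕ → Bool) × X)
  | 0 => []
  | ρ + 1 => Eng.all Win ξ ρ ++ E.rnd Win ξ ρ

/-- initial states -/
structure Eng.Ini (s : St V X Ω) : Prop where
  inv : E.Inv s
  c : ∀ v, s.C v = univ
  b : s.bad = ∅
  l : ∀ v k, s.lab v = some k → k = 0

noncomputable def Eng.st (Win : Finset X) (s : St V X Ω) (ξ : ℕ → Bool) (ρ : ℕ) (u : V → Ω) :
    St V X Ω := E.run (E.all Win ξ ρ) s u

variable {E} {Win : Finset X} {s : St V X Ω}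

theorem Eng.Ini.cyl (hs : E.Ini s) (u : V → Ω) : u ∈ cyl s.C := fun v => by rw [hs.c]; trivial

theorem st_prefix (hs : E.Ini s) {ξ ξ' : ℕ → Bool} {ρ : ℕ} (h : ∀ i < E.N * ρ, ξ i = ξ' i) :
    E.st Win s ξ ρ = E.st Win s ξ' ρ := by
  have : E.all Win ξ ρ = E.all Win ξ' ρ := by
    induction ρ with
    | zero => rfl
    | succ ρ ih =>
      have e : trunc (E.N * (ρ + 1)) ξ = trunc (E.N * (ρ + 1)) ξ' := by
        funext i
        simp only [trunc]
        split_ifs with hi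
        · exact h i hi
        · rfl
      rw [Eng.all, Eng.all, ih fun i hi => h i (hi.trans_le (Nat.mul_le_mul_left _ (by omega))),
        Eng.rnd, Eng.rnd, e]
  funext u
  rw [Eng.st, this]; rfl

theorem st_ok (hs : E.Ini s) (ξ : ℕ → Bool) (ρ : ℕ) (u : V → Ω) :
    E.Inv (E.st Win s ξ ρ u) ∧ u ∈ PercWords.cyl (E.st Win s ξ ρ u).C :=
  ⟨(E.run_ok _ hs.inv (hs.cyl u)).1, (E.run_ok _ hs.inv (hs.cyl u)).2.1⟩

theorem st_succ (hs : E.Ini s) (ξ : ℕ → Bool) (ρ : ℕ) (u : V → Ω) :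
    E.st Win s ξ (ρ + 1) u = E.run (E.rnd Win ξ ρ) (E.st Win s ξ ρ u) u := by
  rw [Eng.st, Eng.all, E.run_append]; rfl

theorem st_mono (hs : E.Ini s) (ξ : ℕ → Bool) {ρ ρ' : ℕ} (h : ρ ≤ ρ') (u : V → Ω) :
    (E.st Win s ξ ρ u).alive ⊆ (E.st Win s ξ ρ' u).alive ∧
    (E.st Win s ξ ρ u).bad ⊆ (E.st Win s ξ ρ' u).bad := by
  induction ρ', h using Nat.le_induction with
  | base => exact ⟨subset_rfl, subset_rfl⟩
  | succ n _ ih =>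
    have := E.run_ok (E.rnd Win ξ n) (st_ok (Win := Win) hs ξ n u).1 (st_ok hs ξ n u).2
    rw [← st_succ hs] at this
    exact ⟨ih.1.trans this.2.2.1, ih.2.trans this.2.2.2⟩

theorem st_hit (hs : E.Ini s) (ξ : ℕ → Bool) (ρ : ℕ) (u : V → Ω) {x y : X}
    (hx : x ∈ (E.st Win s ξ ρ u).alive) (hxy : E.nb x y) (hy : y ∈ Win) :
    y ∈ (E.st Win s ξ (ρ + 512) u).alive ∨ y ∈ (E.st Win s ξ (ρ + 512) u).bad := by
  obtain ⟨ρ', h1, h2, h3⟩ : ∃ ρ', ρ ≤ ρ' ∧ ρ' + 1 ≤ ρ + 512 ∧ ρ' % 512 = E.col y := by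
    have := E.colt y
    refine ⟨ρ + (E.col y + 512 - ρ % 512) % 512, ?_, ?_, ?_⟩ <;> omega
  have := E.run_hit (E.rnd Win ξ ρ') (st_ok (Win := Win) hs ξ ρ' u).1 (st_ok hs ξ ρ' u).2
    ((st_mono hs ξ h1 u).1 hx) hxy (ξ := trunc (E.N * (ρ' + 1)) ξ)
    (by
      rw [Eng.rnd, List.mem_map]
      exact ⟨y, by simp [hy, h3], rfl⟩)
  rw [← st_succ hs] at this
  have hm := st_mono (Win := Win) hs ξ h2 u
  exact this.imp (@hm.1 y) (@hm.2 y)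

theorem st_bad (hs : E.Ini s) (ξ : ℕ → Bool) (ρ : ℕ) (B : Finset X) :
    (PM V E.ν).real {u | ∀ x ∈ B, x ∈ (E.st Win s ξ ρ u).bad} ≤ E.ε ^ B.card := by
  classical
  have hc : PercWords.cyl s.C = univ := eq_univ_of_forall fun u => hs.cyl u
  by_cases hB : ∀ x ∈ B, x ∉ s.alive
  · have := E.run_bad (E.all Win ξ ρ) hs.inv B hB
    rw [hc, hs.b] at this
    simpa [Eng.st] using this
  · push Not at hB
    obtain ⟨x, hx, hxa⟩ := hB
    have : {u | ∀ x ∈ B, x ∈ (E.st Win s ξ ρ u).bad} = ∅ := by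
      refine eq_empty_of_forall_notMem fun u hu => ?_
      exact (st_ok (Win := Win) hs ξ ρ u).1.i4 x
        ((E.run_ok _ hs.inv (hs.cyl u)).2.2.1 hxa) (hu x hx)
    rw [this, measureReal_empty]
    exact pow_nonneg E.hε _

/-- label soundness -/
structure Snd (E : Eng V X Ω) (Win : Finset X) (s0 : St V X Ω) (ξ : ℕ → Bool) (s : St V X Ω) :
    Prop where
  a : ∀ v l, s.lab v = some (l + 1) → (∃ x ∈ Win, v ∈ E.Reg x) ∧ s0.lab v = none ∧
    ∃ w, E.g w v ∧ s.lab w = some l ∧ ∀ o ∈ s.C v, E.lt o = ξ l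
  b : ∀ v, s.lab v = some 0 → s0.lab v = some 0

theorem snd_round {s0 : St V X Ω} {ξ ξ' : ℕ → Bool} {β c : ℕ} (hξ : ∀ i < β + E.N, ξ' i = ξ i)
    (u : V → Ω) (xs : List X) (hnd : xs.Nodup) (hc : ∀ x ∈ xs, E.col x = c) (hW : ∀ x ∈ xs, x ∈ Win)
    (D : Set X) (hD : ∀ y ∈ D, E.col y = c ∧ y ∉ xs) (s : St V X Ω) (hs : E.Inv s)
    (hu : u ∈ PercWords.cyl s.C) (hS : Snd E Win s0 ξ s)
    (h0 : ∀ v, s0.lab v ≠ none → s.lab v ≠ none)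
    (hb : ∀ v l, s.lab v = some l → l ≤ β ∨ (l ≤ β + E.N ∧ ∃ y ∈ D, v ∈ E.Reg y)) :
    Snd E Win s0 ξ (E.run (xs.map fun x => (ξ', x)) s u) ∧
    (∀ v, s0.lab v ≠ none → (E.run (xs.map fun x => (ξ', x)) s u).lab v ≠ none) ∧
    ∀ v l, (E.run (xs.map fun x => (ξ', x)) s u).lab v = some l → l ≤ β + E.N := by
  induction xs generalizing s D with
  | nil =>
    refine ⟨hS, h0, fun v l h => ?_⟩
    rcases hb v l h with h | h
    · omega
    · exact h.1
  | cons x xs ih =>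
    rw [List.nodup_cons] at hnd
    by_cases hx : E.Elig s x
    · obtain ⟨h1, h2, -⟩ := E.stp_yes (ξ := ξ') hs hx
      have hT := h2 u hu
      have hnear : ∀ w l, s.lab w = some l → E.Near x w → l ≤ β := by
        intro w l hw hn
        rcases hb w l hw with h | ⟨-, y, hy, hwy⟩
        · exact h
        · exfalso
          have hyx : x ≠ y := by rintro rfl; exact (hD x hy).2 (by simp)
          have hcc : E.col x = E.col y := (hc x (by simp)).trans (hD y hy).1.symm
          rcases hn with hn | ⟨v, hv, hwv⟩
          · exact (E.coldj x y hyx hcc w hn w hwy).1 rfl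
          · exact (E.coldj x y hyx hcc v hv w hwy).2 hwv
      have hbd := hT.bd β hnear
      have hold : ∀ w l, (E.stp ξ' x s u).lab w = some l → s.lab w ≠ none → s.lab w = some l := by
        intro w l hw hn
        obtain ⟨k, hk⟩ := Option.ne_none_iff_exists'.1 hn
        have := hT.ext w k hk
        rw [hw] at this
        rw [hk, this]
      have hz : ∀ v, s0.lab v ≠ none → (E.stp ξ' x s u).lab v ≠ none := by
        intro v hv
        obtain ⟨k, hk⟩ := Option.ne_none_iff_exists'.1 (h0 v hv)
        rw [hT.ext v k hk]; simp
      refine ih hnd.2 (fun y hy => hc y (by simp [hy])) (fun y hy => hW y (by simp [hy]))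
        (insert x D) ?_ (E.stp ξ' x s u) hT.inv (h1.mem u hu) ⟨?_, ?_⟩ hz ?_
      · rintro y (rfl | hy)
        · exact ⟨hc y (by simp), hnd.1⟩
        · exact ⟨(hD y hy).1, fun h => (hD y hy).2 (by simp [h])⟩
      · intro v l hv
        by_cases hn : s.lab v = none
        · obtain ⟨a1, k, w, a2, a3, a4, a5⟩ := hT.new v (l + 1) hn hv
          have hkl : l = k := by omega
          subst hkl
          refine ⟨⟨x, hW x (by simp), a1⟩, ?_, w, a3, a4, fun o ho => ?_⟩
          · by_contra hc; exact h0 v hc hn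
          · rw [a5 o ho]
            have := hbd v (l + 1) hv (.inl a1)
            exact hξ l (by omega)
        · obtain ⟨a1, a2, w, a3, a4, a5⟩ := hS.a v l (hold v _ hv hn)
          exact ⟨a1, a2, w, a3, hT.ext _ _ a4, fun o ho => a5 o (hT.sub v ho)⟩
      · intro v hv
        by_cases hn : s.lab v = none
        · obtain ⟨a1, k, w, a2, -⟩ := hT.new v 0 hn hv
          omega
        · exact hS.b v (hold v _ hv hn)
      · intro v l hv
        by_cases hn : s.lab v = none
        · have a1 := (hT.new v l hn hv).1
          exact .inr ⟨hbd v l hv (.inl a1), x, by simp, a1⟩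
        · rcases hb v l (hold v _ hv hn) with h | ⟨h, y, hy, h'⟩
          · exact .inl h
          · exact .inr ⟨h, y, by simp [hy], h'⟩
    · rw [List.map_cons, Eng.run, E.stp_no hx]
      exact ih hnd.2 (fun y hy => hc y (by simp [hy])) (fun y hy => hW y (by simp [hy])) D
        (fun y hy => ⟨(hD y hy).1, fun h => (hD y hy).2 (by simp [h])⟩) s hs hu hS h0 hb

theorem st_snd (hs : E.Ini s) (ξ : ℕ → Bool) (ρ : ℕ) (u : V → Ω) :
    Snd E Win s ξ (E.st Win s ξ ρ u) ∧
    (∀ v, s.lab v ≠ none → (E.st Win s ξ ρ u).lab v ≠ none) ∧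
    ∀ v l, (E.st Win s ξ ρ u).lab v = some l → l ≤ E.N * ρ := by
  induction ρ with
  | zero =>
    refine ⟨⟨fun v l h => ?_, fun v h => h⟩, fun v h => h, fun v l h => ?_⟩
    · have := hs.l v _ h; omega
    · have := hs.l v _ h; omega
  | succ ρ ih =>
    rw [st_succ hs]
    have := snd_round (E := E) (Win := Win) (ξ := ξ) (ξ' := trunc (E.N * (ρ + 1)) ξ)
      (β := E.N * ρ) (c := ρ % 512) (by
        intro i hi
        have : i < E.N * (ρ + 1) := by rw [Nat.mul_succ]; exact hi
        simp [trunc, this]) u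
      (Win.filter (fun x => E.col x = ρ % 512)).toList (Finset.nodup_toList _)
      (by simp) (by simp +contextual) ∅ (by simp) (E.st Win s ξ ρ u) (st_ok hs ξ ρ u).1
      (st_ok hs ξ ρ u).2 ih.1 ih.2.1 (fun v l h => .inl (ih.2.2 v l h))
    refine ⟨this.1, this.2.1, fun v l h => ?_⟩
    rw [Nat.mul_succ]
    exact this.2.2 v l h

end rounds

section sheets

def disp : Fin 6 → ℤ × ℤ := ![(1, -1), (-1, -1), (0, 1), (0, 1), (0, 1), (0, 1)]
def offs : Fin 6 → ℤ := ![0, 0, 0, -1, 0, 1]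

def posn (t0 : ℤ) (c : ℕ → Fin 6) (i : ℕ) : ℤ × ℤ := (t0, 0) + ∑ k ∈ Finset.range i, disp (c k)

abbrev Code := Σ N : ℕ, ℤ × (Fin N → Fin 6)

def Code.fn (k : Code) : ℕ → Fin 6 := fun i => if h : i < k.1 then k.2.2 ⟨i, h⟩ else 0

/-- bad sites of a code -/
def cB (k : Code) : Finset (ℤ × ℤ) :=
  ((Finset.range k.1).filter (fun i => 3 ≤ k.fn i)).image
    (fun i => posn k.2.1 k.fn i + (0, offs (k.fn i)))

noncomputable def Cod (T g : ℕ) : Finset Code :=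
  ((Finset.Icc g ((T + 1) * (g + 1))).sigma
    (fun N => (Finset.Icc (0 : ℤ) T) ×ˢ (Finset.univ : Finset (Fin N → Fin 6)))).filter
    (fun k => k.1 ≤ 192 * (cB k).card)

variable (T g : ℕ) (bad : Set (ℤ × ℤ)) (S Y : Finset ℤ)

def Clo (a : ℤ × ℤ) : Prop := (a.1 = 0 ∧ a.2 ∉ S) ∨ (a.1 = T ∧ a.2 ∉ Y) ∨
  ∃ o : ℤ, (o = -1 ∨ o = 0 ∨ o = 1) ∧ a + (0, o) ∈ bad

/-- elementary step, with its code -/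
def Stp (a : ℤ × ℤ) (c : Fin 6) (b : ℤ × ℤ) : Prop :=
  b = a + disp c ∧ 0 ≤ b.1 ∧ b.1 ≤ T ∧ 0 ≤ b.2 ∧ b.2 ≤ g ∧
    (c = 2 → (a.1 = 0 ∧ a.2 ∉ S) ∨ (a.1 = T ∧ a.2 ∉ Y)) ∧ (3 ≤ c → a + (0, offs c) ∈ bad)

def Wlk (n : ℕ) (p : ℕ → ℤ × ℤ) (c : ℕ → Fin 6) : Prop :=
  (p 0).2 = 0 ∧ 0 ≤ (p 0).1 ∧ (p 0).1 ≤ T ∧ ∀ i < n, Stp T g bad S Y (p i) (c i) (p (i + 1))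

variable {T g bad S Y}

theorem Wlk.snoc {n : ℕ} {p : ℕ → ℤ × ℤ} {c : ℕ → Fin 6} (h : Wlk T g bad S Y n p c)
    {k : Fin 6} {b : ℤ × ℤ} (hb : Stp T g bad S Y (p n) k b) :
    ∃ p' c', Wlk T g bad S Y (n + 1) p' c' ∧ p' (n + 1) = b := by
  refine ⟨Function.update p (n + 1) b, Function.update c n k, ⟨?_, ?_, ?_, fun i hi => ?_⟩, by simp⟩
  · simpa using h.1
  · simpa using h.2.1
  · simpa using h.2.2.1
  · rcases Nat.lt_succ_iff_lt_or_eq.1 hi with hi | rfl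
    · rw [Function.update_of_ne (by omega), Function.update_of_ne (by omega),
        Function.update_of_ne (by omega)]
      exact h.2.2.2 i hi
    · rw [Function.update_of_ne (by omega)]
      simpa using hb

theorem Wlk.cut {n : ℕ} {p : ℕ → ℤ × ℤ} {c : ℕ → Fin 6} (h : Wlk T g bad S Y n p c) {i j : ℕ}
    (hij : i < j) (hj : j ≤ n) (e : p i = p j) :
    ∃ p' c', Wlk T g bad S Y (n - (j - i)) p' c' ∧ p' (n - (j - i)) = p n := by
  refine ⟨fun k => if k ≤ i then p k else p (k + (j - i)),
    fun k => if k < i then c k else c (k + (j - i)), ⟨?_, ?_, ?_, fun k hk => ?_⟩, ?_⟩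
  · simpa using h.1
  · simpa using h.2.1
  · simpa using h.2.2.1
  · rcases lt_trichotomy k i with h1 | h1 | h1
    · simp only [h1, h1.le, if_true, Nat.succ_le_of_lt h1]
      exact h.2.2.2 k (by omega)
    · subst h1
      have := h.2.2.2 j (by omega)
      simp only [le_refl, if_true, lt_irrefl, if_false, Nat.not_succ_le_self, e]
      rw [show k + (j - k) = j by omega, show k + 1 + (j - k) = j + 1 by omega]
      exact this
    · simp only [show ¬ k ≤ i by omega, show ¬ k < i by omega, show ¬ k + 1 ≤ i by omega, if_false]
      rw [show k + 1 + (j - i) = k + (j - i) + 1 by omega]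
      exact h.2.2.2 _ (by omega)
  · beta_reduce
    by_cases h1 : n - (j - i) ≤ i
    · rw [if_pos h1, show n - (j - i) = i by omega, e, show j = n by omega]
    · rw [if_neg h1, show n - (j - i) + (j - i) = n by omega]

theorem Wlk.box {n : ℕ} {p : ℕ → ℤ × ℤ} {c : ℕ → Fin 6} (h : Wlk T g bad S Y n p c) {i : ℕ}
    (hi : i ≤ n) : 0 ≤ (p i).1 ∧ (p i).1 ≤ T ∧ 0 ≤ (p i).2 ∧ (p i).2 ≤ g := by
  cases i with
  | zero => exact ⟨h.2.1, h.2.2.1, h.1.ge, by rw [h.1]; positivity⟩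
  | succ i =>
    obtain ⟨-, a, b, c, d, -⟩ := h.2.2.2 i (by omega)
    exact ⟨a, b, c, d⟩

theorem sheet_pos (h : ¬ ∃ n p c, Wlk T g bad S Y n p c ∧ (p n).2 = g) (hg : 1 ≤ g) :
    ∃ F : ℤ → ℤ, F 0 ∈ S ∧ F T ∈ Y ∧ (∀ t : ℤ, 0 ≤ t → t ≤ T → 0 ≤ F t ∧ F t < g ∧
      ∀ o : ℤ, (o = -1 ∨ o = 0 ∨ o = 1) → (t, F t + o) ∉ bad) ∧
      ∀ t : ℤ, 0 ≤ t → t < T → |F (t + 1) - F t| ≤ 1 := by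
  have hmax : ∀ t : ℤ, ∃ y : ℤ, 0 ≤ t → t ≤ T → (∃ n p c, Wlk T g bad S Y n p c ∧ p n = (t, y)) ∧
      ∀ z, (∃ n p c, Wlk T g bad S Y n p c ∧ p n = (t, z)) → z ≤ y := by
    intro t
    by_cases ht : 0 ≤ t ∧ t ≤ T
    · obtain ⟨y, h1, h2⟩ := Int.exists_greatest_of_bdd
        (P := fun z => ∃ n p c, Wlk T g bad S Y n p c ∧ p n = (t, z))
        ⟨g, fun z ⟨n, p, c, hw, hp⟩ => by have := (hw.box le_rfl).2.2.2; rw [hp] at this; exact this⟩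
        ⟨0, 0, fun _ => (t, 0), fun _ => 0, ⟨rfl, ht.1, ht.2, by simp⟩, rfl⟩
      exact ⟨y, fun _ _ => ⟨h1, h2⟩⟩
    · exact ⟨0, fun h1 h2 => absurd ⟨h1, h2⟩ ht⟩
  choose F hF using hmax
  have hF0 : ∀ t : ℤ, 0 ≤ t → t ≤ T → 0 ≤ F t := fun t h1 h2 => (hF t h1 h2).2 0
    ⟨0, fun _ => (t, 0), fun _ => 0, ⟨rfl, h1, h2, by simp⟩, rfl⟩
  have hFg : ∀ t : ℤ, 0 ≤ t → t ≤ T → F t < g := by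
    intro t h1 h2
    obtain ⟨n, p, c, hw, hp⟩ := (hF t h1 h2).1
    refine lt_of_le_of_ne (by have := (hw.box le_rfl).2.2.2; rw [hp] at this; exact this) ?_
    intro e
    exact h ⟨n, p, c, hw, by rw [hp, ← e]⟩
  have hnc : ∀ t : ℤ, 0 ≤ t → t ≤ T → ¬ Clo T bad S Y (t, F t) := by
    intro t h1 h2 hc
    obtain ⟨n, p, c, hw, hp⟩ := (hF t h1 h2).1
    have key : ∃ k : Fin 6, Stp T g bad S Y (p n) k (t, F t + 1) := by
      have hb : 0 ≤ t ∧ t ≤ T ∧ 0 ≤ F t + 1 ∧ F t + 1 ≤ g :=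
        ⟨h1, h2, by linarith [hF0 t h1 h2], by linarith [hFg t h1 h2]⟩
      rw [hp]
      rcases hc with hc | hc | ⟨o, rfl | rfl | rfl, hc⟩
      · exact ⟨2, by simp [disp], hb.1, hb.2.1, hb.2.2.1, hb.2.2.2, fun _ => .inl hc, fun h => absurd h (by decide)⟩
      · exact ⟨2, by simp [disp], hb.1, hb.2.1, hb.2.2.1, hb.2.2.2, fun _ => .inr hc, fun h => absurd h (by decide)⟩
      · exact ⟨3, by simp [disp], hb.1, hb.2.1, hb.2.2.1, hb.2.2.2, fun h => absurd h (by decide),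
          fun _ => by simpa [offs] using hc⟩
      · exact ⟨4, by simp [disp], hb.1, hb.2.1, hb.2.2.1, hb.2.2.2, fun h => absurd h (by decide),
          fun _ => by simpa [offs] using hc⟩
      · exact ⟨5, by simp [disp], hb.1, hb.2.1, hb.2.2.1, hb.2.2.2, fun h => absurd h (by decide),
          fun _ => by simpa [offs] using hc⟩
    obtain ⟨k, hk⟩ := key
    obtain ⟨p', c', hw', hp'⟩ := hw.snoc hk
    have := (hF t h1 h2).2 _ ⟨_, p', c', hw', hp'⟩
    linarith
  have hdn : ∀ t t' : ℤ, 0 ≤ t → t ≤ T → 0 ≤ t' → t' ≤ T → (t' = t + 1 ∨ t' = t - 1) →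
      F t - 1 ≤ F t' := by
    intro t t' h1 h2 h3 h4 h5
    by_cases hz : F t = 0
    · linarith [hF0 t' h3 h4]
    obtain ⟨n, p, c, hw, hp⟩ := (hF t h1 h2).1
    have hpos : 0 ≤ F t - 1 := by have := hF0 t h1 h2; omega
    have hgg := hFg t h1 h2
    have key : ∃ k : Fin 6, Stp T g bad S Y (p n) k (t', F t - 1) := by
      rw [hp]
      rcases h5 with rfl | rfl
      · exact ⟨0, by simp [disp]; ring, h3, h4, hpos, by simp only; omega, fun h => absurd h (by decide), fun h => absurd h (by decide)⟩
      · exact ⟨1, by simp [disp]; constructor <;> ring, h3, h4, hpos, by simp only; omega,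
          fun h => absurd h (by decide), fun h => absurd h (by decide)⟩
    obtain ⟨k, hk⟩ := key
    obtain ⟨p', c', hw', hp'⟩ := hw.snoc hk
    exact (hF t' h3 h4).2 _ ⟨_, p', c', hw', hp'⟩
  have hT0 : (0 : ℤ) ≤ T := by positivity
  refine ⟨F, ?_, ?_, fun t h1 h2 => ⟨hF0 t h1 h2, hFg t h1 h2, fun o ho hb => ?_⟩, fun t h1 h2 => ?_⟩
  · by_contra hc
    exact hnc 0 le_rfl hT0 (.inl ⟨rfl, hc⟩)
  · by_contra hc
    exact hnc T hT0 le_rfl (.inr (.inl ⟨rfl, hc⟩))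
  · exact hnc t h1 h2 (.inr (.inr ⟨o, ho, by simpa using hb⟩))
  · have a := hdn t (t + 1) h1 h2.le (by omega) (by omega) (.inl rfl)
    have b := hdn (t + 1) t (by omega) (by omega) h1 h2.le (.inr (by ring))
    rw [abs_le]; constructor <;> linarith

theorem Wlk.posn {n : ℕ} {p : ℕ → ℤ × ℤ} {c c' : ℕ → Fin 6} (h : Wlk T g bad S Y n p c)
    (hc : ∀ i < n, c' i = c i) {i : ℕ} (hi : i ≤ n) : PercWords.posn (p 0).1 c' i = p i := by
  induction i with
  | zero => simp [PercWords.posn, Prod.ext_iff, h.1]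
  | succ i ih =>
    have := ih (by omega)
    unfold PercWords.posn at *
    rw [Finset.sum_range_succ, ← add_assoc, this, hc i (by omega)]
    exact (h.2.2.2 i (by omega)).1.symm

theorem disp1 (c : Fin 6) : |(disp c).1| ≤ if c < 2 then 1 else 0 := by
  fin_cases c <;> simp [disp] <;> decide
theorem disp2 (c : Fin 6) : (disp c).2 = if c < 2 then -1 else 1 := by
  fin_cases c <;> simp [disp] <;> decide

theorem Wlk.ht {n : ℕ} {p : ℕ → ℤ × ℤ} {c : ℕ → Fin 6} (h : Wlk T g bad S Y n p c) {i : ℕ}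
    (hi : i ≤ n) : (p i).2 + 2 * (((Finset.range i).filter (fun j => c j < 2)).card : ℤ) = i := by
  induction i with
  | zero => simp [h.1]
  | succ i ih =>
    have := ih (by omega)
    rw [(h.2.2.2 i (by omega)).1, Prod.snd_add, disp2, Finset.range_add_one, Finset.filter_insert]
    split_ifs with h1
    · rw [Finset.card_insert_of_notMem (by simp)]; push_cast; linarith
    · push_cast; linarith

theorem Wlk.hz {n : ℕ} {p : ℕ → ℤ × ℤ} {c : ℕ → Fin 6} (h : Wlk T g bad S Y n p c) {i j : ℕ}
    (hij : i ≤ j) (hi : j ≤ n) :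
    |(p j).1 - (p i).1| ≤ (((Finset.range j).filter (fun j => c j < 2)).card : ℤ) := by
  induction j, hij using Nat.le_induction with
  | base => simp
  | succ j hj ih =>
    have := ih (by omega)
    have h2 := disp1 (c j)
    rw [(h.2.2.2 j (by omega)).1, Prod.fst_add, Finset.range_add_one, Finset.filter_insert]
    have h3 : |(p j).1 + (disp (c j)).1 - (p i).1| ≤ |(p j).1 - (p i).1| + |(disp (c j)).1| := by
      rw [show (p j).1 + (disp (c j)).1 - (p i).1 = ((p j).1 - (p i).1) + (disp (c j)).1 by ring]
      exact abs_add_le _ _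
    split_ifs with h1
    · rw [Finset.card_insert_of_notMem (by simp)]
      rw [if_pos h1] at h2
      push_cast; linarith
    · rw [if_neg h1] at h2; linarith

theorem sheet_neg (h : ∃ n p c, Wlk T g bad S Y n p c ∧ (p n).2 = g) (hg : 1 ≤ g) (hT : 2 * g ≤ T)
    (hS : S ⊆ Finset.Ico 0 (g : ℤ)) (hY : Y ⊆ Finset.Ico 0 (g : ℤ)) (cS : g ≤ 32 * S.card)
    (cY : g ≤ 32 * Y.card) : ∃ k ∈ Cod T g, ∀ b ∈ cB k, b ∈ bad := by
  classical
  set n := Nat.find h with hn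
  obtain ⟨p, c, hw, hp⟩ := Nat.find_spec h
  rw [← hn] at hw hp
  have inj : ∀ i ≤ n, ∀ j ≤ n, p i = p j → i = j := by
    have : ∀ i j, i < j → j ≤ n → p i ≠ p j := by
      intro i j hij hj e
      obtain ⟨p', c', h1, h2⟩ := hw.cut hij hj e
      exact Nat.find_min h (m := n - (j - i)) (by omega) ⟨p', c', h1, by rw [h2, hp]⟩
    intro i hi j hj e
    rcases lt_trichotomy i j with h1 | h1 | h1
    · exact absurd e (this i j h1 hj)
    · exact h1
    · exact absurd e.symm (this j i h1 hi)
  have hup : ∀ i < n, ¬ c i < 2 → (p i).2 ∈ Finset.Ico (0 : ℤ) g := by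
    intro i hi hc
    have a := (hw.box (i := i) (by omega)).2.2.1
    obtain ⟨e, -, -, -, b, -⟩ := hw.2.2.2 i hi
    rw [e, Prod.snd_add, disp2, if_neg hc] at b
    rw [Finset.mem_Ico]; omega
  set D := (Finset.range n).filter (fun j => c j < 2) with hD
  set F0 := (Finset.range n).filter (fun j => c j = 2 ∧ (p j).1 = 0 ∧ (p j).2 ∉ S) with hF0
  set FT := (Finset.range n).filter (fun j => c j = 2 ∧ (p j).1 = T ∧ (p j).2 ∉ Y) with hFT
  set BU := (Finset.range n).filter (fun j => 3 ≤ c j) with hBU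
  have e1 : (g : ℤ) + 2 * D.card = n := by rw [← hw.ht le_rfl, hp]
  have e2 : n ≤ D.card + (F0.card + FT.card) + BU.card := by
    have : Finset.range n ⊆ D ∪ (F0 ∪ FT) ∪ BU := by
      intro i hi
      have hi' := Finset.mem_range.1 hi
      simp only [Finset.mem_union, hD, hF0, hFT, hBU, Finset.mem_filter, hi, true_and]
      obtain ⟨-, -, -, -, -, h2, -⟩ := hw.2.2.2 i hi'
      rcases (show c i < 2 ∨ c i = 2 ∨ 3 ≤ c i by generalize c i = z; revert z; decide) with h | h | h
      · tauto
      · have := h2 h; tauto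
      · tauto
    have := Finset.card_le_card this
    rw [Finset.card_range] at this
    have a1 := Finset.card_union_le (D ∪ (F0 ∪ FT)) BU
    have a2 := Finset.card_union_le D (F0 ∪ FT)
    have a3 := Finset.card_union_le F0 FT
    omega
  have side : ∀ (a : ℤ) (X : Finset ℤ), X ⊆ Finset.Ico 0 (g : ℤ) →
      ((Finset.range n).filter (fun j => c j = 2 ∧ (p j).1 = a ∧ (p j).2 ∉ X)).card + X.card ≤ g := by
    intro a X hX
    have : ((Finset.range n).filter (fun j => c j = 2 ∧ (p j).1 = a ∧ (p j).2 ∉ X)).card ≤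
        (Finset.Ico 0 (g : ℤ) \ X).card := by
      refine Finset.card_le_card_of_injOn (fun i => (p i).2) (fun i hi => ?_) (fun i hi j hj e => ?_)
      · simp only [Finset.coe_filter, Finset.mem_range, mem_setOf_eq] at hi
        simp only [Finset.mem_coe, Finset.mem_sdiff]
        exact ⟨hup i hi.1 (by rw [hi.2.1]; decide), hi.2.2.2⟩
      · simp only [Finset.coe_filter, Finset.mem_range, mem_setOf_eq] at hi hj
        exact inj i hi.1.le j hj.1.le (Prod.ext (by rw [hi.2.2.1, hj.2.2.1]) e)
    rw [Finset.card_sdiff_of_subset hX, Int.card_Ico] at this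
    have := Finset.card_le_card hX
    rw [Int.card_Ico] at this
    simp at *
    omega
  have s0 := side 0 S hS
  have sT := side T Y hY
  rw [← hF0] at s0
  rw [← hFT] at sT
  have both : F0.Nonempty → FT.Nonempty → T ≤ D.card := by
    rintro ⟨i, hi⟩ ⟨j, hj⟩
    simp only [hF0, hFT, Finset.mem_filter, Finset.mem_range] at hi hj
    have mon : ∀ l < n, ((Finset.range l).filter (fun j => c j < 2)).card ≤ D.card := fun l hl =>
      Finset.card_le_card (Finset.filter_subset_filter _ (Finset.range_mono hl.le))
    rcases le_total i j with hij | hij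
    · have := hw.hz hij hj.1.le
      rw [hi.2.2.1, hj.2.2.1, sub_zero, Nat.abs_cast] at this
      have := mon j hj.1
      omega
    · have := hw.hz hij hi.1.le
      rw [hi.2.2.1, hj.2.2.1, zero_sub, abs_neg, Nat.abs_cast] at this
      have := mon i hi.1
      omega
  set k : Code := ⟨n, (p 0).1, fun i => c i⟩ with hk
  have kf : ∀ i < n, k.fn i = c i := fun i hi => by
    have hi' : i < k.1 := hi
    simp only [Code.fn, hi', dif_pos]
    rfl
  have kp : ∀ i < n, posn k.2.1 k.fn i = p i := fun i hi => hw.posn kf hi.le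
  have cBe : cB k = BU.image (fun i => p i + (0, offs (c i))) := by
    unfold cB
    ext b
    simp only [Finset.mem_image, Finset.mem_filter, Finset.mem_range, hBU]
    constructor
    · rintro ⟨i, ⟨h1, h2⟩, h3⟩
      have h1 : i < n := h1
      rw [kf i h1] at h2 h3; rw [kp i h1] at h3
      exact ⟨i, ⟨h1, h2⟩, h3⟩
    · rintro ⟨i, ⟨h1, h2⟩, h3⟩
      refine ⟨i, ⟨h1, by rwa [kf i h1]⟩, by rwa [kf i h1, kp i h1]⟩
  have c3 : BU.card ≤ 3 * (cB k).card := by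
    rw [cBe]
    refine Finset.card_le_mul_card_image _ _ (fun b hb => ?_)
    refine le_trans (Finset.card_le_card_of_injOn (t := ({-1, 0, 1} : Finset ℤ))
      (fun i => offs (c i)) (fun i hi => ?_) (fun i hi j hj e => ?_)) (by decide)
    · have : ∀ z, offs z ∈ ({-1, 0, 1} : Finset ℤ) := by decide
      exact this (c i)
    · simp only [Finset.coe_filter, mem_setOf_eq, hBU, Finset.mem_filter, Finset.mem_range] at hi hj
      have h1 := hi.2.trans hj.2.symm
      simp only at e
      rw [e] at h1
      exact inj i hi.1.1.le j hj.1.1.le (add_right_cancel h1)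
  have nb : n + 1 ≤ (T + 1) * (g + 1) := by
    have : (Finset.range (n + 1)).card ≤ ((Finset.Icc (0 : ℤ) T) ×ˢ (Finset.Icc (0 : ℤ) g)).card := by
      refine Finset.card_le_card_of_injOn p (fun i hi => ?_) (fun i hi j hj e => ?_)
      · have := hw.box (i := i) (by simp at hi; omega)
        simp only [Finset.mem_coe, Finset.mem_product, Finset.mem_Icc]
        tauto
      · simp at hi hj
        exact inj i (by omega) j (by omega) e
    rw [Finset.card_product, Finset.card_range, Int.card_Icc, Int.card_Icc] at this
    refine this.trans (le_of_eq ?_)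
    congr 1 <;> omega
  refine ⟨k, ?_, ?_⟩
  · unfold Cod
    simp only [Finset.mem_filter, Finset.mem_sigma, Finset.mem_Icc, Finset.mem_product,
      Finset.mem_univ, and_true]
    refine ⟨⟨⟨?_, ?_⟩, hw.2.1, hw.2.2.1⟩, ?_⟩
    · show g ≤ n
      omega
    · show n ≤ _
      omega
    · show n ≤ 192 * _
      rcases F0.eq_empty_or_nonempty with h0 | h0
      · have := Finset.card_eq_zero.2 h0
        omega
      · rcases FT.eq_empty_or_nonempty with h1 | h1
        · have := Finset.card_eq_zero.2 h1
          omega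
        · have := both h0 h1
          omega
  · intro b hb
    rw [cBe] at hb
    obtain ⟨i, hi, rfl⟩ := Finset.mem_image.1 hb
    simp only [hBU, Finset.mem_filter, Finset.mem_range] at hi
    exact (hw.2.2.2 i hi.1).2.2.2.2.2.2 hi.2

/-- the sheet lemma -/
theorem sheet (hg : 1 ≤ g) (hT : 2 * g ≤ T)
    (hS : S ⊆ Finset.Ico 0 (g : ℤ)) (hY : Y ⊆ Finset.Ico 0 (g : ℤ)) (cS : g ≤ 32 * S.card)
    (cY : g ≤ 32 * Y.card) : (∃ k ∈ Cod T g, ∀ b ∈ cB k, b ∈ bad) ∨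
    ∃ F : ℤ → ℤ, F 0 ∈ S ∧ F T ∈ Y ∧ (∀ t : ℤ, 0 ≤ t → t ≤ T → 0 ≤ F t ∧ F t < g ∧
      ∀ o : ℤ, (o = -1 ∨ o = 0 ∨ o = 1) → (t, F t + o) ∉ bad) ∧
      ∀ t : ℤ, 0 ≤ t → t < T → |F (t + 1) - F t| ≤ 1 := by
  by_cases h : ∃ n p c, Wlk T g bad S Y n p c ∧ (p n).2 = g
  · exact .inl (sheet_neg h hg hT hS hY cS cY)
  · exact .inr (sheet_pos h hg)

end sheets

noncomputable def Zs (ε : ℝ) (T g : ℕ) : ℝ := ∑ k ∈ Cod T g, ε ^ (cB k).card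

theorem Zs_nn {ε : ℝ} (h : 0 ≤ ε) (T g : ℕ) : 0 ≤ Zs ε T g :=
  Finset.sum_nonneg fun _ _ => pow_nonneg h _

theorem geo_tail {x : ℝ} (h0 : 0 ≤ x) (h1 : x ≤ 1 / 2) (g M : ℕ) :
    ∑ N ∈ Finset.Icc g M, x ^ N ≤ 2 * x ^ g := by
  rcases le_or_gt g M with h | h
  · suffices H : ∑ N ∈ Finset.Icc g M, x ^ N ≤ 2 * x ^ g - x ^ M by
      linarith [pow_nonneg h0 M]
    induction M, h using Nat.le_induction with
    | base => simp; linarith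
    | succ M hM ih =>
      rw [Finset.sum_Icc_succ_top (by omega)]
      have : x ^ (M + 1) ≤ x ^ M / 2 := by
        rw [pow_succ]; nlinarith [pow_nonneg h0 M]
      linarith
  · rw [Finset.Icc_eq_empty (by omega)]; simp; positivity

theorem Zs_le {η : ℝ} (h0 : 0 ≤ η) (h1 : η ≤ 1 / 12) {g : ℕ} (hg : 1 ≤ g) :
    Zs (η ^ 192) (2 * g) g ≤ (48 * η) ^ g := by
  have hle : η ≤ 1 := by linarith
  have a : Zs (η ^ 192) (2 * g) g ≤ ∑ k ∈ Cod (2 * g) g, η ^ k.1 := by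
    refine Finset.sum_le_sum fun k hk => ?_
    rw [← pow_mul]
    exact pow_le_pow_of_le_one h0 hle (Finset.mem_filter.1 hk).2
  have b : ∑ k ∈ Cod (2 * g) g, η ^ k.1 ≤
      ∑ N ∈ Finset.Icc g ((2 * g + 1) * (g + 1)), ((2 * g + 1 : ℕ) : ℝ) * (6 * η) ^ N := by
    refine (Finset.sum_le_sum_of_subset_of_nonneg (Finset.filter_subset _ _)
      (fun _ _ _ => pow_nonneg h0 _)).trans (le_of_eq ?_)
    rw [Finset.sum_sigma]
    refine Finset.sum_congr rfl fun N hN => ?_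
    show ∑ s ∈ _, η ^ N = _
    rw [Finset.sum_const, Finset.card_product, Int.card_Icc, Finset.card_univ]
    simp only [Fintype.card_fun, Fintype.card_fin, nsmul_eq_mul]
    rw [show ((((2 * g : ℕ) : ℤ) + 1 - 0).toNat) = 2 * g + 1 by omega]
    push_cast
    rw [mul_pow]; ring
  refine a.trans (b.trans ?_)
  rw [← Finset.mul_sum]
  have c := geo_tail (x := 6 * η) (by positivity) (by linarith) g ((2 * g + 1) * (g + 1))
  have d : ((2 * g + 1 : ℕ) : ℝ) * 2 ≤ 8 ^ g := by
    have : (2 * g + 1) * 2 ≤ 8 ^ g := by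
      clear c b a
      induction g, hg using Nat.le_induction with
      | base => norm_num
      | succ g hg ih => rw [pow_succ]; omega
    exact_mod_cast this
  calc _ ≤ ((2 * g + 1 : ℕ) : ℝ) * (2 * (6 * η) ^ g) := by gcongr
    _ = ((2 * g + 1 : ℕ) : ℝ) * 2 * (6 * η) ^ g := by ring
    _ ≤ 8 ^ g * (6 * η) ^ g := by gcongr
    _ = _ := by rw [← mul_pow]; congr 1; ring

section multi

def Obs {X : Type*} (f : ℤ × ℤ → X) (bad : Set X) (T g : ℕ) : Prop :=
  ∃ k ∈ Cod T g, ∀ b ∈ cB k, f b ∈ bad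
variable {Ω X ι : Type*} [MeasurableSpace Ω] {μ : Measure Ω} [IsProbabilityMeasure μ]
  {bad : Ω → Set X} {ε : ℝ} {T g : ℕ} {f : ι → ℤ × ℤ → X}

theorem multi0 (hε : 0 ≤ ε) (hb : ∀ B : Finset X, μ.real {u | ∀ x ∈ B, x ∈ bad u} ≤ ε ^ B.card)
    (hf : ∀ i a j b, f i a = f j b → i = j ∧ a = b) (J : Finset ι) : ∀ B : Finset X,
    (∀ j ∈ J, ∀ b, f j b ∉ B) →
    μ.real {u | (∀ x ∈ B, x ∈ bad u) ∧ ∀ j ∈ J, ∃ k ∈ Cod T g, ∀ b ∈ cB k, f j b ∈ bad u} ≤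
      ε ^ B.card * Zs ε T g ^ J.card := by
  classical
  induction J using Finset.induction_on with
  | empty =>
    intro B _
    simpa using hb B
  | insert j J hj ih =>
    intro B hB
    have sub : {u | (∀ x ∈ B, x ∈ bad u) ∧ ∀ i ∈ insert j J, ∃ k ∈ Cod T g, ∀ b ∈ cB k, f i b ∈ bad u} ⊆
        ⋃ k ∈ Cod T g, {u | (∀ x ∈ B ∪ (cB k).image (f j), x ∈ bad u) ∧
          ∀ i ∈ J, ∃ k ∈ Cod T g, ∀ b ∈ cB k, f i b ∈ bad u} := by
      rintro u ⟨h1, h2⟩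
      obtain ⟨k, hk, h3⟩ := h2 j (Finset.mem_insert_self _ _)
      simp only [mem_iUnion]
      refine ⟨k, hk, fun x hx => ?_, fun i hi => h2 i (Finset.mem_insert_of_mem hi)⟩
      rcases Finset.mem_union.1 hx with hx | hx
      · exact h1 x hx
      · obtain ⟨b, hb', rfl⟩ := Finset.mem_image.1 hx
        exact h3 b hb'
    refine (measureReal_mono sub (measure_ne_top _ _)).trans ((measureReal_biUnion_finset_le _ _).trans ?_)
    rw [Finset.card_insert_of_notMem hj, pow_succ, mul_comm (_ ^ _) (Zs ε T g), ← mul_assoc,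
      mul_comm _ (Zs ε T g)]
    conv_rhs => unfold Zs
    rw [Finset.sum_mul, Finset.sum_mul]
    refine Finset.sum_le_sum fun k hk => ?_
    refine (ih _ ?_).trans (le_of_eq ?_)
    · intro i hi b hbm
      rcases Finset.mem_union.1 hbm with h | h
      · exact hB i (Finset.mem_insert_of_mem hi) b h
      · obtain ⟨b', -, h'⟩ := Finset.mem_image.1 h
        exact hj ((hf _ _ _ _ h').1 ▸ hi)
    · rw [Finset.card_union_of_disjoint, Finset.card_image_of_injective, pow_add]
      · unfold Zs; ring
      · intro a b hab; exact (hf _ _ _ _ hab).2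
      · rw [Finset.disjoint_right]
        intro x hx
        obtain ⟨b, -, rfl⟩ := Finset.mem_image.1 hx
        exact hB j (Finset.mem_insert_self _ _) b

open Classical in
theorem multi (hε : 0 ≤ ε) (hb : ∀ B : Finset X, μ.real {u | ∀ x ∈ B, x ∈ bad u} ≤ ε ^ B.card)
    (hf : ∀ i a j b, f i a = f j b → i = j ∧ a = b) (J : Finset ι) (n : ℕ) :
    μ.real {u | n ≤ (J.filter (fun j => Obs (f j) (bad u) T g)).card} ≤
      2 ^ J.card * Zs ε T g ^ n := by
  have sub : {u | n ≤ (J.filter (fun j => Obs (f j) (bad u) T g)).card} ⊆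
      ⋃ K ∈ J.powersetCard n, {u | (∀ x ∈ (∅ : Finset X), x ∈ bad u) ∧
          ∀ i ∈ K, ∃ k ∈ Cod T g, ∀ b ∈ cB k, f i b ∈ bad u} := by
    intro u hu
    obtain ⟨K, h1, h2⟩ := Finset.exists_subset_card_eq (mem_setOf_eq ▸ hu)
    simp only [mem_iUnion]
    refine ⟨K, Finset.mem_powersetCard.2 ⟨h1.trans (Finset.filter_subset _ _), h2⟩, by simp, ?_⟩
    intro i hi
    exact (Finset.mem_filter.1 (h1 hi)).2
  refine (measureReal_mono sub (measure_ne_top _ _)).trans ((measureReal_biUnion_finset_le _ _).trans ?_)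
  calc _ ≤ ∑ K ∈ J.powersetCard n, Zs ε T g ^ n := by
        refine Finset.sum_le_sum fun K hK => ?_
        refine (multi0 hε hb hf K ∅ (by simp)).trans (le_of_eq ?_)
        rw [(Finset.mem_powersetCard.1 hK).2]; simp
    _ = (J.card.choose n : ℝ) * Zs ε T g ^ n := by
        rw [Finset.sum_const, Finset.card_powersetCard, nsmul_eq_mul]
    _ ≤ _ := by
        have := Nat.choose_le_two_pow J.card n
        have h2 : (J.card.choose n : ℝ) ≤ 2 ^ J.card := by exact_mod_cast this
        have := pow_nonneg (Zs_nn hε T g) n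
        gcongr
end multi

section scales
open Classical

abbrev X3 := ℤ × ℤ × ℤ
def nb3 (x y : X3) : Prop := |x.1 - y.1| + |x.2.1 - y.2.1| + |x.2.2 - y.2.2| = 1

theorem line {X : Type} {nb : X → X → Prop} {alive : ℕ → Set X} {bad : Set X} {R : ℕ} {Win : Set X}
    (hm : ∀ ρ ρ', ρ ≤ ρ' → alive ρ ⊆ alive ρ')
    (hit : ∀ ρ x y, ρ + 512 ≤ R → x ∈ alive ρ → nb x y → y ∈ Win → y ∈ alive (ρ + 512) ∨ y ∈ bad)
    (f : ℤ × ℤ → X) (hn : ∀ t s, nb (f (t, s)) (f (t + 1, s)) ∧ nb (f (t, s)) (f (t, s + 1)) ∧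
      nb (f (t, s + 1)) (f (t, s))) {g' : ℕ} (hg : 1 ≤ g')
    (hW : ∀ t s : ℤ, 0 ≤ t → t ≤ 64 * g' → 0 ≤ s → s < 32 * g' → f (t, s) ∈ Win) {ρ : ℕ}
    (hS : g' ≤ ((Finset.Ico (0 : ℤ) (32 * g')).filter (fun s => f (0, s) ∈ alive ρ)).card)
    (hO : ¬ Obs f bad (2 * (32 * g')) (32 * g'))
    (hR : ρ + 1024 * (64 * g') ≤ R) :
    31 * g' ≤ ((Finset.Ico (0 : ℤ) (32 * g')).filter
      (fun s => f (64 * g', s) ∈ alive (ρ + 1024 * (64 * g')))).card := by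
  by_contra hlt
  set I := Finset.Ico (0 : ℤ) (32 * g') with hI
  have hIe : I = Finset.Ico (0 : ℤ) ((32 * g' : ℕ) : ℤ) := by rw [hI]; push_cast; rfl
  have hc := Finset.card_filter_add_card_filter_not (s := I)
    (fun s => f (64 * g', s) ∈ alive (ρ + 1024 * (64 * g')))
  have hIc : I.card = 32 * g' := by rw [hI, Int.card_Ico]; omega
  rcases sheet (g := 32 * g') (T := 2 * (32 * g')) (bad := {b | f b ∈ bad})
    (S := I.filter (fun s => f (0, s) ∈ alive ρ))
    (Y := I.filter (fun s => ¬ f (64 * g', s) ∈ alive (ρ + 1024 * (64 * g'))))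
    (by omega) le_rfl (by rw [← hIe]; exact Finset.filter_subset _ _)
    (by rw [← hIe]; exact Finset.filter_subset _ _) (by omega) (by omega) with h | h
  · exact hO h
  · obtain ⟨F, h0, hT, hb, hl⟩ := h
    have hb' : ∀ t : ℤ, 0 ≤ t → t ≤ 64 * g' → 0 ≤ F t ∧ F t < 32 * g' ∧
        ∀ o : ℤ, (o = -1 ∨ o = 0 ∨ o = 1) → f (t, F t + o) ∉ bad := by
      intro t h1 h2
      obtain ⟨a, b, c⟩ := hb t h1 (by push_cast; linarith)
      exact ⟨a, by push_cast at b; exact b, c⟩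
    have key : ∀ t : ℕ, t ≤ 64 * g' → f (t, F t) ∈ alive (ρ + 1024 * t) := by
      intro t
      induction t with
      | zero => intro _; exact (Finset.mem_filter.1 h0).2
      | succ t ih =>
        intro ht
        have h1 := ih (by omega)
        obtain ⟨a1, a2, a3⟩ := hb' t (by omega) (by omega)
        obtain ⟨b1, b2, b3⟩ := hb' (t + 1) (by omega) (by omega)
        have h2 := hl t (by omega) (by push_cast; omega)
        have h3 : f ((t : ℤ) + 1, F t) ∈ alive (ρ + 1024 * t + 512) := by
          refine (hit _ _ _ (by omega) h1 (hn _ _).1 (hW _ _ (by omega) (by omega) a1 a2)).resolve_right ?_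
          have := b3 (F t - F (t + 1)) (by rw [abs_le] at h2; omega)
          rwa [show F (t + 1) + (F t - F (t + 1)) = F t by ring] at this
        have h4 : f ((t : ℤ) + 1, F (t + 1)) ∈ alive (ρ + 1024 * t + 512 + 512) := by
          have nbad : f ((t : ℤ) + 1, F (t + 1)) ∉ bad := by simpa using b3 0 (by simp)
          have hw := hW (t + 1) (F (t + 1)) (by omega) (by omega) b1 b2
          rcases (show F (t + 1) = F t ∨ F (t + 1) = F t + 1 ∨ F t = F (t + 1) + 1 by
            rw [abs_le] at h2; omega) with e | e | e
          · rw [e]; exact hm _ _ (by omega) h3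
          · refine (hit _ _ _ (by omega) h3 ?_ hw).resolve_right nbad
            rw [e]; exact (hn _ _).2.1
          · refine (hit _ _ _ (by omega) h3 ?_ hw).resolve_right nbad
            rw [e]; exact (hn _ _).2.2
        push_cast
        convert h4 using 2
        omega
    have := key (64 * g') le_rfl
    have h5 := (Finset.mem_filter.1 hT).2
    have e : (((2 * (32 * g') : ℕ)) : ℤ) = 64 * g' := by push_cast; ring
    rw [e] at h5
    apply h5
    push_cast at this
    exact this

theorem dbl {α β : Type*} (I : Finset α) (J : Finset β) (P : α → β → Prop) :
    ∑ i ∈ I, (J.filter (fun j => P i j)).card = ∑ j ∈ J, (I.filter (fun i => P i j)).card := by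
  simp only [Finset.card_filter]
  exact Finset.sum_comm

/-- bound of a sum over a set split by a threshold -/
theorem thr {α : Type*} (I : Finset α) (φ : α → ℕ) (A b : ℕ) (Q : α → Prop)
    (h1 : ∀ i ∈ I, φ i ≤ A) (h2 : ∀ i ∈ I, ¬ Q i → φ i ≤ b) :
    ∑ i ∈ I, φ i + (I.filter Q).card * b ≤ (I.filter Q).card * A + I.card * b := by
  rw [← Finset.sum_filter_add_sum_filter_not I Q, ← Finset.card_filter_add_card_filter_not (s := I) Q]
  have a := Finset.sum_le_card_nsmul (I.filter Q) φ A (fun i hi => h1 i (Finset.mem_filter.1 hi).1)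
  have c := Finset.sum_le_card_nsmul (I.filter (fun i => ¬ Q i)) φ b
    (fun i hi => h2 i (Finset.mem_filter.1 hi).1 (Finset.mem_filter.1 hi).2)
  simp only [smul_eq_mul] at a c
  nlinarith

def rowf (a z : ℤ) (b : ℤ × ℤ) : X3 := (a + b.1, b.2, z)
def colf (a y : ℤ) (b : ℤ × ℤ) : X3 := (a + b.1, y, b.2)

noncomputable def cnt (al : Set X3) (a : ℤ) (w' H' : ℕ) : ℕ :=
  ∑ z ∈ Finset.Ico (0 : ℤ) (32 * H'), ((Finset.Ico (0 : ℤ) (16 * w')).filter (fun y => (a, y, z) ∈ al)).card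

theorem scale_step {alive : ℕ → Set X3} {bad : Set X3} {R : ℕ} {Win : Set X3}
    (hm : ∀ ρ ρ', ρ ≤ ρ' → alive ρ ⊆ alive ρ')
    (hit : ∀ ρ x y, ρ + 512 ≤ R → x ∈ alive ρ → nb3 x y → y ∈ Win → y ∈ alive (ρ + 512) ∨ y ∈ bad)
    {w' H' : ℕ} (hw : 1 ≤ w') (hH : 1 ≤ H') {a : ℤ} {ρ : ℕ}
    (hWin : ∀ x y z : ℤ, a ≤ x → x ≤ a + 64 * w' + 64 * H' → 0 ≤ y → y < 32 * w' → 0 ≤ z →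
      z < 32 * H' → (x, y, z) ∈ Win)
    (hR : ρ + 1024 * (64 * w') + 1024 * (64 * H') = R)
    (hc : 256 * w' * H' ≤ cnt (alive ρ) a w' H')
    (h1 : ((Finset.Ico (0 : ℤ) (32 * H')).filter (fun z => Obs (rowf a z) bad (2 * (32 * w')) (32 * w'))).card < H')
    (h2 : ((Finset.Ico (0 : ℤ) (32 * w')).filter (fun y => Obs (colf (a + 64 * w') y) bad (2 * (32 * H')) (32 * H'))).card < w') :
    256 * (2 * w') * H' ≤ cnt (alive R) (a + 64 * w' + 64 * H') (2 * w') H' := by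
  set JZ := Finset.Ico (0 : ℤ) (32 * H') with hJZ
  set IY := Finset.Ico (0 : ℤ) (32 * w') with hIY
  have cZ : JZ.card = 32 * H' := by rw [hJZ, Int.card_Ico]; omega
  have cY : IY.card = 32 * w' := by rw [hIY, Int.card_Ico]; omega
  set OZ := JZ.filter (fun z => Obs (rowf a z) bad (2 * (32 * w')) (32 * w'))
    with hOZ
  set OY := IY.filter (fun y => Obs (colf (a + 64 * w') y) bad (2 * (32 * H')) (32 * H')) with hOY
  -- rows
  obtain ⟨Q, hQ⟩ : ∃ Q : ℤ → Prop, ∀ z, Q z ↔ w' ≤ (IY.filter (fun y => rowf a z (0, y) ∈ alive ρ)).card :=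
    ⟨_, fun _ => Iff.rfl⟩
  have t1 := thr JZ (fun z => ((Finset.Ico (0 : ℤ) (16 * w')).filter (fun y => (a, y, z) ∈ alive ρ)).card)
    (16 * w') w' Q (fun z hz => (Finset.card_filter_le _ _).trans (by rw [Int.card_Ico]; omega))
    (fun z hz hq => by
      rw [hQ] at hq
      refine le_trans (Finset.card_le_card ?_) (not_le.1 hq).le
      intro y hy
      rw [Finset.mem_filter, Finset.mem_Ico] at hy
      rw [Finset.mem_filter, hIY, Finset.mem_Ico]
      refine ⟨⟨hy.1.1, by omega⟩, ?_⟩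
      simpa [rowf] using hy.2)
  rw [cZ] at t1
  have t2 : 224 * H' ≤ 15 * (JZ.filter Q).card := by
    have : 256 * w' * H' + (JZ.filter Q).card * w' ≤ (JZ.filter Q).card * (16 * w') + 32 * H' * w' :=
      le_trans (Nat.add_le_add_right hc _) t1
    by_contra h
    have h' := not_le.1 h
    nlinarith
  set G := JZ.filter Q \ OZ with hG
  have t3 : 209 * H' ≤ 15 * G.card := by
    have := Finset.le_card_sdiff OZ (JZ.filter Q)
    rw [← hG] at this
    omega
  set ρ1 := ρ + 1024 * (64 * w') with hρ1
  have t4 : ∀ z ∈ G, 31 * w' ≤ (IY.filter (fun y => (a + 64 * w', y, z) ∈ alive ρ1)).card := by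
    intro z hz
    rw [hG, Finset.mem_sdiff, Finset.mem_filter] at hz
    have hz0 := Finset.mem_Ico.1 hz.1.1
    refine line (Win := Win) (nb := nb3) hm hit (rowf a z) ?_ hw ?_ ((hQ z).1 hz.1.2) ?_ (by omega)
    · intro t s
      refine ⟨?_, ?_, ?_⟩ <;> simp [rowf, nb3]
    · intro t s q1 q2 q3 q4
      exact hWin _ _ _ (by simp [q1]) (by simp only; omega) q3 q4 hz0.1 hz0.2
    · intro h
      exact hz.2 (Finset.mem_filter.2 ⟨hz.1.1, h⟩)
  -- columns
  obtain ⟨Q2, hQ2⟩ : ∃ Q2 : ℤ → Prop, ∀ y, Q2 y ↔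
      H' ≤ (JZ.filter (fun z => colf (a + 64 * w') y (0, z) ∈ alive ρ1)).card := ⟨_, fun _ => Iff.rfl⟩
  have t5 : 31 * w' * G.card ≤ ∑ y ∈ IY, (G.filter (fun z => (a + 64 * w', y, z) ∈ alive ρ1)).card := by
    rw [dbl]
    have := Finset.card_nsmul_le_sum G _ _ t4
    rw [smul_eq_mul] at this
    linarith
  have t6 := thr IY (fun y => (G.filter (fun z => (a + 64 * w', y, z) ∈ alive ρ1)).card)
    G.card H' Q2 (fun y hy => Finset.card_filter_le _ _)
    (fun y hy hq => by
      rw [hQ2] at hq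
      refine le_trans (Finset.card_le_card ?_) (not_le.1 hq).le
      intro z hz
      rw [Finset.mem_filter] at hz ⊢
      refine ⟨(Finset.mem_filter.1 (Finset.mem_sdiff.1 hz.1).1).1, ?_⟩
      simpa [colf] using hz.2)
  rw [cY] at t6
  have t7 : 18 * w' ≤ (IY.filter Q2).card := by
    by_contra h
    have h' := not_le.1 h
    set C := (IY.filter Q2).card
    have e1 : 31 * w' * G.card + C * H' ≤ C * G.card + 32 * w' * H' := by linarith
    have hGH : H' ≤ G.card := by omega
    obtain ⟨D, hD⟩ := Nat.exists_eq_add_of_le hGH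
    rw [hD] at e1
    have e2 : C * D ≤ 18 * w' * D := Nat.mul_le_mul_right _ h'.le
    have e3 : 31 * w' * H' + 13 * w' * D ≤ 32 * w' * H' := by nlinarith
    have e4 : w' * (31 * H' + 13 * D) ≤ w' * (32 * H') := by nlinarith
    have e5 := Nat.le_of_mul_le_mul_left e4 (by omega)
    omega
  have t8 : 17 * w' ≤ (IY.filter Q2 \ OY).card := by
    have := Finset.le_card_sdiff OY (IY.filter Q2)
    omega
  have t9 : ∀ y ∈ IY.filter Q2 \ OY,
      31 * H' ≤ (JZ.filter (fun z => (a + 64 * w' + 64 * H', y, z) ∈ alive R)).card := by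
    intro y hy
    rw [Finset.mem_sdiff, Finset.mem_filter] at hy
    have hy0 := Finset.mem_Ico.1 hy.1.1
    rw [← hR]
    refine line (Win := Win) (nb := nb3) hm hit (colf (a + 64 * w') y) ?_ hH ?_ ((hQ2 y).1 hy.1.2) ?_ (by omega)
    · intro t s
      refine ⟨?_, ?_, ?_⟩ <;> simp [colf, nb3]
    · intro t s q1 q2 q3 q4
      exact hWin _ _ _ (by simp only; omega) (by simp only; omega) hy0.1 hy0.2 q3 q4
    · intro h
      exact hy.2 (Finset.mem_filter.2 ⟨hy.1.1, h⟩)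
  unfold cnt
  rw [← hJZ, ← dbl (Finset.Ico (0 : ℤ) (16 * ((2 * w' : ℕ) : ℤ))) JZ
    (fun y z => (a + 64 * w' + 64 * H', y, z) ∈ alive R),
    show (16 * ((2 * w' : ℕ) : ℤ)) = 32 * w' by push_cast; ring, ← hIY]
  calc 256 * (2 * w') * H' ≤ 17 * w' * (31 * H') := by nlinarith
    _ ≤ (IY.filter Q2 \ OY).card * (31 * H') := Nat.mul_le_mul_right _ t8
    _ ≤ ∑ y ∈ IY.filter Q2 \ OY, (JZ.filter (fun z => (a + 64 * w' + 64 * H', y, z) ∈ alive R)).card := by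
        have := Finset.card_nsmul_le_sum _ _ _ t9
        rwa [smul_eq_mul] at this
    _ ≤ _ := Finset.sum_le_sum_of_subset (Finset.sdiff_subset.trans (Finset.filter_subset _ _))

end scales

section scp
open Classical

def sa (w H : ℕ) : ℕ → ℕ
  | 0 => 0
  | j + 1 => sa w H j + 64 * (2 ^ j * w) + 64 * H

theorem sa_le (w H j : ℕ) : sa w H j ≤ 64 * (2 ^ j * w) + 64 * (H * j) := by
  induction j with
  | zero => simp [sa]
  | succ j ih => rw [sa, pow_succ]; nlinarith

theorem sa_ge (w : ℕ) {H : ℕ} (hH : 1 ≤ H) (j : ℕ) : j ≤ sa w H j := by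
  induction j with
  | zero => simp
  | succ j ih => rw [sa]; omega

theorem sa_mono (w H : ℕ) {i j : ℕ} (h : i ≤ j) : sa w H i ≤ sa w H j := by
  induction j, h using Nat.le_induction with
  | base => rfl
  | succ j _ ih => rw [sa]; omega

theorem sa_bd {w H : ℕ} (h : H ≤ w) (j : ℕ) : sa w H (j + 1) ≤ 192 * (2 ^ j * w) := by
  rw [sa]
  have h1 := sa_le w H j
  have h2 : H * (j + 1) ≤ 2 ^ j * w := by
    rw [mul_comm]
    exact Nat.mul_le_mul Nat.lt_two_pow_self h
  nlinarith

variable {V Ω : Type} [DecidableEq V] [Countable V] [Fintype Ω] [MeasurableSpace Ω]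
  [MeasurableSingletonClass Ω] (E : Eng V X3 Ω) (Win : Finset X3) (s : St V X3 Ω)

def Fl (w H j : ℕ) (ξ : ℕ → Bool) : Set (V → Ω) :=
  {u | H ≤ ((Finset.Ico (0 : ℤ) (32 * H)).filter (fun z => Obs (rowf (sa w H j) z)
      (E.st Win s ξ (1024 * sa w H (j + 1)) u).bad (2 * (32 * (2 ^ j * w))) (32 * (2 ^ j * w)))).card} ∪
  {u | 2 ^ j * w ≤ ((Finset.Ico (0 : ℤ) (32 * (2 ^ j * w : ℕ))).filter
      (fun y => Obs (colf (sa w H j + 64 * (2 ^ j * w : ℕ)) y)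
      (E.st Win s ξ (1024 * sa w H (j + 1)) u).bad (2 * (32 * H)) (32 * H))).card}

variable {E Win s}

theorem Fl_le (hs : E.Ini s) (hε : E.ε = (1 / 768) ^ 192) {w H : ℕ} (hH : 1 ≤ H) (hw : H ≤ w)
    (j : ℕ) (ξ : ℕ → Bool) :
    (PM V E.ν).real (Fl E Win s w H j ξ) ≤ 2 * 2 ^ (32 * (2 ^ j * w)) * (1 / 16) ^ (32 * (2 ^ j * w * H)) := by
  haveI := E.prob
  set W := 2 ^ j * w with hW
  have hHW : H ≤ W := hw.trans (Nat.le_mul_of_pos_left _ (by positivity))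
  have hb := fun B => st_bad (Win := Win) hs ξ (1024 * sa w H (j + 1)) B
  have z : ∀ g : ℕ, 1 ≤ g → Zs E.ε (2 * (32 * g)) (32 * g) ≤ (1 / 16) ^ (32 * g) := by
    intro g hg
    rw [hε]
    refine (Zs_le (by norm_num) (by norm_num) (by omega)).trans (le_of_eq ?_)
    norm_num
  have c1 : (Finset.Ico (0 : ℤ) (32 * H)).card = 32 * H := by rw [Int.card_Ico]; omega
  have c2 : (Finset.Ico (0 : ℤ) (32 * W)).card = 32 * W := by rw [Int.card_Ico]; omega
  have m1 := multi (T := 2 * (32 * W)) (g := 32 * W) (f := rowf (sa w H j)) E.hε hb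
    (by
      intro i a j b h
      simp only [rowf, Prod.mk.injEq] at h
      exact ⟨h.2.2, Prod.ext (by linarith [h.1]) h.2.1⟩) (Finset.Ico (0 : ℤ) (32 * H)) H
  have m2 := multi (T := 2 * (32 * H)) (g := 32 * H) (f := colf (sa w H j + 64 * (W : ℕ))) E.hε hb
    (by
      intro i a j b h
      simp only [colf, Prod.mk.injEq] at h
      exact ⟨h.2.1, Prod.ext (by linarith [h.1]) h.2.2⟩) (Finset.Ico (0 : ℤ) (32 * W)) W
  rw [c1] at m1
  rw [c2] at m2
  have p1 : (2 : ℝ) ^ (32 * H) * Zs E.ε (2 * (32 * W)) (32 * W) ^ H ≤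
      2 ^ (32 * W) * (1 / 16) ^ (32 * (W * H)) := by
    have h1 := pow_le_pow_left₀ (Zs_nn E.hε _ _) (z W (by omega)) H
    rw [← pow_mul, show 32 * W * H = 32 * (W * H) by ring] at h1
    have h2 : (2 : ℝ) ^ (32 * H) ≤ 2 ^ (32 * W) := pow_le_pow_right₀ (by norm_num) (by omega)
    exact mul_le_mul h2 h1 (pow_nonneg (Zs_nn E.hε _ _) _) (by positivity)
  have p2 : (2 : ℝ) ^ (32 * W) * Zs E.ε (2 * (32 * H)) (32 * H) ^ W ≤
      2 ^ (32 * W) * (1 / 16) ^ (32 * (W * H)) := by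
    have h1 := pow_le_pow_left₀ (Zs_nn E.hε _ _) (z H (by omega)) W
    rw [← pow_mul, show 32 * H * W = 32 * (W * H) by ring] at h1
    exact mul_le_mul le_rfl h1 (pow_nonneg (Zs_nn E.hε _ _) _) (by positivity)
  refine (measureReal_union_le _ _).trans ((add_le_add (m1.trans p1) (m2.trans p2)).trans (le_of_eq ?_))
  ring

theorem Fl_prefix (hs : E.Ini s) {w H j : ℕ} {ξ ξ' : ℕ → Bool}
    (h : ∀ i < E.N * (1024 * sa w H (j + 1)), ξ i = ξ' i) : Fl E Win s w H j ξ = Fl E Win s w H j ξ' := by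
  unfold Fl
  rw [st_prefix hs h]

theorem scale_ind (hs : E.Ini s) (hnb : ∀ x y, nb3 x y → E.nb x y) {w H M : ℕ} (hH : 1 ≤ H)
    (hw : H ≤ w) (hini : ∀ y z : ℤ, 0 ≤ y → y < 16 * w → 0 ≤ z → z < 32 * H → (0, y, z) ∈ s.alive)
    (hWin : ∀ x y z : ℤ, 0 ≤ x → x ≤ sa w H M → 0 ≤ y → y < 32 * (2 ^ M * w : ℕ) → 0 ≤ z → z < 32 * H →
      (x, y, z) ∈ Win) (ξ : ℕ → Bool) (u : V → Ω) (hF : ∀ j < M, u ∉ Fl E Win s w H j ξ) :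
    ∀ j ≤ M, 256 * (2 ^ j * w) * H ≤
      cnt (E.st Win s ξ (1024 * sa w H j) u).alive (sa w H j) (2 ^ j * w) H := by
  intro j
  induction j with
  | zero =>
    intro _
    unfold cnt
    have : ∀ z ∈ Finset.Ico (0 : ℤ) (32 * H), 16 * w ≤ ((Finset.Ico (0 : ℤ) (16 * ((2 ^ 0 * w : ℕ) : ℤ))).filter
        (fun y => (((sa w H 0 : ℕ) : ℤ), y, z) ∈ (E.st Win s ξ (1024 * sa w H 0) u).alive)).card := by
      intro z hz
      rw [Finset.mem_Ico] at hz
      rw [Finset.filter_true_of_mem, Int.card_Ico]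
      · push_cast; omega
      · intro y hy
        rw [Finset.mem_Ico] at hy
        refine (st_mono hs ξ (Nat.zero_le _) u).1 ?_
        push_cast at hy
        exact hini y z hy.1 (by linarith [hy.2]) hz.1 hz.2
    have := Finset.card_nsmul_le_sum _ _ _ this
    rw [Int.card_Ico, smul_eq_mul] at this
    refine le_trans ?_ this
    have : ((32 * H : ℤ) - 0).toNat = 32 * H := by omega
    rw [this]
    nlinarith
  | succ j ih =>
    intro hj
    have i1 := ih (by omega)
    have hf := hF j (by omega)
    simp only [Fl, mem_union, mem_setOf_eq, not_or, not_le] at hf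
    have hsm := sa_mono w H hj
    have hpm : 2 ^ j * w ≤ 2 ^ M * w := Nat.mul_le_mul_right _ (Nat.pow_le_pow_right (by norm_num) (by omega))
    have e : ((sa w H (j + 1) : ℕ) : ℤ) = sa w H j + 64 * (2 ^ j * w : ℕ) + 64 * H := by
      rw [sa]; push_cast; ring
    have hhit : ∀ ρ x y, ρ + 512 ≤ 1024 * sa w H (j + 1) → x ∈ (E.st Win s ξ ρ u).alive → nb3 x y →
        y ∈ (Win : Set X3) → y ∈ (E.st Win s ξ (ρ + 512) u).alive ∨
          y ∈ (E.st Win s ξ (1024 * sa w H (j + 1)) u).bad := by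
      intro ρ x y h1 h2 h3 h4
      have h6 := st_hit (Win := Win) hs ξ ρ u h2 (hnb _ _ h3) (Finset.mem_coe.1 h4)
      generalize ρ + 512 = R' at *
      rcases h6 with h | h
      · exact .inl h
      · have h5 := (st_mono (Win := Win) hs ξ h1 u).2
        exact .inr (h5 h)
    have key := scale_step (alive := fun ρ => (E.st Win s ξ ρ u).alive)
      (bad := (E.st Win s ξ (1024 * sa w H (j + 1)) u).bad) (R := 1024 * sa w H (j + 1))
      (Win := (Win : Set X3)) (fun ρ ρ' h => (st_mono hs ξ h u).1)
      hhit
      (w' := 2 ^ j * w) (H' := H) (Nat.mul_pos (by positivity) (by omega)) hH (a := sa w H j)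
      (ρ := 1024 * sa w H j)
      (by
        intro x y z q1 q2 q3 q4 q5 q6
        have hz : ((2 ^ j * w : ℕ) : ℤ) ≤ ((2 ^ M * w : ℕ) : ℤ) := by exact_mod_cast hpm
        exact hWin x y z (by omega) (by omega) q3 (by linarith) q5 q6)
      (by rw [sa]; ring) i1 hf.1 hf.2
    rw [← e] at key
    rw [pow_succ, show 2 ^ j * 2 * w = 2 * (2 ^ j * w) by ring]
    exact key

theorem scales_prob (hs : E.Ini s) (hnb : ∀ x y, nb3 x y → E.nb x y) (hε : E.ε = (1 / 768) ^ 192)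
    (hN : 1 ≤ E.N) {w H M m : ℕ} (hH : H = 196608 * E.N) (hm : 1 ≤ m) (hw : w = H * m)
    (hini : ∀ y z : ℤ, 0 ≤ y → y < 16 * w → 0 ≤ z → z < 32 * H → (0, y, z) ∈ s.alive)
    (hWin : ∀ x y z : ℤ, 0 ≤ x → x ≤ sa w H M → 0 ≤ y → y < 32 * (2 ^ M * w : ℕ) → 0 ≤ z → z < 32 * H →
      (x, y, z) ∈ Win) :
    (PM V E.ν).real {u | ∃ ξ, ∀ x ∈ (E.st Win s ξ (1024 * sa w H M) u).alive, x.1 < M} ≤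
      Real.exp (-m) := by
  haveI := E.prob
  have hH1 : 1 ≤ H := by omega
  have hHw : H ≤ w := by rw [hw]; exact Nat.le_mul_of_pos_right _ hm
  set L : ℕ → ℕ := fun j => E.N * (1024 * sa w H (j + 1)) with hL
  have hLb : ∀ j, L j ≤ H * (2 ^ j * w) := by
    intro j
    have := sa_bd hHw j
    show E.N * (1024 * sa w H (j + 1)) ≤ _
    calc E.N * (1024 * sa w H (j + 1)) ≤ E.N * (1024 * (192 * (2 ^ j * w))) := by gcongr
      _ = H * (2 ^ j * w) := by rw [hH]; ring
  let ext : (j : ℕ) → (Fin (L j) → Bool) → ℕ → Bool := fun j e i => if h : i < L j then e ⟨i, h⟩ else false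
  have sub : {u | ∃ ξ, ∀ x ∈ (E.st Win s ξ (1024 * sa w H M) u).alive, x.1 < M} ⊆
      ⋃ j ∈ Finset.range M, ⋃ e ∈ (Finset.univ : Finset (Fin (L j) → Bool)),
        Fl E Win s w H j (ext j e) := by
    rintro u ⟨ξ, hu⟩
    by_contra hc
    simp only [mem_iUnion, not_exists] at hc
    have hF : ∀ j < M, u ∉ Fl E Win s w H j ξ := by
      intro j hj h
      refine hc j (Finset.mem_range.2 hj) (fun i => ξ i) (Finset.mem_univ _) ?_
      rwa [Fl_prefix hs (ξ' := ξ)]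
      intro i hi
      have hi' : i < L j := hi
      simp [ext, hi']
    have := scale_ind hs hnb hH1 hHw hini hWin ξ u hF M le_rfl
    have pos : 0 < cnt (E.st Win s ξ (1024 * sa w H M) u).alive (sa w H M) (2 ^ M * w) H :=
      lt_of_lt_of_le (Nat.mul_pos (Nat.mul_pos (by norm_num) (Nat.mul_pos (by positivity) (by omega))) hH1) this
    unfold cnt at pos
    obtain ⟨z, -, hz⟩ := Finset.exists_ne_zero_of_sum_ne_zero pos.ne'
    obtain ⟨y, hy⟩ := Finset.card_pos.1 (Nat.pos_of_ne_zero hz)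
    have h1 := hu _ (Finset.mem_filter.1 hy).2
    have h2 := sa_ge w hH1 M
    simp only at h1
    omega
  have bound : ∀ j, ∑ e ∈ (Finset.univ : Finset (Fin (L j) → Bool)),
      (PM V E.ν).real (Fl E Win s w H j (ext j e)) ≤ (1 / 4) ^ m * ((1 / 2) ^ j * (1 / 2)) := by
    intro j
    refine (Finset.sum_le_card_nsmul _ _ _ (fun e _ => Fl_le hs hε hH1 hHw j _)).trans ?_
    rw [Finset.card_univ, nsmul_eq_mul]
    simp only [Fintype.card_fun, Fintype.card_bool, Fintype.card_fin]
    set W := 2 ^ j * w with hW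
    have hWm : m ≤ W := by
      rw [hW, hw]
      calc m = 1 * (1 * m) := by ring
        _ ≤ 2 ^ j * (H * m) := by gcongr; exact Nat.one_le_two_pow
    have hWj : j + 1 ≤ W := by
      have h1 : j + 1 ≤ 2 ^ j := Nat.lt_two_pow_self
      have h2 : 1 ≤ w := by omega
      calc j + 1 = (j + 1) * 1 := by ring
        _ ≤ 2 ^ j * w := Nat.mul_le_mul h1 h2
    have hWH : W ≤ W * H := Nat.le_mul_of_pos_right _ hH1
    have hexp : L j + 1 + 32 * W + (2 * m + j + 1) ≤ 4 * (32 * (W * H)) := by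
      have := hLb j
      rw [mul_comm, ← hW] at this
      omega
    push_cast
    have e16 : ((1 : ℝ) / 16) ^ (32 * (W * H)) = (1 / 2) ^ (4 * (32 * (W * H))) := by
      rw [pow_mul (1 / 2 : ℝ) 4]; norm_num
    have e4 : ((1 : ℝ) / 4) ^ m * ((1 / 2) ^ j * (1 / 2)) = (1 / 2) ^ (2 * m + j + 1) := by
      rw [pow_add, pow_add, pow_mul]; norm_num; ring
    rw [e16, e4]
    calc (2 : ℝ) ^ L j * (2 * 2 ^ (32 * W) * (1 / 2) ^ (4 * (32 * (W * H))))
        ≤ (2 : ℝ) ^ L j * (2 * 2 ^ (32 * W) * (1 / 2) ^ (L j + 1 + 32 * W + (2 * m + j + 1))) := by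
          gcongr ?_ * (?_ * ?_)
          exact pow_le_pow_of_le_one (by norm_num) (by norm_num) hexp
      _ = (1 / 2) ^ (2 * m + j + 1) * ((2 : ℝ) ^ L j * (1 / 2) ^ L j) *
            ((2 : ℝ) ^ (32 * W) * (1 / 2) ^ (32 * W)) := by
          rw [pow_add _ _ (2 * m + j + 1), pow_add _ (L j + 1), pow_add _ (L j)]; ring
      _ = _ := by rw [← mul_pow, ← mul_pow]; norm_num
  refine (measureReal_mono sub (measure_ne_top _ _)).trans ((measureReal_biUnion_finset_le _ _).trans ?_)
  calc _ ≤ ∑ j ∈ Finset.range M, ((1 / 4 : ℝ) ^ m * ((1 / 2) ^ j * (1 / 2))) :=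
        Finset.sum_le_sum fun j _ => (measureReal_biUnion_finset_le _ _).trans (bound j)
    _ ≤ (1 / 4) ^ m * 1 := by
        rw [← Finset.mul_sum]
        gcongr
        rw [← Finset.sum_mul]
        have : ∀ M : ℕ, ∑ i ∈ Finset.range M, (1 / 2 : ℝ) ^ i ≤ 2 := fun M => by
          rw [geom_sum_eq (by norm_num)]
          have : (0 : ℝ) ≤ (1 / 2) ^ M := by positivity
          rw [show (1 / 2 : ℝ) - 1 = -(1 / 2) by norm_num, div_le_iff_of_neg (by norm_num)]
          linarith
        linarith [this M]
    _ ≤ _ := by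
        rw [mul_one, show (-(m : ℝ)) = m * (-1) by ring, Real.exp_nat_mul]
        gcongr
        rw [Real.exp_neg, one_div]
        apply inv_anti₀ (Real.exp_pos _)
        linarith [Real.exp_one_lt_d9]

end scp

section inst
open Classical

abbrev Om : Type := Bool × Fin (513 + 1)

noncomputable def wtO (p q δ : ℝ) (o : Om) : ℝ :=
  if o.2.val = 0 then q else if o.2.val = 513 then (if o.1 then p else 1 - p) - q - 512 * δ else δ

noncomputable def nuO (p q δ : ℝ) : Measure Om := ∑ o : Om, ENNReal.ofReal (wtO p q δ o) • Measure.dirac o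

theorem nuO_apply (p q δ : ℝ) (S : Set Om) :
    nuO p q δ S = ∑ o : Om, if o ∈ S then ENNReal.ofReal (wtO p q δ o) else 0 := by
  rw [nuO, Measure.coe_finset_sum, Finset.sum_apply]
  refine Finset.sum_congr rfl fun o _ => ?_
  rw [Measure.smul_apply, Measure.dirac_apply' _ (MeasurableSet.of_discrete)]
  by_cases h : o ∈ S <;> simp [h]

attribute [irreducible] nuO

theorem nuO_letter {p q δ : ℝ} (hq : 0 ≤ q) (hδ : 0 ≤ δ) (h1 : q + 512 * δ ≤ p)
    (h2 : q + 512 * δ ≤ 1 - p) (a : Bool) :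
    nuO p q δ {o | o.1 = a} = ENNReal.ofReal (if a then p else 1 - p) := by
  rw [nuO_apply]
  have h3 : 0 ≤ (if a then p else 1 - p) - q - 512 * δ := by split_ifs <;> linarith
  rw [Fintype.sum_prod_type, Finset.sum_eq_single a]
  · rw [Fin.sum_univ_succ, Fin.sum_univ_castSucc]
    have : ∀ i : Fin 512, wtO p q δ (a, i.castSucc.succ) = δ := by
      intro i
      have := i.2
      simp only [wtO, Fin.val_succ, Fin.val_castSucc]
      rw [if_neg (by omega), if_neg (by omega)]
    have e0 : wtO p q δ (a, 0) = q := by simp [wtO]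
    have e1 : wtO p q δ (a, (Fin.last 512).succ) = (if a then p else 1 - p) - q - 512 * δ := by simp [wtO]
    simp only [this, mem_setOf_eq, if_true, Finset.sum_const, Finset.card_univ,
      Fintype.card_fin, nsmul_eq_mul]
    rw [e0, e1, show ((512 : ℕ) : ENNReal) = ENNReal.ofReal 512 by simp, ← ENNReal.ofReal_mul (by norm_num),
      ← ENNReal.ofReal_add (by positivity) h3, ← ENNReal.ofReal_add hq (by positivity)]
    congr 1
    ring
  · intro b _ hb
    simp [hb]
  · simp

theorem nuO_map {p q δ : ℝ} (hq : 0 ≤ q) (hδ : 0 ≤ δ) (h1 : q + 512 * δ ≤ p)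
    (h2 : q + 512 * δ ≤ 1 - p) : (nuO p q δ).map (fun o : Om => o.1) = bernMeas p := by
  refine Measure.ext_of_singleton fun a => ?_
  rw [bernMeas_single, Measure.map_apply (measurable_of_countable _) (measurableSet_singleton _)]
  rw [← nuO_letter hq hδ h1 h2 a]
  congr 1

theorem nuO_prob {p q δ : ℝ} (hq : 0 ≤ q) (hδ : 0 ≤ δ) (h1 : q + 512 * δ ≤ p)
    (h2 : q + 512 * δ ≤ 1 - p) : IsProbabilityMeasure (nuO p q δ) := by
  have hm : Measurable (fun o : Om => o.1) := measurable_of_countable _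
  haveI : IsProbabilityMeasure (bernMeas p) := bernMeas_prob (by linarith) (by linarith)
  constructor
  rw [← preimage_univ (f := fun o : Om => o.1), ← Measure.map_apply hm MeasurableSet.univ,
    nuO_map hq hδ h1 h2]
  exact measure_univ

theorem nuO_single (p q δ : ℝ) (o : Om) : nuO p q δ {o} = ENNReal.ofReal (wtO p q δ o) := by
  rw [nuO_apply]; simp

noncomputable def pos3 {d : ℕ} (n : ℕ) (x : X3) : Vtx d := fun i =>
  if (i : ℕ) = 0 then n * x.1 else if (i : ℕ) = 1 then n * x.2.1 else if (i : ℕ) = 2 then n * (x.2.2 + 4) else 0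

def col8 (x : X3) : ℕ := (x.1 % 8).toNat + 8 * (x.2.1 % 8).toNat + 64 * (x.2.2 % 8).toNat

theorem far8 {n : ℕ} (hn : 2 ≤ n) {a b v w : ℤ} (hab : a ≠ b) (h8 : a % 8 = b % 8)
    (hv : |v - n * a| ≤ (3 * n : ℕ)) (hw : |w - n * b| ≤ (3 * n : ℕ)) : 2 ≤ |w - v| := by
  have : 8 ≤ |a - b| := by
    by_contra h
    rw [not_le, abs_lt] at h
    omega
  have h2 : 8 * (n : ℤ) ≤ |n * a - n * b| := by
    rw [← mul_sub, abs_mul, Nat.abs_cast]; nlinarith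
  push_cast at hv hw
  have hn' : (2 : ℤ) ≤ n := by exact_mod_cast hn
  rw [abs_le] at hv hw
  rcases le_abs'.1 h2 with h | h <;> rw [le_abs']
  · right; linarith
  · left; linarith

theorem pos_far {d : ℕ} (hd : 3 ≤ d) {n : ℕ} (hn : 2 ≤ n) {x y : X3} (hxy : x ≠ y)
    (hc : col8 x = col8 y) {v w : Vtx d} (hv : v ∈ ball (pos3 n x) (3 * n))
    (hw : w ∈ ball (pos3 n y) (3 * n)) : ∃ i, 2 ≤ |w i - v i| := by
  rw [mem_ball] at hv hw
  unfold col8 at hc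
  have h0 : x.1 % 8 = y.1 % 8 := by omega
  have h1 : x.2.1 % 8 = y.2.1 % 8 := by omega
  have h2 : x.2.2 % 8 = y.2.2 % 8 := by omega
  by_cases e0 : x.1 = y.1
  · by_cases e1 : x.2.1 = y.2.1
    · have e2 : x.2.2 ≠ y.2.2 := fun e => hxy (Prod.ext e0 (Prod.ext e1 e))
      refine ⟨⟨2, by omega⟩, far8 (a := x.2.2 + 4) (b := y.2.2 + 4) hn (by omega) (by omega) ?_ ?_⟩
      · simpa [pos3] using hv ⟨2, by omega⟩
      · simpa [pos3] using hw ⟨2, by omega⟩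
    · refine ⟨⟨1, by omega⟩, far8 hn e1 h1 ?_ ?_⟩
      · simpa [pos3] using hv ⟨1, by omega⟩
      · simpa [pos3] using hw ⟨1, by omega⟩
  · refine ⟨⟨0, by omega⟩, far8 hn e0 h0 ?_ ?_⟩
    · simpa [pos3] using hv ⟨0, by omega⟩
    · simpa [pos3] using hw ⟨0, by omega⟩

theorem pos_nb {d : ℕ} (hd : 3 ≤ d) (n : ℕ) {x y : X3} (h : nb3 y x) :
    ∃ (i : Fin d) (σ : ℤˣ), pos3 n x i = pos3 n y i + σ * n ∧ ∀ j ≠ i, (pos3 n x j : ℤ) = pos3 n y j := by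
  obtain ⟨y0, y1, y2⟩ := y
  obtain ⟨x0, x1, x2⟩ := x
  unfold nb3 at h
  simp only at h
  have key : ((x0 = y0 + 1 ∨ x0 = y0 - 1) ∧ x1 = y1 ∧ x2 = y2) ∨
    (x0 = y0 ∧ (x1 = y1 + 1 ∨ x1 = y1 - 1) ∧ x2 = y2) ∨
    (x0 = y0 ∧ x1 = y1 ∧ (x2 = y2 + 1 ∨ x2 = y2 - 1)) := by
    rcases abs_cases (y0 - x0) with a | a <;> rcases abs_cases (y1 - x1) with b | b <;>
      rcases abs_cases (y2 - x2) with c | c <;> omega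
  clear h
  rcases key with ⟨h | h, rfl, rfl⟩ | ⟨rfl, h | h, rfl⟩ | ⟨rfl, rfl, h | h⟩
  · refine ⟨⟨0, by omega⟩, 1, by subst h; simp [pos3]; ring, fun j hj => ?_⟩
    have : (j : ℕ) ≠ 0 := fun e => hj (Fin.ext e)
    simp [pos3, this]
  · refine ⟨⟨0, by omega⟩, -1, by subst h; simp [pos3]; ring, fun j hj => ?_⟩
    have : (j : ℕ) ≠ 0 := fun e => hj (Fin.ext e)
    simp [pos3, this]
  · refine ⟨⟨1, by omega⟩, 1, by subst h; simp [pos3]; ring, fun j hj => ?_⟩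
    have : (j : ℕ) ≠ 1 := fun e => hj (Fin.ext e)
    simp [pos3, this]
  · refine ⟨⟨1, by omega⟩, -1, by subst h; simp [pos3]; ring, fun j hj => ?_⟩
    have : (j : ℕ) ≠ 1 := fun e => hj (Fin.ext e)
    simp [pos3, this]
  · refine ⟨⟨2, by omega⟩, 1, by subst h; simp [pos3]; ring, fun j hj => ?_⟩
    have : (j : ℕ) ≠ 2 := fun e => hj (Fin.ext e)
    simp [pos3, this]
  · refine ⟨⟨2, by omega⟩, -1, by subst h; simp [pos3]; ring, fun j hj => ?_⟩
    have : (j : ℕ) ≠ 2 := fun e => hj (Fin.ext e)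
    simp [pos3, this]

theorem exists_eng {d : ℕ} (hd : 3 ≤ d) {p q : ℝ} (hq0 : 0 < q) (hqp : q < p) (hqp' : q < 1 - p)
    (hC1 : ∀ η : ℝ, 0 < η → ∃ m : ℕ, ∀ n, m ≤ n →
      1 - η ≤ pr (fun _ => q) (ball (0 : Vtx d) n) (Conn m n)) :
    ∃ (E : Eng (Vtx d) X3 Om) (n : ℕ), E.g = adj ∧ E.lt = (fun o => o.1) ∧
      E.ν.map (fun o : Om => o.1) = bernMeas p ∧ E.ε = (1 / 768) ^ 192 ∧ (∀ x y, nb3 x y → E.nb x y) ∧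
      1 ≤ E.N ∧ 2 ≤ n ∧ (∀ x, E.Reg x = ball (pos3 n x) (3 * n)) ∧
      (∀ x A, (((ball (pos3 n x) n : Finset (Vtx d)) : Set (Vtx d))) ⊆ A → E.Seed x A) ∧
      (∀ x A, E.Seed x A → ∃ v ∈ A, n * (x.1 - 1) + 1 ≤ v ⟨0, by omega⟩) := by
  obtain ⟨δ, hδ0, hδq, hδ1, hδ2⟩ : ∃ δ : ℝ, 0 < δ ∧ δ ≤ q ∧ q + 512 * δ ≤ p ∧ q + 512 * δ ≤ 1 - p := by
    refine ⟨min q (min ((p - q) / 512) ((1 - p - q) / 512)), ?_, min_le_left _ _, ?_, ?_⟩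
    · have h1 : 0 < (p - q) / 512 := by apply div_pos <;> linarith
      have h2 : 0 < (1 - p - q) / 512 := by apply div_pos <;> linarith
      positivity
    · have := (min_le_right q (min ((p - q) / 512) ((1 - p - q) / 512))).trans (min_le_left _ _)
      linarith
    · have := (min_le_right q (min ((p - q) / 512) ((1 - p - q) / 512))).trans (min_le_right _ _)
      linarith
  obtain ⟨m, n, hmn, G⟩ := GMstep (d := d) (ε := (1 / 768) ^ 192) (by omega) (by linarith : q < 1) hδ0 hδq hC1
    (by positivity)
  set n' := n + m + 1 with hn'
  let E : Eng (Vtx d) X3 Om :=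
    { g := adj
      lt := fun o => o.1
      ν := nuO p q δ
      prob := nuO_prob hq0.le hδ0.le hδ1 hδ2
      Q0 := fun a => {((a, 0) : Om)}
      Qc := fun a c => {o | ∃ h : c < 512, o = (a, ⟨c + 1, by omega⟩)}
      Reg := fun x => ball (pos3 n' x) (3 * n')
      col := col8
      nb := nb3
      Seed := fun x A => ∃ u : Vtx d, (∀ i, |u i - pos3 n' x i| ≤ n) ∧ (ball u m : Set (Vtx d)) ⊆ A
      q := q
      δ := δ
      ε := (1 / 768) ^ 192
      N := (2 * (3 * n') + 1) ^ d
      Q0l := by rintro a o rfl; rfl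
      Qcl := by rintro a c o ⟨h, rfl⟩; rfl
      Q0m := by
        intro a
        rw [measureReal_def, nuO_single, ENNReal.toReal_ofReal] <;> simp [wtO, hq0.le]
      Qcm := by
        intro a c hc
        have : {o : Om | ∃ h : c < 512, o = (a, ⟨c + 1, by omega⟩)} = {((a, ⟨c + 1, by omega⟩) : Om)} := by
          ext o; simp [hc]
        have hw : wtO p q δ ((a, ⟨c + 1, by omega⟩) : Om) = δ := by
          simp only [wtO]
          rw [if_neg (by omega), if_neg (by omega)]
        rw [this, measureReal_def, nuO_single, hw, ENNReal.toReal_ofReal hδ0.le]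
      dj0 := by
        intro a b c
        rw [Set.disjoint_left]
        rintro o rfl ⟨h, h'⟩
        have := congrArg Prod.snd h'
        simp at this
      djc := by
        intro a b c c' hc
        rw [Set.disjoint_left]
        rintro o ⟨h, rfl⟩ ⟨h', h''⟩
        have := congrArg Prod.snd h''
        simp at this
        exact hc this
      colt := by intro x; unfold col8; omega
      coldj := by
        intro x y hxy hc v hv w hw
        obtain ⟨i, hi⟩ := pos_far hd (by omega : 2 ≤ n') hxy hc hv hw
        refine ⟨?_, fun h => ?_⟩
        · rintro rfl; simp at hi
        · have := adj_le h i; omega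
      regc := fun x => (card_ball _ _).le
      seedm := fun x A B hAB ⟨u, h1, h2⟩ => ⟨u, h1, h2.trans hAB⟩
      hδ := hδ0.le
      hδq := hδq
      hε := by positivity
      gm := by
        rintro x y A hyx ⟨u, hu, huA⟩
        obtain ⟨i, σ, hi, hj⟩ := pos_nb hd n' hyx
        let s : Fin d → ℤˣ := fun j => if j = i then σ else if u j ≤ pos3 n' y j then 1 else -1
        have hr : ∀ v, δ ≤ (if ∃ a ∈ A, adj a v then δ else q) ∧ (if ∃ a ∈ A, adj a v then δ else q) ≤ 1 := by
          intro v; split_ifs <;> constructor <;> linarith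
        refine (G u i s A (fun v => if ∃ a ∈ A, adj a v then δ else q)
          ((ball (pos3 n' x) (3 * n')).filter (fun v => v ∉ A)) huA (fun v _ => (hr v).1) (fun v _ => (hr v).2)
          ?_ ?_).trans (pr_mono (fun v _ => hδ0.le.trans (hr v).1) (fun v _ => (hr v).2) ?_)
        · intro v _ _ hv
          rw [if_neg]
          push Not; exact hv
        · intro v hv hvA
          rw [Finset.mem_filter]
          refine ⟨?_, hvA⟩
          rw [mem_ball] at hv ⊢
          intro j
          have h1 := hv j
          have h2 := hu j
          have h3 : |pos3 n' y j - pos3 n' x j| ≤ n' := by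
            by_cases hji : j = i
            · subst hji
              rw [hi]
              rcases Int.units_eq_one_or σ with rfl | rfl <;> simp
            · rw [hj j hji]; simp
          rw [abs_le] at h1 h2 h3 ⊢
          push_cast [hn'] at *
          constructor <;> linarith
        · rintro O - ⟨u', h1, h2, h3⟩
          refine ⟨u', fun j => ?_, fun v hv => h1 v hv⟩
          have h4 := hu j
          by_cases hji : j = i
          · subst hji
            have : s j = σ := by simp [s]
            rw [this] at h2
            rw [h2, hi]
            push_cast [hn']
            convert h4 using 2
            ring
          · have h5 := h3 j hji
            rw [hj j hji]
            rw [abs_le] at h4 ⊢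
            by_cases hle : u j ≤ pos3 n' y j
            · have : s j = 1 := by simp [s, hji, hle]
              rw [this] at h5
              push_cast at h5
              constructor <;> linarith
            · have : s j = -1 := by simp [s, hji, hle]
              rw [this] at h5
              push_cast at h5
              constructor <;> linarith }
  refine ⟨E, n', rfl, rfl, nuO_map hq0.le hδ0.le hδ1 hδ2, rfl, fun _ _ h => h, Nat.one_le_pow _ _ (by omega), by omega,
    fun _ => rfl, ?_, ?_⟩
  · intro x A hA
    refine ⟨pos3 n' x, by simp, fun v hv => hA ?_⟩
    rw [Finset.mem_coe, mem_ball] at hv ⊢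
    intro i
    exact (hv i).trans (by omega)
  · rintro x A ⟨u, hu, hA⟩
    refine ⟨u, hA ?_, ?_⟩
    · rw [Finset.mem_coe, mem_ball]; simp
    · have := hu ⟨0, by omega⟩
      simp only [pos3, if_true] at this
      rw [abs_le] at this
      have e : (n' : ℤ) = n + m + 1 := by push_cast [hn']; ring
      rw [e] at this ⊢
      nlinarith [this.1]

end inst

section kon
open Classical
variable {d : ℕ}

def Zp (B A : Set (Vtx d)) (ω : Config d) (ξ : ℕ → Bool) (L : ℕ) : Set (ℕ → Vtx d) :=
  {γ | γ 0 ∈ B ∧ (∀ i ≤ L, ∀ j ≤ L, γ i = γ j → i = j) ∧ (∀ i < L, adj (γ i) (γ (i + 1))) ∧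
    (∀ i ≤ L, γ i ∈ A) ∧ ∀ i ≤ L, ω (γ i) = ξ i}

theorem Zp_anti {B A : Set (Vtx d)} {ω : Config d} {ξ : ℕ → Bool} {L L' : ℕ} (h : L ≤ L') :
    Zp B A ω ξ L' ⊆ Zp B A ω ξ L := by
  rintro γ ⟨h1, h2, h3, h4, h5⟩
  exact ⟨h1, fun i hi j hj => h2 i (hi.trans h) j (hj.trans h), fun i hi => h3 i (hi.trans_le h),
    fun i hi => h4 i (hi.trans h), fun i hi => h5 i (hi.trans h)⟩

theorem Zp_congr {B A : Set (Vtx d)} {ω : Config d} {ξ ξ' : ℕ → Bool} {L : ℕ} {γ γ' : ℕ → Vtx d}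
    (hξ : ∀ i ≤ L, ξ i = ξ' i) (hγ : ∀ i ≤ L, γ i = γ' i) (h : γ ∈ Zp B A ω ξ L) : γ' ∈ Zp B A ω ξ' L := by
  obtain ⟨h1, h2, h3, h4, h5⟩ := h
  refine ⟨hγ 0 (Nat.zero_le _) ▸ h1, fun i hi j hj => ?_, fun i hi => ?_, fun i hi => ?_, fun i hi => ?_⟩
  · rw [← hγ i hi, ← hγ j hj]; exact h2 i hi j hj
  · rw [← hγ i hi.le, ← hγ (i + 1) hi]; exact h3 i hi
  · rw [← hγ i hi]; exact h4 i hi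
  · rw [← hγ i hi, ← hξ i hi]; exact h5 i hi

theorem konig {B A : Set (Vtx d)} {R : ℕ} (hB : B ⊆ (ball 0 R : Finset (Vtx d))) {ω : Config d} {ξ : ℕ → Bool}
    (h : ∀ L, (Zp B A ω ξ L).Nonempty) : ∃ x ∈ B, seesWordIn ω ξ A x := by
  set S : Set (ℕ → Vtx d) := Set.pi univ (fun i => ((ball 0 (R + i) : Finset (Vtx d)) : Set (Vtx d))) with hS
  have hcS : IsCompact S := isCompact_univ_pi fun i => (Finset.finite_toSet _).isCompact
  have hcl : ∀ L, IsClosed (Zp B A ω ξ L) := by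
    intro L
    have c1 : ∀ (i : ℕ) (P : Vtx d → Prop), IsClosed {γ : ℕ → Vtx d | P (γ i)} := fun i P =>
      (isClosed_discrete {x | P x}).preimage (continuous_apply i)
    have c2 : ∀ (i j : ℕ) (P : Vtx d → Vtx d → Prop), IsClosed {γ : ℕ → Vtx d | P (γ i) (γ j)} := by
      intro i j P
      have hc : Continuous (fun γ : ℕ → Vtx d => (γ i, γ j)) := by fun_prop
      exact (isClosed_discrete {x : Vtx d × Vtx d | P x.1 x.2}).preimage hc
    have : Zp B A ω ξ L = {γ | γ 0 ∈ B} ∩ ((⋂ i, ⋂ (_ : i ≤ L), ⋂ j, ⋂ (_ : j ≤ L), {γ | γ i = γ j → i = j}) ∩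
      ((⋂ i, ⋂ (_ : i < L), {γ | adj (γ i) (γ (i + 1))}) ∩ ((⋂ i, ⋂ (_ : i ≤ L), {γ | γ i ∈ A}) ∩
        ⋂ i, ⋂ (_ : i ≤ L), {γ | ω (γ i) = ξ i}))) := by
      ext γ; simp [Zp]
    rw [this]
    refine (c1 _ _).inter (IsClosed.inter ?_ (IsClosed.inter ?_ (IsClosed.inter ?_ ?_)))
    · exact isClosed_iInter fun i => isClosed_iInter fun _ => isClosed_iInter fun j => isClosed_iInter fun _ =>
        c2 i j (fun x y => x = y → i = j)
    · exact isClosed_iInter fun i => isClosed_iInter fun _ => c2 i (i + 1) adj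
    · exact isClosed_iInter fun i => isClosed_iInter fun _ => c1 i (· ∈ A)
    · exact isClosed_iInter fun i => isClosed_iInter fun _ => c1 i (fun x => ω x = ξ i)
  have hne : ∀ L, (S ∩ Zp B A ω ξ L).Nonempty := by
    intro L
    obtain ⟨γ, hγ⟩ := h L
    have hb : ∀ i ≤ L, γ i ∈ ball 0 (R + i) := by
      intro i
      induction i with
      | zero => intro _; exact hB hγ.1
      | succ i ih =>
        intro hi
        have h1 := ih (by omega)
        have h2 := hγ.2.2.1 i (by omega)
        rw [mem_ball] at h1 ⊢
        intro j
        have h3 := h1 j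
        have h4 := adj_le h2 j
        push_cast at h3 ⊢
        rw [abs_le] at h3 h4 ⊢
        constructor <;> linarith
    refine ⟨fun i => γ (min i L), fun i _ => ?_, Zp_congr (fun _ _ => rfl) (fun i hi => by simp [hi]) hγ⟩
    have := hb (min i L) (min_le_right _ _)
    show _ ∈ ball 0 (R + i)
    rw [mem_ball] at this ⊢
    intro j
    refine (this j).trans ?_
    have : min i L ≤ i := min_le_left _ _
    exact_mod_cast Nat.add_le_add_left this R
  obtain ⟨γ, hγ⟩ := IsCompact.nonempty_iInter_of_sequence_nonempty_isCompact_isClosed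
    (fun L => S ∩ Zp B A ω ξ L) (fun L => inter_subset_inter_right _ (Zp_anti (Nat.le_succ L))) hne
    (hcS.inter_right (hcl 0)) (fun L => hcS.isClosed.inter (hcl L))
  rw [mem_iInter] at hγ
  have hz := fun L => (hγ L).2
  refine ⟨γ 0, (hz 0).1, γ, rfl, fun i j hij => ?_, fun i => (hz (i + 1)).2.2.1 i (by omega),
    fun i => (hz i).2.2.2.1 i le_rfl, fun i => (hz i).2.2.2.2 i le_rfl⟩
  exact (hz (i + j)).2.1 i (by omega) j (by omega) hij

def BadL (B A : Set (Vtx d)) (L : ℕ) : Set (Config d) := {ω | ∃ ξ, ¬ (Zp B A ω ξ L).Nonempty}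

theorem BadL_mono (B A : Set (Vtx d)) : Monotone (BadL B A) := by
  rintro L L' h ω ⟨ξ, hξ⟩
  exact ⟨ξ, fun hn => hξ (hn.mono (Zp_anti h))⟩

theorem BadL_meas (B A : Set (Vtx d)) (L : ℕ) : MeasurableSet (BadL B A L) := by
  have : BadL B A L = ⋃ e : Fin (L + 1) → Bool, ⋂ c : Fin (L + 1) → Vtx d,
      {ω | ¬ ((fun i => c (Fin.ofNat (L + 1) i)) ∈ Zp B A ω (fun i => e (Fin.ofNat (L + 1) i)) L)} := by
    have hm : ∀ i ≤ L, i % (L + 1) = i := fun i hi => Nat.mod_eq_of_lt (by omega)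
    ext ω
    simp only [BadL, mem_setOf_eq, mem_iUnion, mem_iInter]
    constructor
    · rintro ⟨ξ, h⟩
      refine ⟨fun i => ξ i, fun c hc => h ⟨_, Zp_congr (fun i hi => ?_) (fun i hi => rfl) hc⟩⟩
      simp [hm i hi]
    · rintro ⟨e, he⟩
      refine ⟨_, fun ⟨γ, hγ⟩ => he (fun i => γ i) (Zp_congr (fun i hi => rfl) (fun i hi => ?_) hγ)⟩
      simp [hm i hi]
  rw [this]
  refine MeasurableSet.iUnion fun e => MeasurableSet.iInter fun c => MeasurableSet.compl ?_
  set γ : ℕ → Vtx d := (fun i => c (Fin.ofNat (L + 1) i))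
  set ξ : ℕ → Bool := (fun i => e (Fin.ofNat (L + 1) i))
  have : {ω | γ ∈ Zp B A ω ξ L} = {ω | γ 0 ∈ B ∧ (∀ i ≤ L, ∀ j ≤ L, γ i = γ j → i = j) ∧
    (∀ i < L, adj (γ i) (γ (i + 1))) ∧ (∀ i ≤ L, γ i ∈ A)} ∩ ⋂ i, ⋂ (_ : i ≤ L), {ω | ω (γ i) = ξ i} := by
    ext ω; simp only [Zp, mem_setOf_eq, mem_inter_iff, mem_iInter]; tauto
  show MeasurableSet {ω | γ ∈ Zp B A ω ξ L}
  rw [this]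
  refine (MeasurableSet.const _).inter (MeasurableSet.iInter fun i => MeasurableSet.iInter fun _ => ?_)
  have hm : Measurable (fun ω : Config d => ω (γ i)) := measurable_pi_apply (γ i)
  exact hm (measurableSet_singleton (ξ i))

end kon

section fin
open Classical
variable {d : ℕ}

def W0 (d k h K : ℕ) : Set (Vtx d) := {v | v ∈ slabS d k h ∧ ∀ i : Fin d, (i : ℕ) ≤ 1 → |v i| < K}

noncomputable def s0 (d k h K w H : ℕ) : St (Vtx d) X3 Om where
  lab := fun v => if v ∈ W0 d k h K then some 0 else none
  C := fun _ => univ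
  alive := {x | x.1 = 0 ∧ 0 ≤ x.2.1 ∧ x.2.1 < 16 * w ∧ 0 ≤ x.2.2 ∧ x.2.2 < 32 * H}
  bad := ∅

theorem bdry_of {k h n : ℕ} {v w : Vtx d} (hk : 1 ≤ k) (hvw : adj w v) (hv : v ∈ slabS d k h)
    (hw : w ∈ W0 d k h (k * n)) (hv' : v ∉ W0 d k h (k * n)) : v ∈ lamBdry d k h n := by
  have : ∃ i : Fin d, (i : ℕ) ≤ 1 ∧ (k * n : ℕ) ≤ |v i| := by
    by_contra hc
    push Not at hc
    exact hv' ⟨hv, hc⟩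
  obtain ⟨i, hi, hki⟩ := this
  have hbd : ∀ j : Fin d, (j : ℕ) ≤ 1 → |v j| ≤ k * n := by
    intro j hj
    have h1 := hw.2 j hj
    have h2 := adj_le hvw j
    push_cast at h1
    rw [abs_lt] at h1
    rw [abs_le] at h2 ⊢
    constructor <;> linarith
  push_cast at hki
  refine ⟨⟨hv, hbd⟩, ?_⟩
  have hslab : ∀ a, Function.update v i a ∈ slabS d k h := by
    intro a j
    have hji : ((j : ℕ) = 2 ∨ 3 ≤ (j : ℕ)) → j ≠ i := by rintro h rfl; omega
    constructor
    · intro h2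
      rw [Function.update_of_ne (hji (.inl h2))]; exact (hv j).1 h2
    · intro h2
      rw [Function.update_of_ne (hji (.inr h2))]; exact (hv j).2 h2
  rcases le_abs'.1 hki with h | h
  · refine ⟨Function.update v i (v i - 1), adj_update v i (.inr rfl), hslab _, fun hc => ?_⟩
    have := hc.2 i hi
    rw [Function.update_self, abs_le] at this
    linarith
  · refine ⟨Function.update v i (v i + 1), adj_update v i (.inl rfl), hslab _, fun hc => ?_⟩
    have := hc.2 i hi
    rw [Function.update_self, abs_le] at this
    linarith

theorem bdry_ball {k h n : ℕ} : lamBdry d k h n ⊆ (ball 0 (k * n + h * k + k) : Finset (Vtx d)) := by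
  rintro v ⟨⟨h1, h2⟩, -⟩
  rw [Finset.mem_coe, mem_ball]
  intro i
  simp only [Pi.zero_apply, sub_zero]
  push_cast
  have a1 : (0 : ℤ) ≤ k * n := by positivity
  have a2 : (0 : ℤ) ≤ h * k := by positivity
  have a3 : (0 : ℤ) ≤ k := by positivity
  by_cases c : (i : ℕ) ≤ 1
  · linarith [h2 i c]
  · rw [abs_le]
    by_cases c2 : (i : ℕ) = 2
    · have := (h1 i).1 c2
      constructor <;> linarith
    · have := (h1 i).2 (by omega)
      constructor <;> linarith

/-- labels give words -/
theorem lab_path {E : Eng (Vtx d) X3 Om} {Win : Finset X3} {k h n w H : ℕ} (hk : 1 ≤ k)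
    (hg : E.g = adj) (hlt : E.lt = fun o => o.1)
    (hR : ∀ x ∈ Win, ∀ v ∈ E.Reg x, v ∈ slabS d k h) {ξ : ℕ → Bool} {s : St (Vtx d) X3 Om}
    (hs : Snd E Win (s0 d k h (k * n) w H) ξ s) {u : Vtx d → Om} (hu : u ∈ cyl s.C) :
    ∀ l v, s.lab v = some (l + 1) → ∃ γ : ℕ → Vtx d, γ l = v ∧ (∀ i ≤ l, s.lab (γ i) = some (i + 1)) ∧
      γ ∈ Zp (lamBdry d k h n) (slabS d k h) (fun v => (u v).1) ξ l := by
  suffices H : ∀ l v, s.lab v = some (l + 1) → ∃ γ : ℕ → Vtx d, γ l = v ∧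
      (∀ i ≤ l, s.lab (γ i) = some (i + 1)) ∧ γ 0 ∈ lamBdry d k h n ∧ (∀ i < l, adj (γ i) (γ (i + 1))) ∧
      (∀ i ≤ l, γ i ∈ slabS d k h) ∧ ∀ i ≤ l, (u (γ i)).1 = ξ i by
    intro l v hv
    obtain ⟨γ, h1, h2, h3, h4, h5, h6⟩ := H l v hv
    refine ⟨γ, h1, h2, h3, fun i hi j hj hij => ?_, h4, h5, h6⟩
    have := h2 i hi
    rw [hij, h2 j hj] at this
    simpa using this.symm
  intro l
  induction l with
  | zero =>
    intro v hv
    obtain ⟨⟨x, hx, hvx⟩, hn, w', hwv, hw, ho⟩ := hs.a v 0 hv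
    rw [hg] at hwv
    rw [hlt] at ho
    have hvS := hR x hx v hvx
    have hb := hs.b w' hw
    have hw0 : w' ∈ W0 d k h (k * n) := by
      by_contra hc; simp [s0, hc] at hb
    have hv0 : v ∉ W0 d k h (k * n) := by
      intro hc; simp [s0, hc] at hn
    have hl := ho _ (hu v)
    refine ⟨fun _ => v, rfl, ?_, bdry_of hk hwv hvS hw0 hv0, ?_, fun _ _ => hvS, ?_⟩
    · intro i hi; obtain rfl : i = 0 := by omega
      exact hv
    · intro i hi; omega
    · intro i hi; obtain rfl : i = 0 := by omega
      exact hl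
  | succ l ih =>
    intro v hv
    obtain ⟨⟨x, hx, hvx⟩, hn, w', hwv, hw, ho⟩ := hs.a v (l + 1) hv
    rw [hg] at hwv
    rw [hlt] at ho
    have hvS := hR x hx v hvx
    have hl := ho _ (hu v)
    obtain ⟨γ, h1, h2, h3, h4, h5, h6⟩ := ih w' hw
    have c : ∀ i, i ≤ l + 1 → i ≤ l ∨ i = l + 1 := by intro i hi; omega
    refine ⟨fun i => if i ≤ l then γ i else v, by simp, ?_, by simpa using h3, ?_, ?_, ?_⟩
    · intro i hi
      rcases c i hi with h | rfl
      · simpa [h] using h2 i h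
      · simpa using hv
    · intro i hi
      by_cases hil : i + 1 ≤ l
      · have : i ≤ l := by omega
        simpa [hil, this] using h4 i (by omega)
      · obtain rfl : i = l := by omega
        simpa [h1] using hwv
    · intro i hi
      rcases c i hi with h | rfl
      · simpa [h] using h5 i h
      · simpa using hvS
    · intro i hi
      rcases c i hi with h | rfl
      · simpa [h] using h6 i h
      · simpa using hl

theorem lab_far {E : Eng (Vtx d) X3 Om} {Win : Finset X3} {k h K w H : ℕ} (hd : 3 ≤ d)
    (hg : E.g = adj) {ξ : ℕ → Bool} {s : St (Vtx d) X3 Om}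
    (hs : Snd E Win (s0 d k h K w H) ξ s) :
    ∀ (l : ℕ) v, s.lab v = some l → v ⟨0, by omega⟩ ≤ K + l := by
  intro l
  induction l with
  | zero =>
    intro v hv
    have hb := hs.b v hv
    have hw0 : v ∈ W0 d k h K := by
      by_contra hc; simp [s0, hc] at hb
    have := hw0.2 ⟨0, by omega⟩ (by simp)
    rw [abs_lt] at this
    push_cast
    linarith
  | succ l ih =>
    intro v hv
    obtain ⟨-, -, w', hwv, hw, -⟩ := hs.a v l hv
    rw [hg] at hwv
    have h1 := ih w' hw
    have h2 := adj_le hwv ⟨0, by omega⟩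
    rw [abs_le] at h2
    push_cast
    linarith

theorem slab_reg {n H k : ℕ} (hn : 2 ≤ n) (hH1 : 1 ≤ H) (hk : k = n * (32 * H + 2)) (x : X3) (hx1 : 0 ≤ x.2.2)
    (hx2 : x.2.2 < 32 * H) (v : Vtx d) (hv : v ∈ ball (pos3 n x) (3 * n)) : v ∈ (slabS d k 10 : Set (Vtx d)) := by
  intro i
  have hn0 : (2 : ℤ) ≤ n := by exact_mod_cast hn
  have hH0 : (1 : ℤ) ≤ H := by exact_mod_cast hH1
  have hkz : (k : ℤ) = 32 * (n * H) + 2 * n := by rw [hk]; push_cast; ring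
  have hnH : (n : ℤ) ≤ n * H := by nlinarith
  rw [mem_ball] at hv
  have h1 := hv i
  push_cast at h1
  rw [abs_le] at h1
  have hz : (n : ℤ) * x.2.2 ≤ n * (32 * H) := by gcongr
  have hz0 : 0 ≤ (n : ℤ) * x.2.2 := by positivity
  rw [hkz]
  constructor
  · intro h2
    have e : (pos3 n x : Vtx d) i = n * (x.2.2 + 4) := by simp [pos3, h2]
    rw [e] at h1
    push_cast
    constructor <;> linarith
  · intro h2
    have e : (pos3 n x : Vtx d) i = 0 := by
      simp only [pos3]
      rw [if_neg (by omega), if_neg (by omega), if_neg (by omega)]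
    rw [e] at h1
    constructor <;> linarith

theorem ini_s0 {E : Eng (Vtx d) X3 Om} {n : ℕ} (hn : 2 ≤ n)
    (hS1 : ∀ x A, (((ball (pos3 n x) n : Finset (Vtx d)) : Set (Vtx d))) ⊆ A → E.Seed x A)
    {H k m : ℕ} (hH1 : 1 ≤ H) (hk : k = n * (32 * H + 2)) (hm : 1 ≤ m) :
    E.Ini (s0 d k 10 (k * (m + 1)) (H * m) H) := by
  have hn0 : (2 : ℤ) ≤ n := by exact_mod_cast hn
  have hKz : ((k * (m + 1) : ℕ) : ℤ) = 32 * (n * (H * m)) + 32 * (n * H) + 2 * (n * m) + 2 * n := by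
    rw [hk]; push_cast; ring
  have p1 : (0 : ℤ) ≤ n * (H * m) := by positivity
  have p2 : (0 : ℤ) ≤ n * H := by positivity
  have p3 : (0 : ℤ) ≤ n * m := by positivity
  refine ⟨⟨⟨∅, fun _ _ => rfl⟩, fun _ _ _ => rfl, fun _ _ _ _ _ _ _ => subset_univ _, ?_, fun _ _ h => h⟩,
    fun _ => rfl, rfl, ?_⟩
  · rintro x ⟨h0, h1, h2, h3, h4⟩
    apply hS1
    intro v hv
    have hv3 : v ∈ ball (pos3 n x) (3 * n) := by
      rw [Finset.mem_coe, mem_ball] at hv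
      rw [mem_ball]
      intro i
      refine (hv i).trans ?_
      push_cast
      linarith
    have : v ∈ W0 d k 10 (k * (m + 1)) := by
      refine ⟨slab_reg hn hH1 hk x h3 h4 v hv3, fun i hi => ?_⟩
      rw [Finset.mem_coe, mem_ball] at hv
      have hvi := hv i
      rw [hKz]
      rw [abs_le] at hvi
      rw [abs_lt]
      rcases (by omega : (i : ℕ) = 0 ∨ (i : ℕ) = 1) with hi0 | hi1
      · have e : (pos3 n x : Vtx d) i = 0 := by simp [pos3, hi0, h0]
        rw [e] at hvi
        constructor <;> linarith
      · have e : (pos3 n x : Vtx d) i = n * x.2.1 := by simp [pos3, hi1]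
        rw [e] at hvi
        push_cast at h2
        have hz : (n : ℤ) * x.2.1 ≤ n * (16 * (H * m)) := by gcongr
        have hz0 : 0 ≤ (n : ℤ) * x.2.1 := by positivity
        constructor <;> linarith
    show (s0 d k 10 (k * (m + 1)) (H * m) H).lab v ≠ none
    simp [s0, this]
  · intro v j hj
    simp only [s0] at hj
    split_ifs at hj with hc
    simpa using hj.symm

theorem bad_prob {E : Eng (Vtx d) X3 Om} {n : ℕ} (hd : 3 ≤ d) (hg : E.g = adj) (hlt : E.lt = fun o => o.1)
    (hε : E.ε = (1 / 768) ^ 192) (hnb : ∀ x y, nb3 x y → E.nb x y) (hN : 1 ≤ E.N) (hn : 2 ≤ n)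
    (hReg : ∀ x, E.Reg x = ball (pos3 n x) (3 * n))
    (hS1 : ∀ x A, (((ball (pos3 n x) n : Finset (Vtx d)) : Set (Vtx d))) ⊆ A → E.Seed x A)
    (hS2 : ∀ x A, E.Seed x A → ∃ v ∈ A, n * (x.1 - 1) + 1 ≤ v ⟨0, by omega⟩)
    {H k m : ℕ} (hH : H = 196608 * E.N) (hk : k = n * (32 * H + 2)) (hm : 1 ≤ m) (L : ℕ) :
    (PM (Vtx d) E.ν).real ((fun (u : Vtx d → Om) v => (u v).1) ⁻¹'
      BadL (lamBdry d k 10 (m + 1)) (slabS d k 10) L) ≤ Real.exp (-m) := by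
  haveI := E.prob
  set w := H * m with hw
  set K := k * (m + 1) with hK
  set M := K + L + 2 with hM
  set Win : Finset X3 := (Finset.Icc (0 : ℤ) (sa w H M)) ×ˢ ((Finset.Ico (0 : ℤ) (32 * (2 ^ M * w : ℕ))) ×ˢ
    (Finset.Ico (0 : ℤ) (32 * H))) with hWin
  have hH1 : 1 ≤ H := by omega
  have hk1 : 1 ≤ k := by rw [hk]; exact Nat.mul_pos (by omega) (by omega)
  have hn0 : (2 : ℤ) ≤ n := by exact_mod_cast hn
  have hslab := slab_reg (d := d) hn hH1 hk
  have hini : E.Ini (s0 d k 10 K w H) := ini_s0 hn hS1 hH1 hk hm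
  refine (measureReal_mono ?_ (measure_ne_top _ _)).trans (scales_prob (Win := Win) (M := M) hini hnb hε hN hH hm hw ?_ ?_)
  · rintro u ⟨ξ, hξ⟩
    refine ⟨ξ, fun x hx => ?_⟩
    by_contra hc
    rw [not_lt] at hc
    apply hξ
    generalize 1024 * sa w H M = ρ at hx
    have ok := st_ok (Win := Win) hini ξ ρ u
    have sd := (st_snd (Win := Win) hini ξ ρ u).1
    obtain ⟨v, hv, hv0⟩ := hS2 x _ (ok.1.i3 x hx)
    obtain ⟨l, hl⟩ := Option.ne_none_iff_exists'.1 (show _ ≠ none from hv)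
    have hf := lab_far hd hg sd l v hl
    have hlL : L + 2 ≤ l := by
      have : (M : ℤ) ≤ n * (x.1 - 1) + 1 := by
        have hM' : (2 : ℤ) ≤ M := by rw [hM]; push_cast; linarith
        nlinarith
      have e : (M : ℤ) = K + L + 2 := by rw [hM]; push_cast; ring
      have : (L : ℤ) + 2 ≤ l := by linarith
      exact_mod_cast this
    obtain ⟨l, rfl⟩ : ∃ l', l = l' + 1 := ⟨l - 1, by omega⟩
    obtain ⟨γ, -, -, hγ⟩ := lab_path hk1 hg hlt (by
      intro x hx v hv
      rw [hReg] at hv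
      simp only [hWin, Finset.mem_product, Finset.mem_Ico] at hx
      exact hslab x hx.2.2.1 hx.2.2.2 v hv) sd ok.2 l v hl
    exact ⟨γ, Zp_anti (by omega) hγ⟩
  · intro y z h1 h2 h3 h4
    exact ⟨rfl, h1, h2, h3, h4⟩
  · intro x y z h1 h2 h3 h4 h5 h6
    simp only [hWin, Finset.mem_product, Finset.mem_Ico, Finset.mem_Icc]
    exact ⟨⟨h1, h2⟩, ⟨h3, h4⟩, h5, h6⟩

theorem perc_one (hd : 0 < d) {ω : Config d} (hω : ∀ v, ω v = true) : PercolatesAt ω (fun _ => 0) := by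
  set i0 : Fin d := ⟨0, hd⟩
  let f : ℤ → Vtx d := fun t => Function.update (fun _ => 0) i0 t
  have hf : Function.Injective f := by
    intro a b h
    have := congrFun h i0
    simpa [f] using this
  refine ⟨range f, ⟨0, by simp [f]⟩, infinite_range_of_injective hf, fun u _ => hω u, ?_⟩
  rintro _ ⟨a, rfl⟩ _ ⟨b, rfl⟩
  refine ⟨(b - a).natAbs, fun i => f (a + (b - a).sign * i), by simp, ?_, ?_, fun i _ => ⟨_, rfl⟩⟩
  · show f _ = f b
    rw [Int.sign_mul_natAbs]
    congr 1
    ring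
  · intro i hi
    have h1 : f (a + (b - a).sign * ((i + 1 : ℕ) : ℤ)) =
        Function.update (f (a + (b - a).sign * i)) i0 (a + (b - a).sign * ((i + 1 : ℕ) : ℤ)) := by
      simp [f]
    show adj (f _) (f _)
    rw [h1]
    apply adj_update
    have h2 : f (a + (b - a).sign * i) i0 = a + (b - a).sign * i := by simp [f]
    rw [h2]
    push_cast
    rcases lt_trichotomy (b - a) 0 with h | h | h
    · rw [Int.sign_eq_neg_one_of_neg h]; right; ring
    · rw [h] at hi; simp at hi
    · rw [Int.sign_eq_one_of_pos h]; left; ring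

theorem main_aux (d : ℕ) (hd : 3 ≤ d)
    (ℙ : ℝ → Measure (Config d))
    (hP : ∀ q : ℝ, 0 ≤ q → q ≤ 1 → IsBernoulliFam q (ℙ q))
    (p : ℝ) (hp : pcSite d ℙ < p) (hp' : p < 1 - pcSite d ℙ) :
    ∃ δ : ℝ, 0 < δ ∧ ∃ k : ℕ, 1 ≤ k ∧ ∃ h₀ : ℕ, 2 ≤ h₀ ∧ Even h₀ ∧
      ∀ m : ℕ, 1 ≤ m →
        ℙ p {ω | ∃ ξ : ℕ → Bool,
            ¬ ∃ x ∈ lamBdry d k h₀ (m + 1), seesWordIn ω ξ (slabS d k h₀) x} ≤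
          ENNReal.ofReal (Real.exp (-(m : ℝ))) := by
  obtain ⟨q, ⟨⟨hq0, hq1⟩, hθ⟩, hqp⟩ : ∃ q ∈ {p : ℝ | p ∈ Set.Icc (0 : ℝ) 1 ∧
      0 < ℙ p {ω | PercolatesAt ω (fun _ => 0)}}, q < min p (1 - p) := by
    refine exists_lt_of_csInf_lt ?_ ?_
    · refine ⟨1, ⟨by norm_num, le_rfl⟩, ?_⟩
      have h1 := hP 1 zero_le_one le_rfl
      haveI := h1.1
      have h2 : ∀ v, ∀ᵐ ω ∂(ℙ 1), ω v = true := by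
        intro v
        have := h1.2 {v} (fun _ => true)
        simp only [Finset.mem_singleton, forall_eq, Finset.prod_singleton, if_true, ENNReal.ofReal_one] at this
        have hm : MeasurableSet {ω : Config d | ω v = true} :=
          (measurable_pi_apply (X := fun _ : Vtx d => Bool) v) (measurableSet_singleton true)
        exact (prob_compl_eq_zero_iff hm).2 this
      have h3 := ae_all_iff.2 h2
      have h4 : ∀ᵐ ω ∂(ℙ 1), ω ∈ {ω | PercolatesAt ω (fun _ => 0)} := h3.mono fun ω hω => perc_one (by omega) hω
      have h5 : {ω | PercolatesAt ω (fun _ => 0)} =ᵐ[ℙ 1] univ := Filter.eventuallyEq_univ.2 h4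
      rw [measure_congr h5]
      simp
    · exact lt_min hp (by unfold pcSite at hp'; linarith)
  have hqp1 : q < p := hqp.trans_le (min_le_left _ _)
  have hqp2 : q < 1 - p := hqp.trans_le (min_le_right _ _)
  have hqpos : 0 < q := by
    refine lt_of_le_of_ne hq0 fun h0 => hθ.ne' ?_
    subst h0
    have := (hP 0 hq0 hq1).2 {fun _ => 0} (fun _ => true)
    simp only [Finset.mem_singleton, forall_eq, Finset.prod_singleton, if_true, ENNReal.ofReal_zero] at this
    refine measure_mono_null ?_ this
    rintro ω ⟨C, h1, -, h2, -⟩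
    exact h2 _ h1
  obtain ⟨E, n, hg, hlt, hν, hε, hnb, hN, hn, hReg, hS1, hS2⟩ := exists_eng hd hqpos hqp1 hqp2
    (C1 hq0 hq1 (by omega) (hP q hq0 hq1) hθ)
  haveI := E.prob
  set k := n * (32 * (196608 * E.N) + 2) with hk
  have hk1 : 1 ≤ k := Nat.mul_pos (by omega) (by omega)
  have hp0 : 0 ≤ p := by linarith
  have hp1 : p ≤ 1 := by linarith
  refine ⟨1, one_pos, k, hk1, 10, by norm_num, ⟨5, rfl⟩, fun m hm => ?_⟩
  set B := lamBdry d k 10 (m + 1)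
  set A := (slabS d k 10 : Set (Vtx d))
  have hsub : {ω : Config d | ∃ ξ : ℕ → Bool, ¬ ∃ x ∈ B, seesWordIn ω ξ A x} ⊆ ⋃ L, BadL B A L := by
    rintro ω ⟨ξ, hξ⟩
    by_contra hc
    simp only [mem_iUnion, not_exists, BadL, mem_setOf_eq, not_not] at hc
    exact hξ (konig bdry_ball fun L => hc L ξ)
  refine (measure_mono hsub).trans ?_
  rw [(BadL_mono B A).measure_iUnion]
  refine iSup_le fun L => ?_
  haveI := bernMeas_prob hp0 hp1
  have hmeas : Measurable (fun o : Om => o.1) := measurable_of_countable _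
  have hmap : ℙ p = (PM (Vtx d) E.ν).map (fun u v => (u v).1) := by
    have := Measure.infinitePi_map_pi (μ := fun _ : Vtx d => E.ν) (f := fun _ (o : Om) => o.1) (fun _ => hmeas)
    rw [bern_eq hp0 hp1 (hP p hp0 hp1), PM, this]
    congr 1
    funext _
    exact hν.symm
  have hF : Measurable (fun (u : Vtx d → Om) v => (u v).1) :=
    measurable_pi_lambda _ fun v => hmeas.comp (measurable_pi_apply v)
  rw [hmap, Measure.map_apply hF (BadL_meas B A L)]
  haveI : IsProbabilityMeasure (PM (Vtx d) E.ν) := inferInstance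
  have := bad_prob hd hg hlt hε hnb hN hn hReg hS1 hS2 rfl hk hm L
  rw [← ENNReal.ofReal_toReal (measure_ne_top (PM (Vtx d) E.ν) _)]
  exact ENNReal.ofReal_le_ofReal this

end fin

/-- **All words from `∂Λ_{m+1}` in a slab** : for `d ≥ 3` and
`p ∈ (p_c^site(ℤ^d), 1 − p_c^site(ℤ^d))`, there exist `δ > 0`, an integer `k ≥ 1` and an
even `h₀ ≥ 2` such that for every `m ≥ 1`, the probability that some word is not seen
from any vertex of `∂Λ_{m+1}` within the slab `𝕊_{h₀}` is at most `e^{−m}`. -/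
theorem all_words_from_boundary_in_slab
    (d : ℕ) (hd : 3 ≤ d)
    (ℙ : ℝ → Measure (Config d))
    (hP : ∀ q : ℝ, 0 ≤ q → q ≤ 1 → IsBernoulliFam q (ℙ q))
    (p : ℝ) (hp : pcSite d ℙ < p) (hp' : p < 1 - pcSite d ℙ) :
    ∃ δ : ℝ, 0 < δ ∧ ∃ k : ℕ, 1 ≤ k ∧ ∃ h₀ : ℕ, 2 ≤ h₀ ∧ Even h₀ ∧
      ∀ m : ℕ, 1 ≤ m →
        ℙ p {ω | ∃ ξ : ℕ → Bool,
            ¬ ∃ x ∈ lamBdry d k h₀ (m + 1), seesWordIn ω ξ (slabS d k h₀) x} ≤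
          ENNReal.ofReal (Real.exp (-(m : ℝ))) := by
  exact main_aux d hd ℙ hP p hp hp'

end PercWords
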